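/- Let \overline{H} : ℝⁿ → ℝ be the deterministic effective Hamiltonian, i.e. a function such that for P-a.e. ω, \overline{H}(p,ω) = \overline{H}(p) for all p ∈ ℝⁿ. Then \overline{H} is convex, continuous and coercive. Moreover, let U ⊆ ℝⁿ be open and for each ε > 0 let u^ε(·,ω) : U → ℝ be an absolute subminimizer for H^ε(p,x,ω) := H(p, x/ε, ω) in U, and assume that for each ω the family {u^ε(·,ω)}_{ε>0} is locally uniformly bounded and locally uniformly Lipschitz in U. Then there is an event of full probability on which the function u^*(x,ω) := limsup_{ε→0} u^ε(x,ω) is an absolute subminimizer for \overline{H} in U. The analogous statement holds for absolute superminimizers, with u_*(x,ω) := liminf_{ε→0} u^ε(x,ω) being an absolute superminimizer for \overline{H} in U almost surely. -/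

import Mathlib

open MeasureTheory Filter Metric Set
open scoped NNReal

noncomputable section

/-- ℝⁿ as a Euclidean space. -/
abbrev Ed (n : ℕ) := EuclideanSpace ℝ (Fin n)

/-- The admissible set of levels `μ` in the definition of the random effective Hamiltonian. -/
def effSetR {n : ℕ} {Ω : Type*} (H : Ed n → Ed n → Ω → ℝ) (ω : Ω) (p : Ed n) : Set ℝ :=
  {μ : ℝ | ∃ w : Ed n → ℝ,
    (∃ K : ℝ≥0, LipschitzWith K w) ∧
    Tendsto (fun y : Ed n => w y / ‖y‖) (cocompact (Ed n)) (nhds 0) ∧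
    ∀ᵐ y ∂(volume : Measure (Ed n)), H (p + gradient w y) y ω ≤ μ}

/-- The random effective Hamiltonian `H̄(p, ω)`. -/
def effHR {n : ℕ} {Ω : Type*} (H : Ed n → Ed n → Ω → ℝ) (ω : Ω) (p : Ed n) : ℝ :=
  sInf (effSetR H ω p)

/-- `u` is an absolute subminimizer for the Hamiltonian `G = G(p,x)` in the open set `U`:
`u` is locally Lipschitz in `U`, and for every open `V` compactly contained in `U` and
Lipschitz `v` on `closure V` with `v ≤ u` in `V` and `v = u` on `∂V`, the essential supremum
of `G(∇u x, x)` over `V` is at most that of `G(∇v x, x)`. -/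
def AbsSubmin {n : ℕ} (G : Ed n → Ed n → ℝ) (U : Set (Ed n)) (u : Ed n → ℝ) : Prop :=
  (∀ x ∈ U, ∃ K : ℝ≥0, ∃ t ∈ nhdsWithin x U, LipschitzOnWith K u t) ∧
  ∀ V : Set (Ed n), IsOpen V → IsCompact (closure V) → closure V ⊆ U →
    ∀ v : Ed n → ℝ, (∃ K : ℝ≥0, LipschitzOnWith K v (closure V)) →
      (∀ x ∈ V, v x ≤ u x) → (∀ x ∈ frontier V, v x = u x) →
      essSup (fun x => ((G (gradient u x) x : ℝ) : EReal)) (volume.restrict V) ≤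
        essSup (fun x => ((G (gradient v x) x : ℝ) : EReal)) (volume.restrict V)

/-- `u` is an absolute superminimizer for `G` in `U`. -/
def AbsSupermin {n : ℕ} (G : Ed n → Ed n → ℝ) (U : Set (Ed n)) (u : Ed n → ℝ) : Prop :=
  (∀ x ∈ U, ∃ K : ℝ≥0, ∃ t ∈ nhdsWithin x U, LipschitzOnWith K u t) ∧
  ∀ V : Set (Ed n), IsOpen V → IsCompact (closure V) → closure V ⊆ U →
    ∀ v : Ed n → ℝ, (∃ K : ℝ≥0, LipschitzOnWith K v (closure V)) →
      (∀ x ∈ V, u x ≤ v x) → (∀ x ∈ frontier V, v x = u x) →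
      essSup (fun x => ((G (gradient u x) x : ℝ) : EReal)) (volume.restrict V) ≤
        essSup (fun x => ((G (gradient v x) x : ℝ) : EReal)) (volume.restrict V)

open scoped ENNReal

/-- A jointly measurable, measure preserving, ergodic action of `ℝⁿ`. -/
structure IsErgodicAction {n : ℕ} {Ω : Type*} [MeasurableSpace Ω] (P : Measure Ω)
    (τ : Ed n → Ω → Ω) : Prop where
  meas : Measurable (fun q : Ed n × Ω => τ q.1 q.2)
  mp : ∀ y, MeasurePreserving (τ y) P P
  add : ∀ y z ω, τ (y + z) ω = τ y (τ z ω)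
  zero : ∀ ω, τ 0 ω = ω
  erg : ∀ D : Set Ω, MeasurableSet D → (∀ z, τ z ⁻¹' D = D) → P D = 0 ∨ P D = 1

namespace IsErgodicAction

variable {n : ℕ} {Ω : Type*} [MeasurableSpace Ω] {P : Measure Ω} {τ : Ed n → Ω → Ω}

lemma meas_orbit (h : IsErgodicAction P τ) (ω : Ω) : Measurable (fun y => τ y ω) :=
  h.meas.comp (measurable_id.prodMk measurable_const)

lemma setLIntegral_shift (h : IsErgodicAction P τ) (F : Ω → ℝ≥0∞)
    (x : Ed n) (r : ℝ) (ω : Ω) :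
    ∫⁻ y in closedBall 0 r, F (τ y (τ x ω)) = ∫⁻ y in closedBall x r, F (τ y ω) := by
  have hpre : (fun y : Ed n => y + x) ⁻¹' closedBall x r = closedBall 0 r := by
    ext y; simp [dist_eq_norm]
  rw [← (measurePreserving_add_right volume x).setLIntegral_comp_preimage_emb
    (measurableEmbedding_addRight x) _ (closedBall x r), hpre]
  simp_rw [h.add]

lemma measurable_setLIntegral (h : IsErgodicAction P τ) {F : Ω → ℝ≥0∞} (hF : Measurable F)
    (r : ℝ) : Measurable (fun ω => ∫⁻ y in closedBall (0 : Ed n) r, F (τ y ω)) := by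
  have : Measurable (fun q : Ω × Ed n => F (τ q.2 q.1)) :=
    hF.comp (h.meas.comp measurable_swap)
  exact this.lintegral_prod_right'

lemma lintegral_setLIntegral [SFinite P] (h : IsErgodicAction P τ) {F : Ω → ℝ≥0∞}
    (hF : Measurable F) (r : ℝ) :
    ∫⁻ ω, (∫⁻ y in closedBall (0 : Ed n) r, F (τ y ω)) ∂P
      = volume (closedBall (0 : Ed n) r) * ∫⁻ ω, F ω ∂P := by
  rw [lintegral_lintegral_swap]
  · have : ∀ y, ∫⁻ ω, F (τ y ω) ∂P = ∫⁻ ω, F ω ∂P := fun y => (h.mp y).lintegral_comp hF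
    simp_rw [this]
    simp [mul_comm]
  · exact (hF.comp (h.meas.comp measurable_swap)).aemeasurable

/-- The points at which a ball average of radius at most `N` exceeds `c`. -/
def maxSet (τ : Ed n → Ω → Ω) (F : Ω → ℝ≥0∞) (c : ℝ≥0∞) (N : ℕ) : Set Ω :=
  {ω | ∃ R : ℕ, 0 < R ∧ R ≤ N ∧
    c * volume (closedBall (0 : Ed n) R) < ∫⁻ y in closedBall (0 : Ed n) R, F (τ y ω)}

lemma measurableSet_maxSet (h : IsErgodicAction P τ) {F : Ω → ℝ≥0∞} (hF : Measurable F)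
    (c : ℝ≥0∞) (N : ℕ) : MeasurableSet (maxSet τ F c N) := by
  have : maxSet τ F c N = ⋃ R : ℕ, ⋃ _ : 0 < R ∧ R ≤ N,
      {ω | c * volume (closedBall (0 : Ed n) R) < ∫⁻ y in closedBall (0 : Ed n) R, F (τ y ω)} := by
    ext ω; simp [maxSet, and_assoc]
  rw [this]
  refine MeasurableSet.iUnion fun R => MeasurableSet.iUnion fun _ => ?_
  exact measurableSet_lt measurable_const (h.measurable_setLIntegral hF _)

lemma covering_bound (h : IsErgodicAction P τ) {F : Ω → ℝ≥0∞}
    (c : ℝ≥0∞) (N : ℕ) (ω : Ω) :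
    c * volume {x : Ed n | x ∈ closedBall (0 : Ed n) N ∧ τ x ω ∈ maxSet τ F c N} ≤
      5 ^ n * ∫⁻ y in closedBall (0 : Ed n) (2 * N), F (τ y ω) := by
  set S := {x : Ed n | x ∈ closedBall (0 : Ed n) N ∧ τ x ω ∈ maxSet τ F c N} with hS
  have hx : ∀ x ∈ S, ∃ R : ℕ, 0 < R ∧ R ≤ N ∧
      c * volume (closedBall x R) < ∫⁻ y in closedBall x R, F (τ y ω) := by
    rintro x ⟨-, R, h0, hN, hlt⟩
    refine ⟨R, h0, hN, ?_⟩
    rw [h.setLIntegral_shift] at hlt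
    rwa [Measure.addHaar_closedBall_center]
  choose! r hr0 hrN hr using hx
  obtain ⟨v, hvS, hdisj, hcov⟩ := Vitali.exists_disjoint_subfamily_covering_enlargement_closedBall
    S (fun x => x) (fun x => (r x : ℝ)) N (fun a ha => by exact_mod_cast hrN a ha) 5 (by norm_num)
  have hvc : v.Countable := by
    refine hdisj.countable_of_nonempty_interior fun a ha => ?_
    refine ⟨a, ?_⟩
    rw [interior_closedBall _ (by have := hr0 a (hvS ha); positivity)]
    exact mem_ball_self (by exact_mod_cast hr0 a (hvS ha))
  have hsub : S ⊆ ⋃ b ∈ v, closedBall b (5 * r b) := by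
    intro a ha
    obtain ⟨b, hb, hab⟩ := hcov a ha
    exact mem_biUnion hb (hab (mem_closedBall_self (by positivity)))
  have hvol : ∀ b, volume (closedBall b (5 * r b)) = 5 ^ n * volume (closedBall b (r b : ℝ)) := by
    intro b
    rw [Measure.addHaar_closedBall_mul volume b (by norm_num) (by positivity)]
    simp [ENNReal.ofReal_pow, Measure.addHaar_closedBall_center]
  calc c * volume S ≤ c * ∑' b : v, volume (closedBall (b : Ed n) (5 * r b)) := by
        gcongr
        exact (measure_mono hsub).trans (measure_biUnion_le _ hvc _)
    _ = ∑' b : v, 5 ^ n * (c * volume (closedBall (b : Ed n) (r b))) := by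
        rw [← ENNReal.tsum_mul_left]
        congr 1; ext b; rw [hvol]; ring
    _ ≤ ∑' b : v, 5 ^ n * ∫⁻ y in closedBall (b : Ed n) (r b), F (τ y ω) := by
        refine ENNReal.tsum_le_tsum fun b => ?_
        gcongr
        exact (hr b (hvS b.2)).le
    _ = 5 ^ n * ∫⁻ y in ⋃ b ∈ v, closedBall b (r b), F (τ y ω) := by
        rw [ENNReal.tsum_mul_left, lintegral_biUnion hvc (fun _ _ => isClosed_closedBall.measurableSet)
          hdisj]
    _ ≤ _ := by
        gcongr
        refine iUnion₂_subset fun b hb => closedBall_subset_closedBall' ?_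
        have h1 := (hvS hb).1
        have h2 : (r b : ℝ) ≤ N := by exact_mod_cast hrN b (hvS hb)
        rw [mem_closedBall] at h1
        linarith

lemma maximal_le [IsProbabilityMeasure P] (h : IsErgodicAction P τ) {F : Ω → ℝ≥0∞}
    (hF : Measurable F) (c : ℝ≥0∞) (N : ℕ) :
    c * P (maxSet τ F c N) ≤ 10 ^ n * ∫⁻ ω, F ω ∂P := by
  rcases Nat.eq_zero_or_pos N with rfl | hN
  · have : maxSet τ F c 0 = ∅ := by
      ext ω; simp only [maxSet, mem_ofPred_eq, mem_empty_iff_false, iff_false]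
      rintro ⟨R, h1, h2, -⟩; omega
    simp [this]
  have hN' : (0 : ℝ) < N := by exact_mod_cast hN
  have hmE := h.measurableSet_maxSet hF c N
  have h1 := lintegral_mono (μ := P) (fun ω => h.covering_bound (F := F) c N ω)
  rw [lintegral_const_mul _ (h.measurable_setLIntegral hF _), h.lintegral_setLIntegral hF] at h1
  have h2 : ∀ ω, volume {x : Ed n | x ∈ closedBall (0 : Ed n) N ∧ τ x ω ∈ maxSet τ F c N} =
      ∫⁻ y in closedBall (0 : Ed n) N, (maxSet τ F c N).indicator 1 (τ y ω) := by
    intro ω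
    have hm : MeasurableSet ((fun y => τ y ω) ⁻¹' maxSet τ F c N) := h.meas_orbit ω hmE
    have : {x : Ed n | x ∈ closedBall (0 : Ed n) N ∧ τ x ω ∈ maxSet τ F c N} =
      ((fun y => τ y ω) ⁻¹' maxSet τ F c N) ∩ closedBall 0 N := by
      ext x; simp [and_comm]
    rw [this, ← Measure.restrict_apply hm, ← lintegral_indicator_one hm]
    rfl
  have hmi : Measurable ((maxSet τ F c N).indicator (1 : Ω → ℝ≥0∞)) :=
    measurable_one.indicator hmE
  simp_rw [h2] at h1
  rw [lintegral_const_mul _ (h.measurable_setLIntegral hmi _), h.lintegral_setLIntegral hmi,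
    lintegral_indicator_one hmE] at h1
  rw [Measure.addHaar_closedBall_mul volume (0 : Ed n) (by norm_num) hN'.le] at h1
  have hv0 : volume (closedBall (0 : Ed n) N) ≠ 0 := (measure_closedBall_pos _ _ hN').ne'
  have hvt : volume (closedBall (0 : Ed n) N) ≠ ⊤ := measure_closedBall_lt_top.ne
  have hpow : (10 : ℝ≥0∞) ^ n = 5 ^ n * 2 ^ n := by rw [← mul_pow]; norm_num
  rw [hpow]
  rw [← ENNReal.mul_le_mul_iff_right hv0 hvt]
  calc _ = c * (volume (closedBall (0 : Ed n) N) * P (maxSet τ F c N)) := by ring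
    _ ≤ _ := h1
    _ = _ := by simp [ENNReal.ofReal_pow]; ring

/-- Wiener's maximal inequality. -/
lemma maximal [IsProbabilityMeasure P] (h : IsErgodicAction P τ) {F : Ω → ℝ≥0∞}
    (hF : Measurable F) (c : ℝ≥0∞) :
    c * P {ω | ∃ R : ℕ, 0 < R ∧
      c * volume (closedBall (0 : Ed n) R) < ∫⁻ y in closedBall (0 : Ed n) R, F (τ y ω)} ≤
      10 ^ n * ∫⁻ ω, F ω ∂P := by
  have : {ω | ∃ R : ℕ, 0 < R ∧
      c * volume (closedBall (0 : Ed n) R) < ∫⁻ y in closedBall (0 : Ed n) R, F (τ y ω)} =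
      ⋃ N, maxSet τ F c N := by
    ext ω
    simp only [maxSet, mem_ofPred_eq, mem_iUnion]
    exact ⟨fun ⟨R, h0, h1⟩ => ⟨R, R, h0, le_rfl, h1⟩, fun ⟨N, R, h0, _, h1⟩ => ⟨R, h0, h1⟩⟩
  have hmono : Monotone (maxSet τ F c) := fun N M hNM ω ⟨R, h0, h1, h2⟩ => ⟨R, h0, h1.trans hNM, h2⟩
  rw [this, hmono.measure_iUnion, ENNReal.mul_iSup]
  exact iSup_le fun N => h.maximal_le hF c N

end IsErgodicAction

lemma inner_Lp_eq_integral {Ω : Type*} [MeasurableSpace Ω] {P : Measure Ω} (f g : Lp ℝ 2 P)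
    {f' g' : Ω → ℝ} (hf : f =ᵐ[P] f') (hg : g =ᵐ[P] g') :
    inner ℝ f g = ∫ ω, f' ω * g' ω ∂P := by
  rw [L2.inner_def]
  refine integral_congr_ae ?_
  filter_upwards [hf, hg] with ω h1 h2
  simp [h1, h2, mul_comm]

lemma memLp_two_of_bound {Ω : Type*} [MeasurableSpace Ω] {P : Measure Ω} [IsFiniteMeasure P]
    {F : Ω → ℝ} {B : ℝ} (hF : Measurable F) (hB : ∀ ω, |F ω| ≤ B) : MemLp F 2 P :=
  MemLp.of_bound hF.aestronglyMeasurable B (Eventually.of_forall hB)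

lemma integrable_of_abs_bound {Ω : Type*} [MeasurableSpace Ω] {P : Measure Ω} [IsFiniteMeasure P]
    {F : Ω → ℝ} {B : ℝ} (hF : Measurable F) (hB : ∀ ω, |F ω| ≤ B) : Integrable F P :=
  Integrable.of_bound hF.aestronglyMeasurable B (Eventually.of_forall hB)

/-- A sequence of asymptotically translation invariant probability measures, dominated by the
uniform distributions on balls. -/
structure IsFolner {n : ℕ} (ν : ℕ → Measure (Ed n)) : Prop where
  prob : ∀ k, IsProbabilityMeasure (ν k)
  dom : ∃ C : ℝ≥0, ∀ k, ∃ R : ℕ, 0 < R ∧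
    ν k ≤ ((C : ℝ≥0∞) / volume (closedBall (0 : Ed n) R)) • volume.restrict (closedBall 0 R)
  shift : ∀ a : Ed n, ∃ e : ℕ → ℝ, Tendsto e atTop (nhds 0) ∧ ∀ k (F : Ed n → ℝ) (B : ℝ),
    Measurable F → (∀ y, |F y| ≤ B) → |∫ y, F (y + a) ∂ν k - ∫ y, F y ∂ν k| ≤ B * e k

namespace IsErgodicAction

variable {n : ℕ} {Ω : Type*} [MeasurableSpace Ω] {P : Measure Ω} {τ : Ed n → Ω → Ω}

lemma ae_invariant_set [IsProbabilityMeasure P] (h : IsErgodicAction P τ) {D : Set Ω}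
    (hD : MeasurableSet D) (hinv : ∀ z, ∀ᵐ ω ∂P, τ z ω ∈ D ↔ ω ∈ D) :
    (∀ᵐ ω ∂P, ω ∈ D) ∨ (∀ᵐ ω ∂P, ω ∉ D) := by
  set D' : Set Ω := {ω | ∀ᵐ y : Ed n, τ y ω ∈ D} with hD'
  have hmeas : MeasurableSet {q : Ω × Ed n | τ q.2 q.1 ∈ D} := (h.meas.comp measurable_swap) hD
  have hmD' : MeasurableSet D' := by
    have := measurable_measure_prodMk_left (ν := (volume : Measure (Ed n))) hmeas.compl
    exact this (measurableSet_singleton 0)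
  have hstr : ∀ z, τ z ⁻¹' D' = D' := by
    intro z
    ext ω
    simp only [hD', mem_preimage, mem_ofPred_eq, ← h.add]
    have hq := (quasiMeasurePreserving_add_right (volume : Measure (Ed n)) z)
    have hq' := (quasiMeasurePreserving_add_right (volume : Measure (Ed n)) (-z))
    refine ⟨fun H => ?_, fun H => hq.ae H⟩
    simpa using hq'.ae H
  have hae : ∀ᵐ ω ∂P, (ω ∈ D' ↔ ω ∈ D) := by
    have hm2 : MeasurableSet {q : Ω × Ed n | τ q.2 q.1 ∈ D ↔ q.1 ∈ D} :=
      hmeas.iff (measurable_fst hD)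
    have h2 : ∀ᵐ ω ∂P, ∀ᵐ y : Ed n, (τ y ω ∈ D ↔ ω ∈ D) :=
      (Measure.ae_ae_comm hm2).2 (Eventually.of_forall hinv)
    filter_upwards [h2] with ω hω
    constructor
    · intro h1
      obtain ⟨y, hy⟩ := (hω.and h1).exists
      exact hy.1.1 hy.2
    · intro h1
      filter_upwards [hω] with y hy using hy.2 h1
  rcases h.erg D' hmD' hstr with h0 | h1
  · right
    have : ∀ᵐ ω ∂P, ω ∉ D' := by rwa [ae_iff, show {a | ¬ a ∉ D'} = D' by ext; simp]
    filter_upwards [hae, this] with ω a b using fun c => b (a.2 c)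
  · left
    have : ∀ᵐ ω ∂P, ω ∈ D' := (mem_ae_iff_prob_eq_one hmD').2 h1
    filter_upwards [hae, this] with ω a b using a.1 b

lemma ae_const_of_invariant [IsProbabilityMeasure P] (h : IsErgodicAction P τ) {g : Ω → ℝ}
    (hg : Measurable g) (hinv : ∀ z, (fun ω => g (τ z ω)) =ᵐ[P] g) : ∃ c, g =ᵐ[P] fun _ => c := by
  refine exists_eventuallyEq_const_of_forall_separating MeasurableSet fun U hU => ?_
  refine h.ae_invariant_set (hg hU) fun z => ?_
  filter_upwards [hinv z] with ω hω
  change g (τ z ω) ∈ U ↔ g ω ∈ U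
  rw [hω]

/-- Bounded functions all of whose orbit averages along Følner sequences vanish. -/
def nullAvg (τ : Ed n → Ω → Ω) : Submodule ℝ (Ω → ℝ) where
  carrier := {c | Measurable c ∧ (∃ B, ∀ ω, |c ω| ≤ B) ∧ ∀ ω (ν : ℕ → Measure (Ed n)), IsFolner ν →
    (∀ k, Integrable (fun y => c (τ y ω)) (ν k)) ∧
    Tendsto (fun k => ∫ y, c (τ y ω) ∂ν k) atTop (nhds 0)}
  zero_mem' := ⟨measurable_const, ⟨0, by simp⟩, fun ω ν _ => by simp⟩
  add_mem' := by
    rintro a b ⟨ha, ⟨A, hA⟩, ha'⟩ ⟨hb, ⟨B, hB⟩, hb'⟩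
    refine ⟨ha.add hb, ⟨A + B, fun ω => (abs_add_le _ _).trans (add_le_add (hA ω) (hB ω))⟩,
      fun ω ν hν => ⟨fun k => ((ha' ω ν hν).1 k).add ((hb' ω ν hν).1 k), ?_⟩⟩
    have := (ha' ω ν hν).2.add (hb' ω ν hν).2
    rw [add_zero] at this
    refine this.congr fun k => ?_
    rw [← integral_add ((ha' ω ν hν).1 k) ((hb' ω ν hν).1 k)]
    rfl
  smul_mem' := by
    rintro r a ⟨ha, ⟨A, hA⟩, ha'⟩
    refine ⟨ha.const_smul r, ⟨|r| * A, fun ω => ?_⟩,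
      fun ω ν hν => ⟨fun k => ((ha' ω ν hν).1 k).const_mul r, ?_⟩⟩
    · simp only [Pi.smul_apply, smul_eq_mul, abs_mul]
      exact mul_le_mul_of_nonneg_left (hA ω) (abs_nonneg _)
    · have := (ha' ω ν hν).2.const_mul r
      rw [mul_zero] at this
      refine this.congr fun k => ?_
      rw [← integral_const_mul]
      rfl

lemma coboundary_mem_nullAvg (h : IsErgodicAction P τ) {g : Ω → ℝ} {B : ℝ} (hg : Measurable g)
    (hB : ∀ ω, |g ω| ≤ B) (z : Ed n) (hz : Measurable (τ z)) :
    (fun ω => g (τ z ω) - g ω) ∈ nullAvg τ := by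
  refine ⟨(hg.comp hz).sub hg, ⟨B + B, fun ω => (abs_sub _ _).trans
    (add_le_add (hB _) (hB _))⟩, fun ω ν hν => ?_⟩
  have := hν.prob
  have hm : Measurable fun y => g (τ y ω) := hg.comp (h.meas_orbit ω)
  have hm' : Measurable fun y => g (τ z (τ y ω)) := (hg.comp hz).comp (h.meas_orbit ω)
  have i1 : ∀ k, Integrable (fun y => g (τ y ω)) (ν k) :=
    fun k => integrable_of_abs_bound hm (fun y => hB _)
  have i2 : ∀ k, Integrable (fun y => g (τ z (τ y ω))) (ν k) :=
    fun k => integrable_of_abs_bound hm' (fun y => hB _)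
  refine ⟨fun k => (i2 k).sub (i1 k), ?_⟩
  obtain ⟨e, he, hse⟩ := hν.shift z
  have h0 : Tendsto (fun k => B * e k) atTop (nhds 0) := by simpa using he.const_mul B
  refine squeeze_zero_norm (fun k => ?_) h0
  rw [integral_sub (i2 k) (i1 k), Real.norm_eq_abs]
  have := hse k (fun y => g (τ y ω)) B hm (fun y => hB _)
  simp_rw [add_comm _ z, h.add] at this
  exact this

/-- Density of null-average functions among the mean zero ones. -/
lemma exists_nullAvg_approx [IsProbabilityMeasure P] (h : IsErgodicAction P τ) {F : Ω → ℝ} {B : ℝ}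
    (hF : Measurable F) (hB : ∀ ω, |F ω| ≤ B) (h0 : ∫ ω, F ω ∂P = 0) {ε : ℝ} (hε : 0 < ε) :
    ∃ c ∈ nullAvg τ, ∫⁻ ω, ‖F ω - c ω‖ₑ ∂P ≤ ENNReal.ofReal ε := by
  have hmem : ∀ c ∈ nullAvg τ, MemLp c 2 P := fun c hc => by
    obtain ⟨hm, ⟨B, hB⟩, -⟩ := hc
    exact memLp_two_of_bound hm hB
  let K : Submodule ℝ (Lp ℝ 2 P) :=
    { carrier := {f | ∃ c ∈ nullAvg τ, f =ᵐ[P] c}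
      zero_mem' := ⟨0, Submodule.zero_mem _, Lp.coeFn_zero _ _ _⟩
      add_mem' := by
        rintro f g ⟨a, ha, hfa⟩ ⟨b, hb, hgb⟩
        exact ⟨a + b, Submodule.add_mem _ ha hb, (Lp.coeFn_add f g).trans (hfa.add hgb)⟩
      smul_mem' := by
        rintro r f ⟨a, ha, hfa⟩
        exact ⟨r • a, Submodule.smul_mem _ r ha, (Lp.coeFn_smul r f).trans (hfa.const_smul r)⟩ }
  have hFm := memLp_two_of_bound (P := P) hF hB
  have hFK : hFm.toLp F ∈ K.topologicalClosure := by
    rw [← Submodule.orthogonal_orthogonal_eq_closure]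
    intro f hf
    have hinvz : ∀ z, Lp.compMeasurePreserving (τ z) (h.mp z) f = f := by
      intro z
      have hcob : ∀ g : Lp ℝ 2 P,
          inner ℝ (Lp.compMeasurePreserving (τ z) (h.mp z) g - g) f = 0 := by
        intro g
        refine (Lp.simpleFunc.denseRange (E := ℝ) (p := 2) (μ := P) (by simp)).induction_on
          (p := fun g => inner ℝ (Lp.compMeasurePreserving (τ z) (h.mp z) g - g) f = 0) g ?_ ?_
        · refine isClosed_eq ?_ continuous_const
          refine Continuous.inner ?_ continuous_const
          exact (Lp.isometry_compMeasurePreserving (h.mp z)).continuous.sub continuous_id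
        · intro s
          refine hf _ ?_
          set s' := Lp.simpleFunc.toSimpleFunc s with hs'
          obtain ⟨B', hB'⟩ := s'.exists_forall_norm_le
          refine ⟨_, h.coboundary_mem_nullAvg (g := s') s'.measurable hB' z (h.mp z).measurable, ?_⟩
          have e1 := Lp.simpleFunc.toSimpleFunc_eq_toFun s
          have e2 := Lp.coeFn_compMeasurePreserving (s : Lp ℝ 2 P) (h.mp z)
          have e3 := (h.mp z).quasiMeasurePreserving.ae e1
          filter_upwards [e1, e2, e3, Lp.coeFn_sub (Lp.compMeasurePreserving (τ z) (h.mp z)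
            (s : Lp ℝ 2 P)) (s : Lp ℝ 2 P)] with ω a1 a2 a3 a4
          rw [a4, Pi.sub_apply, a2, Function.comp_apply, ← a3, ← a1]
      have h1 := hcob f
      rw [inner_sub_left] at h1
      have h2 : ‖Lp.compMeasurePreserving (τ z) (h.mp z) f‖ = ‖f‖ :=
        Lp.norm_compMeasurePreserving f (h.mp z)
      have h3 := norm_sub_sq_real (Lp.compMeasurePreserving (τ z) (h.mp z) f) f
      have h4 : inner ℝ f f = ‖f‖ ^ 2 := real_inner_self_eq_norm_sq f
      rw [h2] at h3
      have h5 : ‖Lp.compMeasurePreserving (τ z) (h.mp z) f - f‖ ^ 2 = 0 := by linarith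
      have h6 := pow_eq_zero_iff (two_ne_zero) |>.1 h5
      exact sub_eq_zero.1 (norm_eq_zero.1 h6)
    obtain ⟨f', hf', hff'⟩ := (Lp.aestronglyMeasurable f).aemeasurable
    obtain ⟨c, hc⟩ := h.ae_const_of_invariant hf' fun z => by
      have e1 := Lp.coeFn_compMeasurePreserving f (h.mp z)
      rw [hinvz z] at e1
      have e3 := (h.mp z).quasiMeasurePreserving.ae hff'
      filter_upwards [e1, e3, hff'] with ω a1 a2 a3
      rw [← a2, ← a3, a1]; rfl
    rw [inner_Lp_eq_integral f _ (hff'.trans hc) hFm.coeFn_toLp, integral_const_mul, h0, mul_zero]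
  obtain ⟨k, ⟨c, hc, hkc⟩, hd⟩ := Metric.mem_closure_iff.1 hFK ε hε
  refine ⟨c, hc, ?_⟩
  have hcm : Measurable c := hc.1
  have e1 : ∫⁻ ω, ‖F ω - c ω‖ₑ ∂P = eLpNorm (fun ω => F ω - c ω) 1 P := by
    rw [eLpNorm_one_eq_lintegral_enorm]
  rw [e1]
  refine (eLpNorm_le_eLpNorm_of_exponent_le (q := 2) (by norm_num)
    (hF.sub hcm).aestronglyMeasurable).trans ?_
  have e2 : eLpNorm (F - c) 2 P = edist (hFm.toLp F) k := by
    rw [Lp.edist_def]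
    refine eLpNorm_congr_ae ?_
    filter_upwards [hFm.coeFn_toLp, hkc] with ω a b
    simp [a, b]
  rw [e2, edist_dist]
  exact ENNReal.ofReal_le_ofReal hd.le

/-- The pointwise ergodic theorem along Følner sequences. -/
lemma tendsto_average [IsProbabilityMeasure P] (h : IsErgodicAction P τ) {F : Ω → ℝ} {B : ℝ}
    (hF : Measurable F) (hB : ∀ ω, |F ω| ≤ B) :
    ∀ᵐ ω ∂P, ∀ ν : ℕ → Measure (Ed n), IsFolner ν →
      Tendsto (fun k => ∫ y, F (τ y ω) ∂ν k) atTop (nhds (∫ ω, F ω ∂P)) := by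
  set m := ∫ ω, F ω ∂P with hm
  have hFi : Integrable F P := integrable_of_abs_bound hF hB
  have hap : ∀ j : ℕ, ∃ c ∈ nullAvg τ,
      ∫⁻ ω, ‖F ω - m - c ω‖ₑ ∂P ≤ ENNReal.ofReal ((1 / 4) ^ j) := fun j =>
    h.exists_nullAvg_approx (F := fun ω => F ω - m) (B := B + |m|) (hF.sub_const m)
      (fun ω => (abs_sub _ _).trans (by gcongr; exact hB ω))
      (by rw [integral_sub hFi (integrable_const _)]; simp [hm]) (by positivity)
  choose c hc hcF using hap
  have hrm : ∀ j, Measurable fun ω => ‖F ω - m - c j ω‖ₑ := fun j =>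
    ((hF.sub_const m).sub (hc j).1).enorm
  let D : ℕ → Set Ω := fun j => {ω | ∃ R : ℕ, 0 < R ∧
      ENNReal.ofReal ((1 / 2) ^ j) * volume (closedBall (0 : Ed n) R) <
        ∫⁻ y in closedBall (0 : Ed n) R, ‖F (τ y ω) - m - c j (τ y ω)‖ₑ}
  have hD : ∀ j, P (D j) ≤ 10 ^ n * ENNReal.ofReal ((1 / 2) ^ j) := by
    intro j
    have h1 := (h.maximal (hrm j) (ENNReal.ofReal ((1 / 2) ^ j))).trans
      (mul_le_mul_right (hcF j) _)
    have hp : (0 : ℝ) < (1 / 2) ^ j := by positivity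
    have h2 : ENNReal.ofReal ((1 / 4) ^ j) =
        ENNReal.ofReal ((1 / 2) ^ j) * ENNReal.ofReal ((1 / 2) ^ j) := by
      rw [← ENNReal.ofReal_mul hp.le, ← mul_pow]; norm_num
    rw [h2, ← mul_assoc, mul_comm (10 ^ n), mul_assoc] at h1
    exact (ENNReal.mul_le_mul_iff_right (ENNReal.ofReal_pos.2 hp).ne' ENNReal.ofReal_ne_top).1 h1
  have hsum : ∑' j, P (D j) ≠ ⊤ := by
    refine ne_top_of_le_ne_top ?_ (ENNReal.tsum_le_tsum hD)
    rw [ENNReal.tsum_mul_left, ← ENNReal.ofReal_tsum_of_nonneg (fun j => by positivity)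
      (summable_geometric_of_lt_one (by norm_num) (by norm_num))]
    exact ENNReal.mul_ne_top (by finiteness) ENNReal.ofReal_ne_top
  filter_upwards [ae_eventually_notMem hsum] with ω hω ν hν
  obtain ⟨C, hC⟩ := hν.dom
  have := hν.prob
  have hFy : ∀ k, Integrable (fun y => F (τ y ω)) (ν k) := fun k =>
    integrable_of_abs_bound (hF.comp (h.meas_orbit ω)) (fun y => hB _)
  have hrem : ∀ j, ω ∉ D j → ∀ k,
      |∫ y, (F (τ y ω) - m - c j (τ y ω)) ∂ν k| ≤ C * (1 / 2) ^ j := by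
    intro j hj k
    obtain ⟨R, hR, hle⟩ := hC k
    have h1 : ∫⁻ y in closedBall (0 : Ed n) R, ‖F (τ y ω) - m - c j (τ y ω)‖ₑ ≤
        ENNReal.ofReal ((1 / 2) ^ j) * volume (closedBall (0 : Ed n) R) := by
      by_contra hcon
      exact hj ⟨R, hR, not_le.1 hcon⟩
    have hR' : (0 : ℝ) < R := by exact_mod_cast hR
    have hv0 : volume (closedBall (0 : Ed n) R) ≠ 0 := (measure_closedBall_pos _ _ hR').ne'
    have hvt : volume (closedBall (0 : Ed n) R) ≠ ⊤ := measure_closedBall_lt_top.ne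
    have h2 : ∫⁻ y, ‖F (τ y ω) - m - c j (τ y ω)‖ₑ ∂ν k ≤ ENNReal.ofReal (C * (1 / 2) ^ j) := by
      calc _ ≤ ∫⁻ y, ‖F (τ y ω) - m - c j (τ y ω)‖ₑ
            ∂(((C : ℝ≥0∞) / volume (closedBall (0 : Ed n) R)) •
              volume.restrict (closedBall (0 : Ed n) R)) := lintegral_mono' hle le_rfl
        _ ≤ ((C : ℝ≥0∞) / volume (closedBall (0 : Ed n) R)) *
            (ENNReal.ofReal ((1 / 2) ^ j) * volume (closedBall (0 : Ed n) R)) := by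
            rw [lintegral_smul_measure, smul_eq_mul]; gcongr
        _ = C * ENNReal.ofReal ((1 / 2) ^ j) := by
            rw [mul_comm (ENNReal.ofReal _), ← mul_assoc, ENNReal.div_mul_cancel hv0 hvt]
        _ = _ := by rw [ENNReal.ofReal_mul C.coe_nonneg, ENNReal.ofReal_coe_nnreal]
    have h3 := enorm_integral_le_lintegral_enorm (μ := ν k)
      (fun y => F (τ y ω) - m - c j (τ y ω))
    have h4 := h3.trans h2
    rw [← ofReal_norm, ENNReal.ofReal_le_ofReal_iff (by positivity)] at h4
    exact h4
  rw [Metric.tendsto_atTop]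
  intro ε hε
  have hlim : Tendsto (fun j : ℕ => (C : ℝ) * (1 / 2) ^ j) atTop (nhds 0) := by
    simpa using (tendsto_pow_atTop_nhds_zero_of_lt_one (r := (1 / 2 : ℝ)) (by norm_num)
      (by norm_num)).const_mul (C : ℝ)
  obtain ⟨j, hj1, hj2⟩ := (hω.and (hlim.eventually (gt_mem_nhds (half_pos hε)))).exists
  obtain ⟨hci, hct⟩ := (hc j).2.2 ω ν hν
  obtain ⟨N, hN⟩ := Metric.tendsto_atTop.1 hct (ε / 2) (half_pos hε)
  refine ⟨N, fun k hk => ?_⟩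
  have h1 := hrem j hj1 k
  have h2 := hN k hk
  have hFm : Integrable (fun y => F (τ y ω) - m) (ν k) := (hFy k).sub (integrable_const _)
  rw [integral_sub hFm (hci k), integral_sub (hFy k) (integrable_const _)] at h1
  simp only [integral_const, probReal_univ, one_smul] at h1
  rw [Real.dist_eq] at h2 ⊢
  rw [abs_lt] at h2 ⊢
  rw [abs_le] at h1
  constructor <;> linarith [h1.1, h1.2, h2.1, h2.2]

end IsErgodicAction

section Tubes
variable {n : ℕ}

/-- The average of the uniform distributions on the balls of radius `r` centred at
`a, a + z, …, a + (K - 1) z`. -/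
def tubeMeasure (a z : Ed n) (K : ℕ) (r : ℝ) : Measure (Ed n) :=
  (K : ℝ≥0∞)⁻¹ • ∑ j ∈ Finset.range K,
    (volume (closedBall (0 : Ed n) r))⁻¹ • volume.restrict (closedBall (a + (j : ℝ) • z) r)

lemma isProbabilityMeasure_tubeMeasure (a z : Ed n) {K : ℕ} (hK : 0 < K) {r : ℝ} (hr : 0 < r) :
    IsProbabilityMeasure (tubeMeasure a z K r) := by
  constructor
  have hv0 : volume (closedBall (0 : Ed n) r) ≠ 0 := (measure_closedBall_pos _ _ hr).ne'
  have hvt : volume (closedBall (0 : Ed n) r) ≠ ⊤ := measure_closedBall_lt_top.ne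
  have hc : ∀ c : Ed n, volume (closedBall c r) = volume (closedBall (0 : Ed n) r) := fun c =>
    Measure.addHaar_closedBall_center _ _ _
  simp only [tubeMeasure, Measure.smul_apply, Measure.coe_finsetSum, Finset.sum_apply,
    Measure.restrict_apply_univ, hc, smul_eq_mul, ENNReal.inv_mul_cancel hv0 hvt]
  simp only [Finset.sum_const, Finset.card_range, nsmul_eq_mul, mul_one]
  exact ENNReal.inv_mul_cancel (by exact_mod_cast hK.ne') (by simp)

lemma tubeMeasure_absolutelyContinuous (a z : Ed n) (K : ℕ) (r : ℝ) :
    tubeMeasure a z K r ≪ volume := by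
  unfold tubeMeasure
  refine Measure.AbsolutelyContinuous.smul_left ?_ _
  refine Measure.AbsolutelyContinuous.mk fun s _ hs => ?_
  simp only [Measure.coe_finsetSum, Finset.sum_apply]
  refine Finset.sum_eq_zero fun j _ => ?_
  rw [Measure.smul_apply, Measure.absolutelyContinuous_of_le Measure.restrict_le_self hs, smul_zero]

lemma setIntegral_closedBall_shift (G : Ed n → ℝ) (c : Ed n) (r : ℝ) :
    ∫ y in closedBall c r, G y = ∫ y in closedBall (0 : Ed n) r, G (y + c) := by
  have hpre : (fun y : Ed n => y + c) ⁻¹' closedBall c r = closedBall 0 r := by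
    ext y; simp [dist_eq_norm]
  rw [← (measurePreserving_add_right volume c).setIntegral_preimage_emb
    (measurableEmbedding_addRight c) _ (closedBall c r), hpre]

lemma integral_tubeMeasure {G : Ed n → ℝ} (a z : Ed n) (K : ℕ) {r : ℝ} (hr : 0 < r)
    (hG : ∀ c, IntegrableOn G (closedBall c r)) :
    ∫ y, G y ∂tubeMeasure a z K r = (K : ℝ)⁻¹ * ∑ j ∈ Finset.range K,
      (volume.real (closedBall (0 : Ed n) r))⁻¹ *
        ∫ y in closedBall (a + (j : ℝ) • z) r, G y := by
  have hv0 : volume (closedBall (0 : Ed n) r) ≠ 0 := (measure_closedBall_pos _ _ hr).ne'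
  unfold tubeMeasure
  rw [integral_smul_measure, integral_finsetSum_measure]
  · simp [integral_smul_measure, Measure.real]
  · intro j _
    exact (hG _).smul_measure (ENNReal.inv_ne_top.2 hv0)

lemma telescoping_tubeMeasure {ϕ : Ed n → ℝ} {L : ℝ≥0} (hϕ : LipschitzWith L ϕ) (a z : Ed n)
    {K : ℕ} (hK : 0 < K) {r : ℝ} (hr : 0 < r) :
    |∫ y, (ϕ (y + z) - ϕ y) ∂tubeMeasure a z K r - (ϕ (a + (K : ℝ) • z) - ϕ a) / K| ≤
      2 * L * r / K := by
  have hc : Continuous ϕ := hϕ.continuous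
  have hint : ∀ (b c : Ed n), IntegrableOn (fun y => ϕ (y + b)) (closedBall c r) := fun b c =>
    (hc.comp (continuous_add_const b)).continuousOn.integrableOn_compact (isCompact_closedBall c r)
  have hG : ∀ c, IntegrableOn (fun y => ϕ (y + z) - ϕ y) (closedBall c r) := fun c => by
    refine (hint z c).sub ?_
    simpa using hint 0 c
  have hKR : (0 : ℝ) < K := by exact_mod_cast hK
  set vv := volume.real (closedBall (0 : Ed n) r) with hvv
  have hv : 0 < vv := ENNReal.toReal_pos (measure_closedBall_pos _ _ hr).ne'
    measure_closedBall_lt_top.ne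
  have h1 : ∑ j ∈ Finset.range K, vv⁻¹ * ∫ y in closedBall (a + (j : ℝ) • z) r,
      (ϕ (y + z) - ϕ y) =
      vv⁻¹ * ∫ y in closedBall (0 : Ed n) r, (ϕ (y + (a + (K : ℝ) • z)) - ϕ (y + a)) := by
    rw [← Finset.mul_sum]
    congr 1
    have h2 : ∀ j : ℕ, ∫ y in closedBall (a + (j : ℝ) • z) r, (ϕ (y + z) - ϕ y) =
        (∫ y in closedBall (0 : Ed n) r, ϕ (y + (a + ((j + 1 : ℕ) : ℝ) • z))) -
        ∫ y in closedBall (0 : Ed n) r, ϕ (y + (a + (j : ℝ) • z)) := by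
      intro j
      rw [setIntegral_closedBall_shift, ← integral_sub (hint _ _) (hint _ _)]
      congr 1; ext y
      congr 2
      push_cast; module
    simp_rw [h2]
    rw [Finset.sum_range_sub (fun j : ℕ => ∫ y in closedBall (0 : Ed n) r,
      ϕ (y + (a + (j : ℝ) • z)))]
    rw [integral_sub (hint _ _) (hint _ _)]
    simp
  rw [integral_tubeMeasure a z K hr hG, h1]
  have h3 : (K : ℝ)⁻¹ * (vv⁻¹ * ∫ y in closedBall (0 : Ed n) r,
        (ϕ (y + (a + (K : ℝ) • z)) - ϕ (y + a))) - (ϕ (a + (K : ℝ) • z) - ϕ a) / K =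
      (K : ℝ)⁻¹ * (vv⁻¹ * ∫ y in closedBall (0 : Ed n) r,
        ((ϕ (y + (a + (K : ℝ) • z)) - ϕ (y + a)) - (ϕ (a + (K : ℝ) • z) - ϕ a))) := by
    have hd : IntegrableOn (fun y => ϕ (y + (a + (K : ℝ) • z)) - ϕ (y + a))
      (closedBall (0 : Ed n) r) := (hint _ _).sub (hint _ _)
    rw [integral_sub hd (integrableOn_const measure_closedBall_lt_top.ne)]
    simp only [setIntegral_const, smul_eq_mul, ← hvv]
    field_simp
  rw [h3, abs_mul, abs_mul, abs_of_pos (inv_pos.2 hKR), abs_of_pos (inv_pos.2 hv)]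
  have h4 : ‖∫ y in closedBall (0 : Ed n) r,
      ((ϕ (y + (a + (K : ℝ) • z)) - ϕ (y + a)) - (ϕ (a + (K : ℝ) • z) - ϕ a))‖ ≤
      (2 * L * r) * vv := by
    refine norm_setIntegral_le_of_norm_le_const measure_closedBall_lt_top fun y hy => ?_
    rw [mem_closedBall_zero_iff] at hy
    have e1 := hϕ.dist_le_mul (y + (a + (K : ℝ) • z)) (a + (K : ℝ) • z)
    have e2 := hϕ.dist_le_mul (y + a) a
    rw [Real.dist_eq, dist_eq_norm, add_sub_cancel_right] at e1 e2
    have e3 : (L : ℝ) * ‖y‖ ≤ L * r := by gcongr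
    rw [Real.norm_eq_abs]
    rw [abs_le] at e1 e2 ⊢
    constructor <;> linarith [e1.1, e1.2, e2.1, e2.2]
  rw [Real.norm_eq_abs] at h4
  calc _ ≤ (K : ℝ)⁻¹ * (vv⁻¹ * ((2 * L * r) * vv)) := by gcongr
    _ = _ := by field_simp

lemma abs_setIntegral_closedBall_shift_sub_le {F : Ed n → ℝ} {B : ℝ} (hF : Measurable F)
    (hB : ∀ y, |F y| ≤ B) (a c : Ed n) {r : ℝ} (hr : 0 < r) :
    |(∫ y in closedBall c r, F (y + a)) - ∫ y in closedBall c r, F y| ≤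
      2 * B * ((1 + ‖a‖ / r) ^ n - 1) * volume.real (closedBall (0 : Ed n) r) := by
  have hi : ∀ c' r', IntegrableOn F (closedBall c' r') := fun c' r' => by
    have : IsFiniteMeasure (volume.restrict (closedBall c' r')) :=
      ⟨by simpa using measure_closedBall_lt_top⟩
    exact integrable_of_abs_bound hF hB
  have key : ∀ c', closedBall c' r ⊆ closedBall c (r + ‖a‖) →
      |(∫ y in closedBall c (r + ‖a‖), F y) - ∫ y in closedBall c' r, F y| ≤
      B * ((1 + ‖a‖ / r) ^ n - 1) * volume.real (closedBall (0 : Ed n) r) := by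
    intro c' hsub
    rw [← setIntegral_sdiff (isClosed_closedBall.measurableSet) (hi _ _) hsub, ← Real.norm_eq_abs]
    have h1 : ‖∫ y in closedBall c (r + ‖a‖) \ closedBall c' r, F y‖ ≤
        B * volume.real (closedBall c (r + ‖a‖) \ closedBall c' r) :=
      norm_setIntegral_le_of_norm_le_const
        ((measure_mono sdiff_subset).trans_lt measure_closedBall_lt_top) fun y _ => hB y
    refine h1.trans (le_of_eq ?_)
    rw [measureReal_sdiff hsub isClosed_closedBall.measurableSet measure_closedBall_lt_top.ne]
    have h2 : r + ‖a‖ = (1 + ‖a‖ / r) * r := by field_simp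
    have h3 : (0 : ℝ) ≤ 1 + ‖a‖ / r := by positivity
    have h4 : volume.real (closedBall c (r + ‖a‖)) =
        (1 + ‖a‖ / r) ^ n * volume.real (closedBall (0 : Ed n) r) := by
      rw [h2, Measure.real, Measure.addHaar_closedBall_mul volume c h3 hr.le]
      simp [Measure.real, ENNReal.toReal_ofReal (pow_nonneg h3 n)]
    have h5 : volume.real (closedBall c' r) = volume.real (closedBall (0 : Ed n) r) := by
      rw [Measure.real, Measure.addHaar_closedBall_center, ← Measure.real]
    rw [h4, h5]
    ring
  have e1 : ∫ y in closedBall c r, F (y + a) = ∫ y in closedBall (c + a) r, F y := by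
    rw [setIntegral_closedBall_shift, setIntegral_closedBall_shift F (c + a)]
    simp [add_assoc]
  have k1 := key (c + a) (closedBall_subset_closedBall' (by simp [dist_eq_norm]))
  have k2 := key c (closedBall_subset_closedBall (by linarith [norm_nonneg a]))
  rw [e1]
  rw [abs_le] at k1 k2 ⊢
  constructor <;> linarith [k1.1, k1.2, k2.1, k2.2]

lemma isFolner_tubeMeasure {a : ℕ → Ed n} (z : Ed n) {K : ℕ → ℕ} {η M : ℝ} (hη : 0 < η)
    (hM : 0 ≤ M) (hK : ∀ k, 0 < K k) (hKt : Tendsto K atTop atTop)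
    (ha : ∀ k, ‖a k‖ ≤ M * K k) :
    IsFolner fun k => tubeMeasure (a k) z (K k) (η * K k) where
  prob k := isProbabilityMeasure_tubeMeasure _ _ (hK k)
    (mul_pos hη (by exact_mod_cast hK k))
  dom := by
    set A : ℝ := (M + ‖z‖ + η + 1) / η with hA
    have hA0 : 0 ≤ A := by positivity
    refine ⟨Real.toNNReal (A ^ n), fun k => ⟨⌈(M + ‖z‖ + η) * K k⌉₊, ?_, ?_⟩⟩
    · have : (0 : ℝ) < K k := by exact_mod_cast hK k
      exact Nat.ceil_pos.2 (by positivity)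
    · set R : ℕ := ⌈(M + ‖z‖ + η) * K k⌉₊ with hR
      have hKk : (0 : ℝ) < K k := by exact_mod_cast hK k
      have hKk1 : (1 : ℝ) ≤ K k := by exact_mod_cast hK k
      have hR1 : (M + ‖z‖ + η) * K k ≤ R := Nat.le_ceil _
      have hR2 : (R : ℝ) ≤ A * (η * K k) := by
        have := Nat.ceil_lt_add_one (a := (M + ‖z‖ + η) * K k) (by positivity)
        have e : A * (η * K k) = (M + ‖z‖ + η) * K k + K k := by
          rw [hA]; field_simp
        rw [e]; rw [← hR] at this; linarith
      have hR0 : (0 : ℝ) < R := lt_of_lt_of_le (by positivity) hR1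
      set r := η * K k with hr
      have hr0 : 0 < r := by positivity
      have hv0 : volume (closedBall (0 : Ed n) r) ≠ 0 := (measure_closedBall_pos _ _ hr0).ne'
      have hvt : volume (closedBall (0 : Ed n) r) ≠ ⊤ := measure_closedBall_lt_top.ne
      have hV0 : volume (closedBall (0 : Ed n) R) ≠ 0 := (measure_closedBall_pos _ _ hR0).ne'
      have hVt : volume (closedBall (0 : Ed n) R) ≠ ⊤ := measure_closedBall_lt_top.ne
      have hsub : ∀ j ∈ Finset.range (K k), closedBall (a k + (j : ℝ) • z) r ⊆ closedBall 0 R := by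
        intro j hj
        refine closedBall_subset_closedBall' ?_
        rw [dist_zero_right]
        have hj' : (j : ℝ) ≤ K k := by exact_mod_cast (Finset.mem_range.1 hj).le
        have : ‖a k + (j : ℝ) • z‖ ≤ M * K k + K k * ‖z‖ := by
          refine (norm_add_le _ _).trans (add_le_add (ha k) ?_)
          rw [norm_smul, Real.norm_of_nonneg (by positivity)]
          gcongr
        nlinarith [this, hR1]
      have hle1 : tubeMeasure (a k) z (K k) r ≤
          (volume (closedBall (0 : Ed n) r))⁻¹ • volume.restrict (closedBall (0 : Ed n) R) := by
        refine Measure.le_iff.2 fun s hs => ?_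
        simp only [tubeMeasure, Measure.smul_apply, Measure.coe_finsetSum, Finset.sum_apply,
          smul_eq_mul]
        calc _ ≤ ((K k : ℕ) : ℝ≥0∞)⁻¹ * ∑ j ∈ Finset.range (K k),
              (volume (closedBall (0 : Ed n) r))⁻¹ * volume.restrict (closedBall (0 : Ed n) R) s := by
              gcongr with j hj
              exact hsub j hj
          _ = _ := by
              rw [Finset.sum_const, Finset.card_range, nsmul_eq_mul, ← mul_assoc,
                ENNReal.inv_mul_cancel (by exact_mod_cast (hK k).ne') (by simp), one_mul]
      refine hle1.trans ?_
      have hvol : volume (closedBall (0 : Ed n) R) ≤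
          ENNReal.ofReal (A ^ n) * volume (closedBall (0 : Ed n) r) := by
        calc _ ≤ volume (closedBall (0 : Ed n) (A * r)) :=
              measure_mono (closedBall_subset_closedBall hR2)
          _ = _ := by
              rw [Measure.addHaar_closedBall_mul volume _ hA0 hr0.le]; simp
      have hcoef : (volume (closedBall (0 : Ed n) r))⁻¹ ≤
          (Real.toNNReal (A ^ n) : ℝ≥0∞) / volume (closedBall (0 : Ed n) R) := by
        rw [ENNReal.le_div_iff_mul_le (Or.inl hV0) (Or.inl hVt), mul_comm, ← div_eq_mul_inv]
        exact ENNReal.div_le_of_le_mul hvol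
      refine Measure.le_iff.2 fun s _ => ?_
      simp only [Measure.smul_apply, smul_eq_mul]
      gcongr
  shift b := by
    refine ⟨fun k => 2 * ((1 + ‖b‖ / (η * K k)) ^ n - 1), ?_, fun k F B hF hB => ?_⟩
    · have h1 : Tendsto (fun k => η * (K k : ℝ)) atTop atTop :=
        (tendsto_natCast_atTop_atTop.comp hKt).const_mul_atTop hη
      have h2 : Tendsto (fun k => ‖b‖ / (η * (K k : ℝ))) atTop (nhds 0) := h1.const_div_atTop _
      simpa using (((h2.const_add 1).pow n).sub_const 1).const_mul 2
    · have hKk : (0 : ℝ) < K k := by exact_mod_cast hK k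
      set r := η * K k with hr
      have hr0 : 0 < r := by positivity
      have hi : ∀ G : Ed n → ℝ, Measurable G → (∀ y, |G y| ≤ B) →
          ∀ c', IntegrableOn G (closedBall c' r) := fun G hG hGB c' => by
        have : IsFiniteMeasure (volume.restrict (closedBall c' r)) :=
          ⟨by simpa using measure_closedBall_lt_top⟩
        exact integrable_of_abs_bound hG hGB
      rw [integral_tubeMeasure _ _ _ hr0 (hi F hF hB), integral_tubeMeasure _ _ _ hr0
        (hi (fun y => F (y + b)) (hF.comp (measurable_add_const b)) (fun y => hB _)),
        ← mul_sub, ← Finset.sum_sub_distrib]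
      set vv := volume.real (closedBall (0 : Ed n) r) with hvv
      have hv : 0 < vv := ENNReal.toReal_pos (measure_closedBall_pos _ _ hr0).ne'
        measure_closedBall_lt_top.ne
      rw [abs_mul, abs_of_pos (inv_pos.2 hKk)]
      calc _ ≤ (K k : ℝ)⁻¹ * ∑ j ∈ Finset.range (K k), 2 * B * ((1 + ‖b‖ / r) ^ n - 1) := by
            gcongr
            refine (Finset.abs_sum_le_sum_abs _ _).trans (Finset.sum_le_sum fun j _ => ?_)
            rw [← mul_sub, abs_mul, abs_of_pos (inv_pos.2 hv), inv_mul_le_iff₀ hv, mul_comm vv]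
            exact abs_setIntegral_closedBall_shift_sub_le hF hB b _ hr0
        _ = _ := by
            rw [Finset.sum_const, Finset.card_range, nsmul_eq_mul, ← mul_assoc,
              inv_mul_cancel₀ hKk.ne']
            ring

end Tubes

set_option linter.unusedSectionVars false

section TestSpace
variable {n : ℕ} {Ω : Type*} [MeasurableSpace Ω] {P : Measure Ω} {τ : Ed n → Ω → Ω}

lemma IsErgodicAction.integrable_orbit (h : IsErgodicAction P τ) {F : Ω → ℝ} {B : ℝ}
    (hF : Measurable F) (hB : ∀ ω, |F ω| ≤ B) (μ : Measure (Ed n)) [IsFiniteMeasure μ] (ω : Ω) :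
    Integrable (fun y => F (τ y ω)) μ :=
  integrable_of_abs_bound (hF.comp (h.meas_orbit ω)) fun _ => hB _

/-- Orbit averages of `f` at `ω` along Følner sequences converge to the mean of `f`. -/
def AvgConverges (P : Measure Ω) (τ : Ed n → Ω → Ω) (ω : Ω) (f : Ω → ℝ) : Prop :=
  ∀ ν : ℕ → Measure (Ed n), IsFolner ν →
    Tendsto (fun k => ∫ y, f (τ y ω) ∂ν k) atTop (nhds (∫ ω', f ω' ∂P))

/-- A space of bounded measurable functions, closed under products, absolute values and shifts. -/
structure IsTestSpace (τ : Ed n → Ω → Ω) (V : Submodule ℝ (Ω → ℝ)) : Prop where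
  meas : ∀ f ∈ V, Measurable f
  bdd : ∀ f ∈ V, ∃ B, ∀ ω, |f ω| ≤ B
  one : (fun _ => 1) ∈ V
  mul : ∀ f ∈ V, ∀ g ∈ V, (fun ω => f ω * g ω) ∈ V
  abs : ∀ f ∈ V, (fun ω => |f ω|) ∈ V
  shift : ∀ f ∈ V, ∀ z, (fun ω => f (τ z ω)) ∈ V

/-- Bounded measurable functions which are uniformly continuous along orbits. -/
structure IsTestFun (τ : Ed n → Ω → Ω) (f : Ω → ℝ) : Prop where
  meas : Measurable f
  bdd : ∃ B, 0 < B ∧ ∀ ω, |f ω| ≤ B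
  uc : ∀ ε > 0, ∃ δ > 0, ∀ y : Ed n, ‖y‖ < δ → ∀ ω, |f (τ y ω) - f ω| ≤ ε

namespace IsTestFun

lemma add {f g : Ω → ℝ} (hf : IsTestFun τ f) (hg : IsTestFun τ g) :
    IsTestFun τ fun ω => f ω + g ω where
  meas := hf.meas.add hg.meas
  bdd := by
    obtain ⟨A, hA0, hA⟩ := hf.bdd
    obtain ⟨B, hB0, hB⟩ := hg.bdd
    exact ⟨A + B, by positivity, fun ω => (abs_add_le _ _).trans (add_le_add (hA ω) (hB ω))⟩
  uc ε hε := by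
    obtain ⟨d, hd, h1⟩ := hf.uc (ε / 2) (half_pos hε)
    obtain ⟨d', hd', h2⟩ := hg.uc (ε / 2) (half_pos hε)
    refine ⟨min d d', lt_min hd hd', fun y hy ω => ?_⟩
    have a := h1 y (hy.trans_le (min_le_left _ _)) ω
    have b := h2 y (hy.trans_le (min_le_right _ _)) ω
    rw [abs_le] at a b ⊢
    constructor <;> linarith [a.1, a.2, b.1, b.2]

lemma mul {f g : Ω → ℝ} (hf : IsTestFun τ f) (hg : IsTestFun τ g) :
    IsTestFun τ fun ω => f ω * g ω where
  meas := hf.meas.mul hg.meas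
  bdd := by
    obtain ⟨A, hA0, hA⟩ := hf.bdd
    obtain ⟨B, hB0, hB⟩ := hg.bdd
    refine ⟨A * B, by positivity, fun ω => ?_⟩
    rw [abs_mul]
    exact mul_le_mul (hA ω) (hB ω) (abs_nonneg _) hA0.le
  uc ε hε := by
    obtain ⟨A, hA0, hA⟩ := hf.bdd
    obtain ⟨B, hB0, hB⟩ := hg.bdd
    obtain ⟨d, hd, h1⟩ := hf.uc (ε / (2 * B)) (by positivity)
    obtain ⟨d', hd', h2⟩ := hg.uc (ε / (2 * A)) (by positivity)
    refine ⟨min d d', lt_min hd hd', fun y hy ω => ?_⟩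
    have a := h1 y (hy.trans_le (min_le_left _ _)) ω
    have b := h2 y (hy.trans_le (min_le_right _ _)) ω
    have e : f (τ y ω) * g (τ y ω) - f ω * g ω =
      (f (τ y ω) - f ω) * g (τ y ω) + f ω * (g (τ y ω) - g ω) := by ring
    rw [e]
    refine (abs_add_le _ _).trans ?_
    rw [abs_mul, abs_mul]
    calc _ ≤ ε / (2 * B) * B + A * (ε / (2 * A)) := by
          gcongr
          · exact hB _
          · exact hA _
      _ = ε := by field_simp; ring

lemma const (r : ℝ) : IsTestFun τ fun _ : Ω => r where
  meas := measurable_const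
  bdd := ⟨|r| + 1, by positivity, fun _ => by linarith⟩
  uc ε hε := ⟨1, one_pos, fun y _ ω => by simpa using hε.le⟩

lemma abs {f : Ω → ℝ} (hf : IsTestFun τ f) : IsTestFun τ fun ω => |f ω| where
  meas := hf.meas.abs
  bdd := by simpa using hf.bdd
  uc ε hε := by
    obtain ⟨d, hd, h1⟩ := hf.uc ε hε
    exact ⟨d, hd, fun y hy ω => (abs_abs_sub_abs_le _ _).trans (h1 y hy ω)⟩

lemma shift (h : IsErgodicAction P τ) {f : Ω → ℝ} (hf : IsTestFun τ f) (z : Ed n) :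
    IsTestFun τ fun ω => f (τ z ω) where
  meas := hf.meas.comp (h.mp z).measurable
  bdd := by
    obtain ⟨A, hA0, hA⟩ := hf.bdd
    exact ⟨A, hA0, fun ω => hA _⟩
  uc ε hε := by
    obtain ⟨d, hd, h1⟩ := hf.uc ε hε
    refine ⟨d, hd, fun y hy ω => ?_⟩
    rw [← h.add, add_comm, h.add]
    exact h1 y hy _

end IsTestFun

/-- One round of closing a set of functions under the test space operations. -/
def testStep (τ : Ed n → Ω → Ω) (S : Set (Ω → ℝ)) : Set (Ω → ℝ) :=
  S ∪ (image2 (fun f g ω => f ω + g ω) S S) ∪ (image2 (fun f g ω => f ω * g ω) S S) ∪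
    ((fun f ω => |f ω|) '' S) ∪
    (image2 (fun (q : ℚ) f ω => (q : ℝ) * f ω) univ S) ∪
    (image2 (fun z f ω => f (τ z ω)) (range (TopologicalSpace.denseSeq (Ed n))) S)

lemma testStep_countable {S : Set (Ω → ℝ)} (hS : S.Countable) : (testStep τ S).Countable :=
  ((((hS.union (hS.image2 hS _)).union (hS.image2 hS _)).union (hS.image _)).union
    (countable_univ.image2 hS _)).union ((countable_range _).image2 hS _)

lemma testStep_isTestFun (h : IsErgodicAction P τ) {S : Set (Ω → ℝ)}
    (hS : ∀ f ∈ S, IsTestFun τ f) : ∀ f ∈ testStep τ S, IsTestFun τ f := by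
  rintro f (((((hf | ⟨a, ha, b, hb, rfl⟩) | ⟨a, ha, b, hb, rfl⟩) | ⟨a, ha, rfl⟩) |
    ⟨q, -, a, ha, rfl⟩) | ⟨z, -, a, ha, rfl⟩)
  · exact hS f hf
  · exact (hS a ha).add (hS b hb)
  · exact (hS a ha).mul (hS b hb)
  · exact (hS a ha).abs
  · exact (IsTestFun.const _).mul (hS a ha)
  · exact (hS a ha).shift h z

/-- The closure of a set of functions under the test space operations. -/
def testAlg (τ : Ed n → Ω → Ω) (S : Set (Ω → ℝ)) : Set (Ω → ℝ) := ⋃ m, (testStep τ)^[m] S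

section testAlg
variable {S : Set (Ω → ℝ)}

lemma testAlg_mono : Monotone fun m => (testStep τ)^[m] S := by
  refine monotone_nat_of_le_succ fun m => ?_
  rw [Function.iterate_succ_apply']
  intro f hf
  exact Or.inl (Or.inl (Or.inl (Or.inl (Or.inl hf))))

lemma testAlg_step {f g : Ω → ℝ} (hf : f ∈ testAlg τ S) (hg : g ∈ testAlg τ S) :
    ∃ m, f ∈ (testStep τ)^[m] S ∧ g ∈ (testStep τ)^[m] S := by
  obtain ⟨a, ha⟩ := mem_iUnion.1 hf
  obtain ⟨b, hb⟩ := mem_iUnion.1 hg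
  exact ⟨max a b, testAlg_mono (le_max_left a b) ha, testAlg_mono (le_max_right a b) hb⟩

lemma mem_testAlg_of_step {f : Ω → ℝ} {m : ℕ} (hf : f ∈ testStep τ ((testStep τ)^[m] S)) :
    f ∈ testAlg τ S := by
  exact mem_iUnion.2 ⟨m + 1, by rwa [Function.iterate_succ_apply']⟩

lemma testAlg_add {f g : Ω → ℝ} (hf : f ∈ testAlg τ S) (hg : g ∈ testAlg τ S) :
    (fun ω => f ω + g ω) ∈ testAlg τ S := by
  obtain ⟨m, h1, h2⟩ := testAlg_step hf hg
  exact mem_testAlg_of_step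
    (Or.inl (Or.inl (Or.inl (Or.inl (Or.inr (mem_image2_of_mem h1 h2))))))

lemma testAlg_mul {f g : Ω → ℝ} (hf : f ∈ testAlg τ S) (hg : g ∈ testAlg τ S) :
    (fun ω => f ω * g ω) ∈ testAlg τ S := by
  obtain ⟨m, h1, h2⟩ := testAlg_step hf hg
  exact mem_testAlg_of_step (Or.inl (Or.inl (Or.inl (Or.inr (mem_image2_of_mem h1 h2)))))

lemma testAlg_abs {f : Ω → ℝ} (hf : f ∈ testAlg τ S) : (fun ω => |f ω|) ∈ testAlg τ S := by
  obtain ⟨m, h1⟩ := mem_iUnion.1 hf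
  exact mem_testAlg_of_step (Or.inl (Or.inl (Or.inr ⟨f, h1, rfl⟩)))

lemma testAlg_smul {f : Ω → ℝ} (q : ℚ) (hf : f ∈ testAlg τ S) :
    (fun ω => (q : ℝ) * f ω) ∈ testAlg τ S := by
  obtain ⟨m, h1⟩ := mem_iUnion.1 hf
  exact mem_testAlg_of_step (Or.inl (Or.inr ⟨q, mem_univ _, f, h1, rfl⟩))

lemma testAlg_shift {f : Ω → ℝ} {z : Ed n} (hz : z ∈ range (TopologicalSpace.denseSeq (Ed n)))
    (hf : f ∈ testAlg τ S) : (fun ω => f (τ z ω)) ∈ testAlg τ S := by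
  obtain ⟨m, h1⟩ := mem_iUnion.1 hf
  exact mem_testAlg_of_step (Or.inr ⟨z, hz, f, h1, rfl⟩)

lemma testAlg_countable (hS : S.Countable) : (testAlg τ S).Countable := by
  refine countable_iUnion fun m => ?_
  induction m with
  | zero => exact hS
  | succ m ih => rw [Function.iterate_succ_apply']; exact testStep_countable ih

lemma testAlg_isTestFun (h : IsErgodicAction P τ) (hS : ∀ f ∈ S, IsTestFun τ f) :
    ∀ f ∈ testAlg τ S, IsTestFun τ f := by
  intro f hf
  obtain ⟨m, hm⟩ := mem_iUnion.1 hf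
  induction m generalizing f with
  | zero => exact hS f hm
  | succ m ih =>
    rw [Function.iterate_succ_apply'] at hm
    exact testStep_isTestFun h (fun g hg => ih g (mem_iUnion.2 ⟨m, hg⟩) hg) f hm

end testAlg

/-- Functions uniformly approximable by elements of `S`. -/
def unifClosure (S : Set (Ω → ℝ)) : Set (Ω → ℝ) :=
  {f | ∀ ε > 0, ∃ g ∈ S, ∀ ω, |f ω - g ω| ≤ ε}

lemma subset_unifClosure (S : Set (Ω → ℝ)) : S ⊆ unifClosure S :=
  fun f hf ε hε => ⟨f, hf, fun ω => by simpa using hε.le⟩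

lemma measurable_of_mem_unifClosure {S : Set (Ω → ℝ)} (hS : ∀ f ∈ S, Measurable f) {f : Ω → ℝ}
    (hf : f ∈ unifClosure S) : Measurable f := by
  choose g hg hfg using fun k : ℕ => hf (1 / ((k : ℝ) + 1)) (by positivity)
  refine measurable_of_tendsto_metrizable (fun k => hS _ (hg k)) (tendsto_pi_nhds.2 fun ω => ?_)
  rw [tendsto_iff_dist_tendsto_zero]
  refine squeeze_zero (fun _ => dist_nonneg) (fun k => ?_) tendsto_one_div_add_atTop_nhds_zero_nat
  rw [dist_comm, Real.dist_eq]
  exact hfg k ω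

lemma bdd_of_mem_unifClosure {S : Set (Ω → ℝ)} (hS : ∀ f ∈ S, ∃ B, 0 < B ∧ ∀ ω, |f ω| ≤ B)
    {f : Ω → ℝ} (hf : f ∈ unifClosure S) : ∃ B, 0 < B ∧ ∀ ω, |f ω| ≤ B := by
  obtain ⟨g, hg, hfg⟩ := hf 1 one_pos
  obtain ⟨B, hB0, hB⟩ := hS g hg
  refine ⟨B + 1, by positivity, fun ω => ?_⟩
  have := abs_sub_abs_le_abs_sub (f ω) (g ω)
  linarith [hfg ω, hB ω]

lemma avgConverges_of_mem_unifClosure [IsProbabilityMeasure P] (h : IsErgodicAction P τ)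
    {S : Set (Ω → ℝ)} (hS : ∀ f ∈ S, IsTestFun τ f) {ω : Ω}
    (hω : ∀ f ∈ S, AvgConverges P τ ω f) {f : Ω → ℝ} (hf : f ∈ unifClosure S) :
    AvgConverges P τ ω f := by
  intro ν hν
  have := hν.prob
  have hfm := measurable_of_mem_unifClosure (fun g hg => (hS g hg).meas) hf
  obtain ⟨B, -, hB⟩ := bdd_of_mem_unifClosure (fun g hg => (hS g hg).bdd) hf
  rw [Metric.tendsto_atTop]
  intro ε hε
  obtain ⟨g, hg, hfg⟩ := hf (ε / 3) (by positivity)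
  obtain ⟨A, -, hA⟩ := (hS g hg).bdd
  have hgm := (hS g hg).meas
  obtain ⟨N, hN⟩ := Metric.tendsto_atTop.1 (hω g hg ν hν) (ε / 3) (by positivity)
  refine ⟨N, fun k hk => ?_⟩
  have h1 : |∫ y, f (τ y ω) ∂ν k - ∫ y, g (τ y ω) ∂ν k| ≤ ε / 3 := by
    rw [← integral_sub (h.integrable_orbit hfm hB _ ω) (h.integrable_orbit hgm hA _ ω),
      ← Real.norm_eq_abs]
    refine (norm_integral_le_of_norm_le_const (Eventually.of_forall fun y => hfg _)).trans ?_
    simp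
  have h2 : |∫ x, f x ∂P - ∫ x, g x ∂P| ≤ ε / 3 := by
    rw [← integral_sub (integrable_of_abs_bound hfm hB) (integrable_of_abs_bound hgm hA),
      ← Real.norm_eq_abs]
    refine (norm_integral_le_of_norm_le_const (Eventually.of_forall hfg)).trans ?_
    simp
  have h3 := hN k hk
  rw [Real.dist_eq] at h3 ⊢
  rw [abs_lt] at h3 ⊢
  rw [abs_le] at h1 h2
  constructor <;> linarith [h1.1, h1.2, h2.1, h2.2, h3.1, h3.2]

lemma exists_testSpace [IsProbabilityMeasure P] (h : IsErgodicAction P τ) {S : Set (Ω → ℝ)}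
    (hSc : S.Countable) (hS : ∀ f ∈ S, IsTestFun τ f) :
    ∃ V : Submodule ℝ (Ω → ℝ), IsTestSpace τ V ∧ S ⊆ V ∧
      ∀ᵐ ω ∂P, ∀ f ∈ V, AvgConverges P τ ω f := by
  set T := insert (fun _ => 1) S with hT
  have hTc : T.Countable := hSc.insert _
  have hTt : ∀ f ∈ T, IsTestFun τ f := by
    rintro f (rfl | hf)
    exacts [IsTestFun.const 1, hS f hf]
  set A := testAlg τ T with hA
  have hAt : ∀ f ∈ A, IsTestFun τ f := testAlg_isTestFun h hTt
  have hTA : T ⊆ A := fun f hf => mem_iUnion.2 ⟨0, hf⟩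
  have bdA : ∀ f ∈ A, ∃ B, 0 < B ∧ ∀ ω, |f ω| ≤ B := fun f hf => (hAt f hf).bdd
  have hadd : ∀ f g : Ω → ℝ, f ∈ unifClosure A → g ∈ unifClosure A →
      (fun ω => f ω + g ω) ∈ unifClosure A := by
    intro f g hf hg ε hε
    obtain ⟨a, ha, hfa⟩ := hf (ε / 2) (half_pos hε)
    obtain ⟨b, hb, hgb⟩ := hg (ε / 2) (half_pos hε)
    refine ⟨_, testAlg_add ha hb, fun ω => ?_⟩
    have h1 := hfa ω
    have h2 := hgb ω
    rw [abs_le] at h1 h2 ⊢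
    constructor <;> linarith [h1.1, h1.2, h2.1, h2.2]
  have hmul : ∀ f g : Ω → ℝ, f ∈ unifClosure A → g ∈ unifClosure A →
      (fun ω => f ω * g ω) ∈ unifClosure A := by
    intro f g hf hg ε hε
    obtain ⟨B, hB0, hB⟩ := bdd_of_mem_unifClosure bdA hg
    obtain ⟨a, ha, hfa⟩ := hf (ε / (2 * B)) (by positivity)
    obtain ⟨C, hC0, hC⟩ := bdA a ha
    obtain ⟨b, hb, hgb⟩ := hg (ε / (2 * C)) (by positivity)
    refine ⟨_, testAlg_mul ha hb, fun ω => ?_⟩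
    have e : f ω * g ω - a ω * b ω = (f ω - a ω) * g ω + a ω * (g ω - b ω) := by ring
    rw [e]
    refine (abs_add_le _ _).trans ?_
    rw [abs_mul, abs_mul]
    calc _ ≤ ε / (2 * B) * B + C * (ε / (2 * C)) := by
          gcongr
          · exact hfa _
          · exact hB _
          · exact hC _
          · exact hgb _
      _ = ε := by field_simp; ring
  have hone : (fun _ : Ω => (1 : ℝ)) ∈ A := hTA (mem_insert _ _)
  have hconst : ∀ r : ℝ, (fun _ : Ω => r) ∈ unifClosure A := by
    intro r ε hε
    obtain ⟨q, hq1, hq2⟩ := exists_rat_btwn (show r - ε < r by linarith)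
    refine ⟨_, testAlg_smul q hone, fun ω => ?_⟩
    rw [mul_one, abs_le]
    constructor <;> linarith
  let V : Submodule ℝ (Ω → ℝ) :=
    { carrier := unifClosure A
      zero_mem' := hconst 0
      add_mem' := fun {f g} hf hg => hadd f g hf hg
      smul_mem' := fun r f hf => hmul _ f (hconst r) hf }
  refine ⟨V, ⟨fun f hf => measurable_of_mem_unifClosure (fun g hg => (hAt g hg).meas) hf,
    fun f hf => ?_, hconst 1, fun f hf g hg => hmul f g hf hg, ?_, ?_⟩, ?_, ?_⟩
  · obtain ⟨B, -, hB⟩ := bdd_of_mem_unifClosure bdA hf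
    exact ⟨B, hB⟩
  · intro f hf ε hε
    obtain ⟨a, ha, hfa⟩ := hf ε hε
    exact ⟨_, testAlg_abs ha, fun ω => (abs_abs_sub_abs_le _ _).trans (hfa ω)⟩
  · intro f hf z ε hε
    obtain ⟨a, ha, hfa⟩ := hf (ε / 2) (half_pos hε)
    obtain ⟨d, hd, huc⟩ := (hAt a ha).uc (ε / 2) (half_pos hε)
    obtain ⟨s, hs, hsd⟩ := (TopologicalSpace.denseRange_denseSeq (Ed n)).exists_mem_open
      isOpen_ball ⟨z, mem_ball_self hd⟩ |>.imp fun i hi => (⟨hi, rfl⟩ : _ ∧ i = i)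
    refine ⟨_, testAlg_shift (mem_range_self s) ha, fun ω => ?_⟩
    set s' := TopologicalSpace.denseSeq (Ed n) s with hs'
    have h1 := huc (z - s') (by rw [mem_ball, dist_comm, dist_eq_norm] at hs; exact hs) (τ s' ω)
    rw [← h.add, sub_add_cancel] at h1
    have h2 := hfa (τ z ω)
    rw [abs_le] at h1 h2 ⊢
    constructor <;> linarith [h1.1, h1.2, h2.1, h2.2]
  · exact fun f hf => subset_unifClosure A (hTA (mem_insert_of_mem _ hf))
  · have : ∀ᵐ ω ∂P, ∀ f ∈ A, AvgConverges P τ ω f := by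
      rw [ae_ball_iff (testAlg_countable hTc)]
      intro f hf
      obtain ⟨B, -, hB⟩ := (hAt f hf).bdd
      exact h.tendsto_average (hAt f hf).meas hB
    filter_upwards [this] with ω hω f hf
    exact avgConverges_of_mem_unifClosure h hAt hω hf

end TestSpace

set_option linter.unusedSectionVars false

section Representation
variable {n : ℕ} {Ω : Type*} [MeasurableSpace Ω] {P : Measure Ω} {τ : Ed n → Ω → Ω}

namespace IsTestSpace
variable {V : Submodule ℝ (Ω → ℝ)}

lemma memLp [IsFiniteMeasure P] (hV : IsTestSpace τ V) {f : Ω → ℝ} (hf : f ∈ V) : MemLp f 2 P := by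
  obtain ⟨B, hB⟩ := hV.bdd f hf
  exact memLp_two_of_bound (hV.meas f hf) hB

/-- The classes in `L²` of the functions in a test space. -/
def toL (P : Measure Ω) [IsFiniteMeasure P] (hV : IsTestSpace τ V) : V →ₗ[ℝ] Lp ℝ 2 P where
  toFun f := (hV.memLp f.2).toLp f.1
  map_add' _ _ := rfl
  map_smul' _ _ := rfl

lemma coeFn_toL [IsFiniteMeasure P] (hV : IsTestSpace τ V) (f : V) : hV.toL P f =ᵐ[P] f.1 :=
  (hV.memLp f.2).coeFn_toLp

/-- The closure in `L²` of a test space. -/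
def lpClosure (P : Measure Ω) [IsFiniteMeasure P] (hV : IsTestSpace τ V) :
    Submodule ℝ (Lp ℝ 2 P) :=
  (LinearMap.range (hV.toL P)).topologicalClosure

lemma ae_le_zero [IsFiniteMeasure P] (hV : IsTestSpace τ V) {G : Lp ℝ 2 P}
    (hG : G ∈ hV.lpClosure P) (hneg : ∀ f ∈ V, (∀ ω, 0 ≤ f ω) → ∫ ω, f ω * G ω ∂P ≤ 0) :
    ∀ᵐ ω ∂P, G ω ≤ 0 := by
  have hc : IsClosed {g : Lp ℝ 2 P | inner ℝ (g ⊔ 0) G ≤ (0 : ℝ)} :=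
    isClosed_le ((continuous_id.sup continuous_const).inner continuous_const) continuous_const
  have hr : (LinearMap.range (hV.toL P) : Set (Lp ℝ 2 P)) ⊆
      {g : Lp ℝ 2 P | inner ℝ (g ⊔ 0) G ≤ (0 : ℝ)} := by
    rintro _ ⟨f, rfl⟩
    have hpos : (fun ω => max (f.1 ω) 0) ∈ V := by
      have := V.smul_mem (1 / 2 : ℝ) (V.add_mem f.2 (hV.abs f.1 f.2))
      convert this using 1
      ext ω
      simp only [Pi.smul_apply, Pi.add_apply, smul_eq_mul]
      rcases le_total 0 (f.1 ω) with h | h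
      · rw [max_eq_left h, abs_of_nonneg h]; ring
      · rw [max_eq_right h, abs_of_nonpos h]; ring
    have he : (hV.toL P f ⊔ 0 : Lp ℝ 2 P) =ᵐ[P] fun ω => max (f.1 ω) 0 := by
      filter_upwards [Lp.coeFn_sup (hV.toL P f) 0, hV.coeFn_toL (P := P) f,
        Lp.coeFn_zero ℝ 2 P] with ω h1 h2 h3
      rw [h1, Pi.sup_apply, h2, h3]
      rfl
    change inner ℝ (hV.toL P f ⊔ 0) G ≤ (0 : ℝ)
    rw [inner_Lp_eq_integral _ G he (ae_eq_refl _)]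
    exact hneg _ hpos fun ω => le_max_right _ _
  have h0 : inner ℝ (G ⊔ 0) G ≤ (0 : ℝ) := closure_minimal hr hc hG
  have he : (G ⊔ 0 : Lp ℝ 2 P) =ᵐ[P] fun ω => max (G ω) 0 := by
    filter_upwards [Lp.coeFn_sup G 0, Lp.coeFn_zero ℝ 2 P] with ω h1 h3
    rw [h1, Pi.sup_apply, h3]
    rfl
  have hsq : inner ℝ (G ⊔ 0) G = inner ℝ (G ⊔ 0) (G ⊔ 0) := by
    rw [inner_Lp_eq_integral _ G he (ae_eq_refl _), inner_Lp_eq_integral _ _ he he]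
    congr 1
    ext ω
    rcases le_total 0 (G ω) with h | h
    · rw [max_eq_left h]
    · rw [max_eq_right h]; ring
  rw [hsq] at h0
  have hz : G ⊔ 0 = 0 := by
    rw [real_inner_self_eq_norm_sq] at h0
    have : ‖G ⊔ 0‖ ^ 2 = 0 := le_antisymm h0 (sq_nonneg _)
    exact norm_eq_zero.1 (pow_eq_zero_iff (two_ne_zero) |>.1 this)
  rw [hz] at he
  filter_upwards [he, Lp.coeFn_zero ℝ 2 P] with ω h1 h2
  rw [h2] at h1
  exact max_eq_right_iff.1 h1.symm

end IsTestSpace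

/-- `G` represents, along the fixed ultrafilter `hyperfilter ℕ`, the weak limit of the functions
`D k` sampled on the orbit of `ω` with respect to the measures `ν k`. -/
structure IsRep (P : Measure Ω) [IsFiniteMeasure P] {V : Submodule ℝ (Ω → ℝ)}
    (hV : IsTestSpace τ V) (ν : ℕ → Measure (Ed n)) (ω : Ω) (D : ℕ → Ed n → ℝ) (G : Ω → ℝ) :
    Prop where
  meas : Measurable G
  mem : ∃ g ∈ hV.lpClosure P, g =ᵐ[P] G
  lim : ∀ f ∈ V, Tendsto (fun k => ∫ y, f (τ y ω) * D k y ∂ν k) (hyperfilter ℕ)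
    (nhds (∫ ω', f ω' * G ω' ∂P))

namespace IsRep
variable {V : Submodule ℝ (Ω → ℝ)}

lemma integrable_mul_orbit [IsFiniteMeasure P] (h : IsErgodicAction P τ) (hV : IsTestSpace τ V)
    {f : Ω → ℝ} (hf : f ∈ V) {D : Ed n → ℝ} (hD : Measurable D) {B : ℝ} (hB : ∀ y, |D y| ≤ B)
    (μ : Measure (Ed n)) [IsFiniteMeasure μ] (ω : Ω) :
    Integrable (fun y => f (τ y ω) * D y) μ := by
  obtain ⟨A, hA⟩ := hV.bdd f hf
  refine integrable_of_abs_bound (B := A * B)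
    (((hV.meas f hf).comp (h.meas_orbit ω)).mul hD) fun y => ?_
  rw [abs_mul]
  exact mul_le_mul (hA _) (hB _) (abs_nonneg _) ((abs_nonneg _).trans (hA (τ y ω)))

lemma memLp [IsFiniteMeasure P] {hV : IsTestSpace τ V} {ν : ℕ → Measure (Ed n)} {ω : Ω}
    {D : ℕ → Ed n → ℝ} {G : Ω → ℝ} (hG : IsRep P hV ν ω D G) : MemLp G 2 P := by
  obtain ⟨g, -, hg⟩ := hG.mem
  exact (memLp_congr_ae hg).1 (Lp.memLp g)

lemma integrable_mul [IsFiniteMeasure P] {hV : IsTestSpace τ V} {ν : ℕ → Measure (Ed n)} {ω : Ω}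
    {D : ℕ → Ed n → ℝ} {G : Ω → ℝ} (hG : IsRep P hV ν ω D G) {f : Ω → ℝ} (hf : f ∈ V) :
    Integrable (fun ω' => f ω' * G ω') P :=
  (hV.memLp hf).integrable_mul hG.memLp

lemma sub [IsFiniteMeasure P] (h : IsErgodicAction P τ) {hV : IsTestSpace τ V}
    {ν : ℕ → Measure (Ed n)} (hν : IsFolner ν) {ω : Ω} {D D' : ℕ → Ed n → ℝ} {G G' : Ω → ℝ}
    (hG : IsRep P hV ν ω D G) (hG' : IsRep P hV ν ω D' G')
    (hD : ∀ k, Measurable (D k)) (hD' : ∀ k, Measurable (D' k)) {B B' : ℝ}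
    (hB : ∀ k y, |D k y| ≤ B) (hB' : ∀ k y, |D' k y| ≤ B') :
    IsRep P hV ν ω (fun k y => D k y - D' k y) (fun ω' => G ω' - G' ω') where
  meas := hG.meas.sub hG'.meas
  mem := by
    obtain ⟨g, hg, hgG⟩ := hG.mem
    obtain ⟨g', hg', hgG'⟩ := hG'.mem
    exact ⟨g - g', Submodule.sub_mem _ hg hg', (Lp.coeFn_sub g g').trans (hgG.sub hgG')⟩
  lim f hf := by
    have := hν.prob
    have key := (hG.lim f hf).sub (hG'.lim f hf)
    rw [← integral_sub (hG.integrable_mul hf) (hG'.integrable_mul hf)] at key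
    simp_rw [← fun k => integral_sub (integrable_mul_orbit h hV hf (hD k) (hB k) (ν k) ω)
      (integrable_mul_orbit h hV hf (hD' k) (hB' k) (ν k) ω), ← mul_sub] at key
    exact key

lemma ae_le [IsFiniteMeasure P] (h : IsErgodicAction P τ) {hV : IsTestSpace τ V}
    {ν : ℕ → Measure (Ed n)} (hν : IsFolner ν) {ω : Ω} (hω : ∀ f ∈ V, AvgConverges P τ ω f)
    {D : ℕ → Ed n → ℝ} {G : Ω → ℝ} (hG : IsRep P hV ν ω D G) (hD : ∀ k, Measurable (D k)) {B : ℝ}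
    (hB : ∀ k y, |D k y| ≤ B) {c : Ω → ℝ} (hc : c ∈ V)
    (hle : ∀ᶠ k in hyperfilter ℕ, ∀ᵐ y ∂ν k, D k y ≤ c (τ y ω)) : ∀ᵐ ω' ∂P, G ω' ≤ c ω' := by
  have := hν.prob
  obtain ⟨g, hg, hgG⟩ := hG.mem
  have hcl : hV.toL P ⟨c, hc⟩ ∈ hV.lpClosure P :=
    Submodule.le_topologicalClosure _ ⟨_, rfl⟩
  have hsub : (g - hV.toL P ⟨c, hc⟩ : Lp ℝ 2 P) =ᵐ[P] fun ω' => G ω' - c ω' :=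
    (Lp.coeFn_sub _ _).trans (hgG.sub (hV.coeFn_toL _))
  have key := hV.ae_le_zero (Submodule.sub_mem _ hg hcl) fun f hf hpos => by
    rw [integral_congr_ae (g := fun ω' => f ω' * G ω' - f ω' * c ω')
      (by filter_upwards [hsub] with ω' h1; rw [h1]; ring)]
    have hfc := hV.mul f hf c hc
    obtain ⟨C, hC⟩ := hV.bdd _ hfc
    rw [integral_sub (hG.integrable_mul hf) (integrable_of_abs_bound (hV.meas _ hfc) hC),
      sub_nonpos]
    refine le_of_tendsto_of_tendsto (hG.lim f hf)
      ((hω _ hfc ν hν).mono_left Nat.hyperfilter_le_atTop) ?_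
    filter_upwards [hle] with k hk
    refine integral_mono_ae (integrable_mul_orbit h hV hf (hD k) (hB k) (ν k) ω)
      (h.integrable_orbit (hV.meas _ hfc) hC (ν k) ω) ?_
    filter_upwards [hk] with y hy
    exact mul_le_mul_of_nonneg_left hy (hpos _)
  filter_upwards [key, hsub] with ω' h1 h2
  rw [h2] at h1
  linarith

/-- Weak limits of bounded sequences are represented. -/
lemma exists_isRep [IsProbabilityMeasure P] (h : IsErgodicAction P τ) (hV : IsTestSpace τ V)
    {ν : ℕ → Measure (Ed n)} (hν : IsFolner ν) {ω : Ω} (hω : ∀ f ∈ V, AvgConverges P τ ω f)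
    {D : ℕ → Ed n → ℝ} (hD : ∀ k, Measurable (D k)) {B : ℝ} (hB : ∀ k y, |D k y| ≤ B) :
    ∃ G, IsRep P hV ν ω D G := by
  have := hν.prob
  have hB0 : 0 ≤ B := (abs_nonneg _).trans (hB 0 0)
  have hint := fun (f : V) k => integrable_mul_orbit h hV f.2 (hD k) (hB k) (ν k) ω
  have habs : ∀ f ∈ V, Tendsto (fun k => ∫ y, |f (τ y ω)| ∂ν k) atTop
      (nhds (∫ ω', |f ω'| ∂P)) := fun f hf => hω _ (hV.abs f hf) ν hν
  have hbd : ∀ (f : V) k, |∫ y, f.1 (τ y ω) * D k y ∂ν k| ≤ B * ∫ y, |f.1 (τ y ω)| ∂ν k := by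
    intro f k
    obtain ⟨A, hA⟩ := hV.bdd f.1 f.2
    obtain ⟨A', hA'⟩ := hV.bdd _ (hV.abs f.1 f.2)
    rw [← integral_const_mul]
    refine (abs_integral_le_integral_abs).trans (integral_mono (hint f k).abs
      ((h.integrable_orbit (hV.meas _ (hV.abs f.1 f.2)) hA' (ν k) ω).const_mul B) fun y => ?_)
    change |f.1 (τ y ω) * D k y| ≤ B * |f.1 (τ y ω)|
    rw [abs_mul, mul_comm]
    gcongr
    exact hB _ _
  have hlim : ∀ f : V, ∃ l, Tendsto (fun k => ∫ y, f.1 (τ y ω) * D k y ∂ν k) (hyperfilter ℕ)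
      (nhds l) := by
    intro f
    obtain ⟨A, hA⟩ := hV.bdd f.1 f.2
    have hmem : ∀ k, (∫ y, f.1 (τ y ω) * D k y ∂ν k) ∈ Icc (-(B * A)) (B * A) := by
      intro k
      rw [mem_Icc, ← abs_le]
      refine (hbd f k).trans (mul_le_mul_of_nonneg_left ?_ hB0)
      have := norm_integral_le_of_norm_le_const (μ := ν k) (f := fun y => |f.1 (τ y ω)|) (C := A)
        (Eventually.of_forall fun y => by simpa using hA _)
      simp only [Real.norm_eq_abs, probReal_univ, mul_one] at this
      exact (le_abs_self _).trans this
    obtain ⟨l, -, hl⟩ := isCompact_Icc.ultrafilter_le_nhds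
      ((hyperfilter ℕ).map fun k => ∫ y, f.1 (τ y ω) * D k y ∂ν k)
      (by
        rw [le_principal_iff]
        exact Filter.mem_map.2 (Filter.univ_mem' hmem))
    exact ⟨l, hl⟩
  choose l hl using hlim
  let ℓ : V →ₗ[ℝ] ℝ :=
    { toFun := l
      map_add' := fun f g => by
        refine tendsto_nhds_unique (hl (f + g)) (((hl f).add (hl g)).congr fun k => ?_)
        rw [← integral_add (hint f k) (hint g k)]
        congr 1; ext y
        change _ = (f.1 + g.1) (τ y ω) * D k y
        rw [Pi.add_apply]; ring
      map_smul' := fun r f => by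
        refine tendsto_nhds_unique (hl (r • f)) (((hl f).const_mul r).congr fun k => ?_)
        rw [← integral_const_mul]
        congr 1; ext y
        change _ = (r • f.1) (τ y ω) * D k y
        rw [Pi.smul_apply, smul_eq_mul]; ring }
  have hℓ : ∀ f : V, ‖ℓ f‖ ≤ B * ‖hV.toL P f‖ := by
    intro f
    have h1 : |l f| ≤ B * ∫ ω', |f.1 ω'| ∂P :=
      le_of_tendsto_of_tendsto (hl f).abs
        (((habs f.1 f.2).mono_left Nat.hyperfilter_le_atTop).const_mul B)
        (Eventually.of_forall fun k => hbd f k)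
    refine h1.trans (mul_le_mul_of_nonneg_left ?_ hB0)
    have hm := hV.memLp (P := P) f.2
    have h2 : ∫ ω', |f.1 ω'| ∂P = (eLpNorm f.1 1 P).toReal := by
      rw [eLpNorm_one_eq_lintegral_enorm,
        ← integral_norm_eq_lintegral_enorm hm.aestronglyMeasurable]
      rfl
    rw [h2]
    change _ ≤ ‖hm.toLp f.1‖
    rw [Lp.norm_toLp]
    exact ENNReal.toReal_mono hm.eLpNorm_lt_top.ne
      (eLpNorm_le_eLpNorm_of_exponent_le (by norm_num) hm.aestronglyMeasurable)
  let e : V →ₗ[ℝ] hV.lpClosure P :=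
    (hV.toL P).codRestrict _ fun f => Submodule.le_topologicalClosure _ ⟨f, rfl⟩
  have hdense : DenseRange e := by
    rw [DenseRange, Subtype.dense_iff]
    intro x hx
    have : (Subtype.val '' range e : Set (Lp ℝ 2 P)) = LinearMap.range (hV.toL P) := by
      ext g; constructor
      · rintro ⟨_, ⟨f, rfl⟩, rfl⟩; exact ⟨f, rfl⟩
      · rintro ⟨f, rfl⟩; exact ⟨e f, ⟨f, rfl⟩, rfl⟩
    change x ∈ closure (Subtype.val '' range e)
    rw [this]; exact hx
  have hcomp : CompleteSpace (hV.lpClosure P) :=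
    (Submodule.isClosed_topologicalClosure _).completeSpace_coe
  let Λ := ℓ.extendOfNorm e
  let G := (InnerProductSpace.toDual ℝ (hV.lpClosure P)).symm Λ
  have hG : ∀ f : V, inner ℝ (G : Lp ℝ 2 P) (hV.toL P f) = l f := by
    intro f
    have h1 : inner ℝ G (e f) = Λ (e f) := InnerProductSpace.toDual_symm_apply
    rw [LinearMap.extendOfNorm_eq hdense ⟨B, hℓ⟩] at h1
    exact h1
  obtain ⟨G', hG'm, hG'⟩ := (Lp.aestronglyMeasurable (G : Lp ℝ 2 P)).aemeasurable
  refine ⟨G', hG'm, ⟨G, G.2, hG'⟩, fun f hf => ?_⟩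
  have h2 := hG ⟨f, hf⟩
  rw [inner_Lp_eq_integral _ _ hG' (hV.coeFn_toL _)] at h2
  simp_rw [mul_comm (G' _)] at h2
  rw [h2]
  exact hl ⟨f, hf⟩

lemma ae_eq [IsFiniteMeasure P] {hV : IsTestSpace τ V} {ν : ℕ → Measure (Ed n)} {ω : Ω}
    {D : ℕ → Ed n → ℝ} {G G' : Ω → ℝ}
    (hG : IsRep P hV ν ω D G) (hG' : IsRep P hV ν ω D G') : G =ᵐ[P] G' := by
  have aux : ∀ {G G' : Ω → ℝ}, IsRep P hV ν ω D G → IsRep P hV ν ω D G' →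
      ∀ᵐ ω' ∂P, G ω' ≤ G' ω' := by
    intro G G' hG hG'
    obtain ⟨g, hg, hgG⟩ := hG.mem
    obtain ⟨g', hg', hgG'⟩ := hG'.mem
    have hsub : (g - g' : Lp ℝ 2 P) =ᵐ[P] fun ω' => G ω' - G' ω' :=
      (Lp.coeFn_sub _ _).trans (hgG.sub hgG')
    have key := hV.ae_le_zero (Submodule.sub_mem _ hg hg') fun f hf hpos => by
      rw [integral_congr_ae (g := fun ω' => f ω' * G ω' - f ω' * G' ω')
        (by filter_upwards [hsub] with ω' h1; rw [h1]; ring)]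
      rw [integral_sub (hG.integrable_mul hf) (hG'.integrable_mul hf),
        tendsto_nhds_unique (hG.lim f hf) (hG'.lim f hf), sub_self]
    filter_upwards [key, hsub] with ω' h1 h2
    rw [h2] at h1
    linarith
  filter_upwards [aux hG hG', aux hG' hG] with ω' h1 h2 using le_antisymm h1 h2

lemma comp_shift [IsFiniteMeasure P] (h : IsErgodicAction P τ) {hV : IsTestSpace τ V}
    {ν : ℕ → Measure (Ed n)} (hν : IsFolner ν) {ω : Ω}
    {D : ℕ → Ed n → ℝ} {G : Ω → ℝ} (hG : IsRep P hV ν ω D G) (hD : ∀ k, Measurable (D k)) {B : ℝ}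
    (hB : ∀ k y, |D k y| ≤ B) (a : Ed n) :
    IsRep P hV ν ω (fun k y => D k (y + a)) (fun ω' => G (τ a ω')) where
  meas := hG.meas.comp (h.mp a).measurable
  mem := by
    obtain ⟨g, hg, hgG⟩ := hG.mem
    refine ⟨Lp.compMeasurePreserving (τ a) (h.mp a) g, ?_,
      (Lp.coeFn_compMeasurePreserving g (h.mp a)).trans
        ((h.mp a).quasiMeasurePreserving.ae_eq hgG)⟩
    have hmaps : MapsTo (Lp.compMeasurePreserving (E := ℝ) (p := 2) (τ a) (h.mp a))
        (LinearMap.range (hV.toL P)) (LinearMap.range (hV.toL P)) := by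
      rintro _ ⟨f, rfl⟩
      refine ⟨⟨_, hV.shift f.1 f.2 a⟩, ?_⟩
      rfl
    exact hmaps.closure (Lp.isometry_compMeasurePreserving (h.mp a)).continuous hg
  lim f hf := by
    have := hν.prob
    obtain ⟨A, hA⟩ := hV.bdd f hf
    have hfs := hV.shift f hf (-a)
    have h1 := hG.lim _ hfs
    have h2 : ∫ ω', f (τ (-a) ω') * G ω' ∂P = ∫ ω', f ω' * G (τ a ω') ∂P := by
      have hm : AEStronglyMeasurable (fun ω' => f (τ (-a) ω') * G ω') (Measure.map (τ a) P) :=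
        ((hV.meas _ hfs).mul hG.meas).aestronglyMeasurable
      have := integral_map (h.mp a).measurable.aemeasurable hm
      rw [(h.mp a).map_eq] at this
      rw [this]
      simp_rw [← h.add, neg_add_cancel, h.zero]
      try rfl
    rw [h2] at h1
    obtain ⟨e, he, hse⟩ := hν.shift a
    have h3 : Tendsto (fun k => (∫ y, f (τ y ω) * D k (y + a) ∂ν k) -
        ∫ y, f (τ (-a) (τ y ω)) * D k y ∂ν k) atTop (nhds 0) := by
      have h0 : Tendsto (fun k => A * B * e k) atTop (nhds 0) := by simpa using he.const_mul (A * B)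
      refine squeeze_zero_norm (fun k => ?_) h0
      have := hse k (fun y => f (τ (-a) (τ y ω)) * D k y) (A * B)
        (((hV.meas _ hfs).comp (h.meas_orbit ω)).mul (hD k)) fun y => by
          rw [abs_mul]
          exact mul_le_mul (hA _) (hB _ _) (abs_nonneg _) ((abs_nonneg _).trans (hA ω))
      have e1 : ∀ y, τ (-a) (τ (y + a) ω) = τ y ω := fun y => by
        rw [← h.add, neg_add_cancel_comm_assoc]
      simp_rw [e1] at this
      exact this
    have := (h3.mono_left Nat.hyperfilter_le_atTop).add h1
    simpa using this

end IsRep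
end Representation

section Cocycle
variable {n : ℕ} {Ω : Type*} [MeasurableSpace Ω] {P : Measure Ω} {τ : Ed n → Ω → Ω}

/-- A measurable Lipschitz additive cocycle over the action `τ`. -/
structure IsCocycle (P : Measure Ω) (τ : Ed n → Ω → Ω) (L : ℝ≥0) (Φ : Ed n → Ω → ℝ) : Prop where
  meas : ∀ z, Measurable (Φ z)
  lip : ∀ z z', ∀ᵐ ω ∂P, Φ z ω - Φ z' ω ≤ L * ‖z - z'‖
  add : ∀ y z, ∀ᵐ ω ∂P, Φ (y + z) ω = Φ y ω + Φ z (τ y ω)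

lemma LipschitzWith.sub_le_norm {E : Type*} [SeminormedAddCommGroup E] {L : ℝ≥0} {ϕ : E → ℝ}
    (h : LipschitzWith L ϕ) (x y : E) : ϕ x - ϕ y ≤ L * ‖x - y‖ := by
  have := h.dist_le_mul x y
  rw [Real.dist_eq, dist_eq_norm] at this
  exact (le_abs_self _).trans this

lemma LipschitzWith.abs_increment_le {L : ℝ≥0} {ϕ : Ed n → ℝ} (h : LipschitzWith L ϕ)
    (z y : Ed n) : |ϕ (y + z) - ϕ y| ≤ L * ‖z‖ := by
  have := h.dist_le_mul (y + z) y
  rwa [Real.dist_eq, dist_eq_norm, add_sub_cancel_left] at this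

lemma LipschitzWith.measurable_increment {L : ℝ≥0} {ϕ : Ed n → ℝ} (h : LipschitzWith L ϕ)
    (z : Ed n) : Measurable fun y => ϕ (y + z) - ϕ y :=
  ((h.continuous.comp (continuous_id.add continuous_const)).sub h.continuous).measurable

namespace IsCocycle
variable {L : ℝ≥0} {Φ : Ed n → Ω → ℝ}

lemma zero [IsProbabilityMeasure P] (h : IsErgodicAction P τ) (hΦ : IsCocycle P τ L Φ) :
    ∀ᵐ ω ∂P, Φ 0 ω = 0 := by
  filter_upwards [hΦ.add 0 0] with ω h1
  rw [h.zero, add_zero] at h1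
  linarith

lemma abs_sub_le (hΦ : IsCocycle P τ L Φ) (z z' : Ed n) :
    ∀ᵐ ω ∂P, |Φ z ω - Φ z' ω| ≤ L * ‖z - z'‖ := by
  filter_upwards [hΦ.lip z z', hΦ.lip z' z] with ω h1 h2
  rw [norm_sub_rev] at h2
  rw [abs_le]; constructor <;> linarith

lemma abs_le [IsProbabilityMeasure P] (h : IsErgodicAction P τ) (hΦ : IsCocycle P τ L Φ)
    (z : Ed n) : ∀ᵐ ω ∂P, |Φ z ω| ≤ L * ‖z‖ := by
  filter_upwards [hΦ.abs_sub_le z 0, hΦ.zero h] with ω h1 h2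
  simpa [h2] using h1

lemma integrable [IsProbabilityMeasure P] (h : IsErgodicAction P τ) (hΦ : IsCocycle P τ L Φ)
    (z : Ed n) : Integrable (Φ z) P :=
  Integrable.of_bound (hΦ.meas z).aestronglyMeasurable (L * ‖z‖) (hΦ.abs_le h z)

/-- The mean of a cocycle is linear. -/
lemma exists_mean [IsProbabilityMeasure P] (h : IsErgodicAction P τ) (hΦ : IsCocycle P τ L Φ) :
    ∃ p : Ed n, ∀ z, ∫ ω, Φ z ω ∂P = inner ℝ p z := by
  have hadd : ∀ y z, ∫ ω, Φ (y + z) ω ∂P = ∫ ω, Φ y ω ∂P + ∫ ω, Φ z ω ∂P := by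
    intro y z
    have hi : Integrable (fun ω => Φ z (τ y ω)) P :=
      (h.mp y).integrable_comp_of_integrable (hΦ.integrable h z)
    rw [integral_congr_ae (hΦ.add y z), integral_add (hΦ.integrable h y) hi]
    congr 1
    have hm : AEStronglyMeasurable (Φ z) (Measure.map (τ y) P) := (hΦ.meas z).aestronglyMeasurable
    have := integral_map (h.mp y).measurable.aemeasurable hm
    rw [(h.mp y).map_eq] at this
    exact this.symm
  let m : Ed n →+ ℝ :=
    { toFun := fun z => ∫ ω, Φ z ω ∂P
      map_zero' := by
        have := hadd 0 0
        rw [add_zero] at this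
        linarith
      map_add' := hadd }
  have hlip : LipschitzWith L m := by
    refine LipschitzWith.of_dist_le_mul fun z z' => ?_
    change dist (∫ ω, Φ z ω ∂P) (∫ ω, Φ z' ω ∂P) ≤ _
    rw [dist_eq_norm, ← integral_sub (hΦ.integrable h z) (hΦ.integrable h z'), dist_eq_norm]
    refine (norm_integral_le_of_norm_le_const (hΦ.abs_sub_le z z')).trans ?_
    simp
  let mc : Ed n →L[ℝ] ℝ := m.toRealLinearMap hlip.continuous
  refine ⟨(InnerProductSpace.toDual ℝ (Ed n)).symm mc, fun z => ?_⟩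
  rw [InnerProductSpace.toDual_symm_apply]
  rfl

end IsCocycle

/-- Increments of Lipschitz functions sampled along an orbit have limiting cocycles. -/
lemma exists_limit_cocycle [IsProbabilityMeasure P] (h : IsErgodicAction P τ)
    {V : Submodule ℝ (Ω → ℝ)} (hV : IsTestSpace τ V) {ν : ℕ → Measure (Ed n)} (hν : IsFolner ν)
    {ω : Ω} (hω : ∀ f ∈ V, AvgConverges P τ ω f) {L : ℝ≥0} {ϕ : ℕ → Ed n → ℝ}
    (hϕ : ∀ k, LipschitzWith L (ϕ k)) :
    ∃ Φ : Ed n → Ω → ℝ, IsCocycle P τ L Φ ∧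
      (∀ z, ∀ c ∈ V, (∀ᶠ k in hyperfilter ℕ, ∀ᵐ y ∂ν k, ϕ k (y + z) - ϕ k y ≤ c (τ y ω)) →
        ∀ᵐ ω' ∂P, Φ z ω' ≤ c ω') ∧
      ∀ z, Tendsto (fun k => ∫ y, (ϕ k (y + z) - ϕ k y) ∂ν k) (hyperfilter ℕ)
        (nhds (∫ ω', Φ z ω' ∂P)) := by
  have hm := fun z k => (hϕ k).measurable_increment z
  have hb := fun z k y => (hϕ k).abs_increment_le z y
  choose Φ hΦ using fun z => IsRep.exists_isRep h hV hν hω (hm z) (hb z)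
  have hconst : ∀ r : ℝ, (fun _ : Ω => r) ∈ V := fun r => by
    have := V.smul_mem r hV.one
    rwa [show (r • fun _ : Ω => (1 : ℝ)) = fun _ => r from funext fun _ => mul_one r] at this
  have hdiff : ∀ z z', IsRep P hV ν ω
      (fun k y => (ϕ k (y + z) - ϕ k y) - (ϕ k (y + z') - ϕ k y)) (fun ω' => Φ z ω' - Φ z' ω') :=
    fun z z' => (hΦ z).sub h hν (hΦ z') (hm z) (hm z') (hb z) (hb z')
  have hbd : ∀ z z' k y, |(ϕ k (y + z) - ϕ k y) - (ϕ k (y + z') - ϕ k y)| ≤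
      L * ‖z‖ + L * ‖z'‖ := fun z z' k y =>
    (abs_sub _ _).trans (add_le_add (hb z k y) (hb z' k y))
  refine ⟨Φ, ⟨fun z => (hΦ z).meas, fun z z' => ?_, fun y z => ?_⟩,
    fun z c hc hle => (hΦ z).ae_le h hν hω (hm z) (hb z) hc hle, fun z => ?_⟩
  · refine (hdiff z z').ae_le h hν hω (fun k => (hm z k).sub (hm z' k)) (hbd z z')
      (hconst (L * ‖z - z'‖)) (Eventually.of_forall fun k => Eventually.of_forall fun y => ?_)
    have := (hϕ k).sub_le_norm (y + z) (y + z')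
    rw [add_sub_add_left_eq_sub] at this
    linarith
  · have h1 := (hΦ z).comp_shift h hν (hm z) (hb z) y
    have h2 := hdiff (y + z) y
    have e : (fun (k : ℕ) (x : Ed n) => ϕ k (x + y + z) - ϕ k (x + y)) =
        fun k x => (ϕ k (x + (y + z)) - ϕ k x) - (ϕ k (x + y) - ϕ k x) := by
      ext k x; rw [add_assoc]; ring
    rw [e] at h1
    filter_upwards [h2.ae_eq h1] with ω' h3
    linarith
  · have := (hΦ z).lim _ hV.one
    simpa using this

end Cocycle

section Realization
variable {n : ℕ} {Ω : Type*} [MeasurableSpace Ω] {P : Measure Ω} {τ : Ed n → Ω → Ω}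

/-- A Lipschitz function which is asymptotically linear along a dense set of directions is
asymptotically linear. -/
lemma LipschitzWith.tendsto_sublinear {L : ℝ≥0} {w : Ed n → ℝ} (hw : LipschitzWith L w)
    (hlim : ∀ k : ℕ, Tendsto (fun K : ℕ => w ((K : ℝ) • TopologicalSpace.denseSeq (Ed n) k) / K)
      atTop (nhds 0)) :
    Tendsto (fun y => w y / ‖y‖) (cocompact (Ed n)) (nhds 0) := by
  set s := TopologicalSpace.denseSeq (Ed n) with hs
  rw [Metric.tendsto_nhds]
  intro ε hε
  set η := ε / (4 * (L + 1)) with hη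
  have hη0 : 0 < η := by positivity
  obtain ⟨t, ht⟩ := (isCompact_closedBall (0 : Ed n) 1).elim_finite_subcover
    (fun k => ball (s k) η) (fun _ => isOpen_ball) (fun x _ => by
      obtain ⟨k, hk⟩ := (TopologicalSpace.denseRange_denseSeq (Ed n)).exists_dist_lt x hη0
      exact mem_iUnion.2 ⟨k, hk⟩)
  have hN : ∀ᶠ K : ℕ in atTop, ∀ k ∈ t, |w ((K : ℝ) • s k) / K| < η := by
    rw [Filter.eventually_all_finset]
    intro k _
    have := Metric.tendsto_nhds.1 (hlim k) η hη0
    simpa only [Real.dist_eq, sub_zero] using this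
  obtain ⟨N, hN⟩ := eventually_atTop.1 hN
  have hev : ∀ᶠ y : Ed n in cocompact (Ed n), (N : ℝ) + 1 ≤ ‖y‖ :=
    (tendsto_norm_cocompact_atTop (E := Ed n)).eventually (eventually_ge_atTop _)
  filter_upwards [hev] with y hy
  have hy1 : 1 ≤ ‖y‖ := le_trans (by simp) hy
  have hy0 : 0 < ‖y‖ := one_pos.trans_le hy1
  set K := ⌈‖y‖⌉₊ with hK
  have hK1 : ‖y‖ ≤ K := Nat.le_ceil _
  have hK2 : (K : ℝ) < ‖y‖ + 1 := Nat.ceil_lt_add_one hy0.le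
  have hKp : (0 : ℝ) < K := hy0.trans_le hK1
  have hKN : N ≤ K := by
    have : (N : ℝ) ≤ K := by linarith
    exact_mod_cast this
  have hmem : (K : ℝ)⁻¹ • y ∈ closedBall (0 : Ed n) 1 := by
    rw [mem_closedBall_zero_iff, norm_smul, norm_inv, Real.norm_of_nonneg hKp.le,
      inv_mul_le_iff₀ hKp, mul_one]
    exact hK1
  obtain ⟨k, hk⟩ := mem_iUnion.1 (ht hmem)
  obtain ⟨hkt, hkb⟩ := mem_iUnion.1 hk
  have h1 := hN K hKN k hkt
  rw [abs_div, abs_of_pos hKp, div_lt_iff₀ hKp] at h1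
  have h2 : |w y - w ((K : ℝ) • s k)| ≤ L * (K * η) := by
    have := hw.dist_le_mul y ((K : ℝ) • s k)
    rw [Real.dist_eq] at this
    refine this.trans (mul_le_mul_of_nonneg_left ?_ L.2)
    rw [mem_ball, dist_eq_norm] at hkb
    have e : y - (K : ℝ) • s k = (K : ℝ) • ((K : ℝ)⁻¹ • y - s k) := by
      rw [smul_sub, smul_inv_smul₀ hKp.ne']
    rw [dist_eq_norm, e, norm_smul, Real.norm_of_nonneg hKp.le]
    exact mul_le_mul_of_nonneg_left hkb.le hKp.le
  have h3 : |w y| ≤ |w y - w ((K : ℝ) • s k)| + |w ((K : ℝ) • s k)| := by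
    have := abs_add_le (w y - w ((K : ℝ) • s k)) (w ((K : ℝ) • s k))
    rwa [sub_add_cancel] at this
  rw [Real.dist_eq, sub_zero, abs_div, abs_norm, div_lt_iff₀ hy0]
  have hL : (0 : ℝ) ≤ L := L.2
  calc |w y| < L * (K * η) + η * K := by linarith
    _ = (L + 1) * η * K := by ring
    _ = ε / 4 * K := by rw [hη]; field_simp
    _ ≤ ε / 4 * (2 * ‖y‖) := by gcongr; linarith
    _ ≤ ε * ‖y‖ := by nlinarith

namespace IsCocycle
variable {L : ℝ≥0} {Φ : Ed n → Ω → ℝ}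

/-- A cocycle has a jointly measurable version with Lipschitz sections. -/
lemma exists_version (hΦ : IsCocycle P τ L Φ) :
    ∃ Ψ : Ω → Ed n → ℝ, Measurable (fun q : Ω × Ed n => Ψ q.1 q.2) ∧
      (∀ᵐ ω ∂P, LipschitzWith L (Ψ ω)) ∧ ∀ y, ∀ᵐ ω ∂P, Ψ ω y = Φ y ω := by
  set s := TopologicalSpace.denseSeq (Ed n) with hs
  have hL : (0 : ℝ) ≤ L := L.2
  refine ⟨fun ω y => ⨅ k : ℕ, (Φ (s k) ω + L * ‖y - s k‖), ?_, ?_, ?_⟩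
  · refine Measurable.iInf fun k => ((hΦ.meas _).comp measurable_fst).add ?_
    exact ((measurable_snd.sub_const _).norm).const_mul _
  · have hg : ∀ᵐ ω ∂P, ∀ k j, Φ (s k) ω - Φ (s j) ω ≤ L * ‖s k - s j‖ :=
      ae_all_iff.2 fun k => ae_all_iff.2 fun j => hΦ.lip _ _
    filter_upwards [hg] with ω hω
    have hbdd : ∀ y, BddBelow (range fun k : ℕ => Φ (s k) ω + L * ‖y - s k‖) := by
      intro y
      refine ⟨Φ (s 0) ω - L * ‖s 0 - y‖, ?_⟩
      rintro _ ⟨k, rfl⟩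
      have h1 := hω 0 k
      have h2 : ‖s 0 - s k‖ ≤ ‖s 0 - y‖ + ‖y - s k‖ := norm_sub_le_norm_sub_add_norm_sub _ _ _
      have := mul_le_mul_of_nonneg_left h2 hL
      change _ ≤ Φ (s k) ω + L * ‖y - s k‖
      linarith
    refine LipschitzWith.of_le_add_mul L fun y y' => ?_
    rw [← sub_le_iff_le_add]
    refine le_ciInf fun k => ?_
    rw [sub_le_iff_le_add]
    refine (ciInf_le (hbdd y) k).trans ?_
    have h2 : ‖y - s k‖ ≤ ‖y - y'‖ + ‖y' - s k‖ := norm_sub_le_norm_sub_add_norm_sub _ _ _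
    have := mul_le_mul_of_nonneg_left h2 hL
    rw [dist_eq_norm]
    linarith
  · intro y
    have hg : ∀ᵐ ω ∂P, ∀ k, |Φ y ω - Φ (s k) ω| ≤ L * ‖y - s k‖ :=
      ae_all_iff.2 fun k => hΦ.abs_sub_le _ _
    filter_upwards [hg] with ω hω
    have hlow : ∀ k, Φ y ω ≤ Φ (s k) ω + L * ‖y - s k‖ := fun k => by
      have := (le_abs_self _).trans (hω k); linarith
    refine le_antisymm ?_ (le_ciInf hlow)
    refine le_of_forall_pos_le_add fun ε hε => ?_
    obtain ⟨k, hk⟩ := (TopologicalSpace.denseRange_denseSeq (Ed n)).exists_dist_lt y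
      (show 0 < ε / (2 * (L + 1)) by positivity)
    refine (ciInf_le ⟨Φ y ω, by rintro _ ⟨k, rfl⟩; exact hlow k⟩ k).trans ?_
    have h1 := (neg_le_abs _).trans (hω k)
    rw [dist_eq_norm, lt_div_iff₀ (by positivity)] at hk
    have hn := norm_nonneg (y - s k)
    have : ‖y - TopologicalSpace.denseSeq (Ed n) k‖ = ‖y - s k‖ := rfl
    rw [this] at hk
    nlinarith

/-- A cocycle is realized by Lipschitz functions which are asymptotically linear. -/
lemma exists_realization [IsProbabilityMeasure P] (h : IsErgodicAction P τ)
    (hΦ : IsCocycle P τ L Φ) {p : Ed n} (hp : ∀ z, ∫ ω, Φ z ω ∂P = inner ℝ p z) :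
    ∃ Ψ : Ω → Ed n → ℝ, ∀ᵐ ω ∂P, LipschitzWith L (Ψ ω) ∧
      Tendsto (fun y => (Ψ ω y - inner ℝ p y) / ‖y‖) (cocompact (Ed n)) (nhds 0) ∧
      ∀ i j : ℕ, Ψ ω (TopologicalSpace.denseSeq (Ed n) j) -
        Ψ ω (TopologicalSpace.denseSeq (Ed n) i) =
          Φ (TopologicalSpace.denseSeq (Ed n) j - TopologicalSpace.denseSeq (Ed n) i)
            (τ (TopologicalSpace.denseSeq (Ed n) i) ω) := by
  obtain ⟨Ψ, hΨm, hΨL, hΨ⟩ := hΦ.exists_version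
  set s := TopologicalSpace.denseSeq (Ed n) with hs
  have hinc : ∀ y z, ∀ᵐ ω ∂P, Ψ ω (y + z) - Ψ ω y = Φ z (τ y ω) := by
    intro y z
    filter_upwards [hΨ (y + z), hΨ y, hΦ.add y z] with ω h1 h2 h3
    rw [h1, h2, h3]; ring
  have hrate : ∀ k : ℕ, ∀ᵐ ω ∂P, Tendsto (fun K : ℕ => Ψ ω ((K : ℝ) • s k) / K) atTop
      (nhds (inner ℝ p (s k))) := by
    intro k
    set z := s k with hz
    set B : ℝ := L * ‖z‖ with hB
    have hB0 : 0 ≤ B := by positivity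
    let F : Ω → ℝ := fun ω => max (-B) (min B (Φ z ω))
    have hFm : Measurable F := measurable_const.max (measurable_const.min (hΦ.meas z))
    have hFB : ∀ ω, |F ω| ≤ B := fun ω =>
      _root_.abs_le.2 ⟨le_max_left _ _, max_le (by linarith) (min_le_left _ _)⟩
    have hFΦ : ∀ᵐ ω ∂P, F ω = Φ z ω := by
      filter_upwards [hΦ.abs_le h z] with ω h1
      rw [_root_.abs_le] at h1
      change max (-B) (min B (Φ z ω)) = _
      rw [min_eq_right h1.2, max_eq_right h1.1]
    have hFp : ∫ ω, F ω ∂P = inner ℝ p z := by rw [integral_congr_ae hFΦ, hp]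
    have hFy : ∀ y, ∀ᵐ ω ∂P, Ψ ω (y + z) - Ψ ω y = F (τ y ω) := by
      intro y
      filter_upwards [hinc y z, (h.mp y).quasiMeasurePreserving.ae hFΦ] with ω h1 h2
      rw [h1, h2]
    have hms : MeasurableSet {q : Ω × Ed n | Ψ q.1 (q.2 + z) - Ψ q.1 q.2 = F (τ q.2 q.1)} := by
      refine measurableSet_eq_fun ?_ (hFm.comp (h.meas.comp measurable_swap))
      exact (hΨm.comp (measurable_fst.prodMk (measurable_snd.add_const z))).sub hΨm
    have hFub : ∀ᵐ ω ∂P, ∀ᵐ y ∂(volume : Measure (Ed n)), Ψ ω (y + z) - Ψ ω y = F (τ y ω) :=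
      (Measure.ae_ae_comm hms).2 (Eventually.of_forall hFy)
    filter_upwards [hΨL, hFub, h.tendsto_average hFm hFB] with ω hL hω hav
    rw [hFp] at hav
    have key : ∀ η > (0 : ℝ), ∀ᶠ K : ℕ in atTop,
        |(Ψ ω ((K : ℝ) • z) - Ψ ω 0) / K - inner ℝ p z| ≤ (2 * L + 1) * η := by
      intro η hη
      have hfol := isFolner_tubeMeasure (n := n) (a := fun _ => 0) z (K := fun k => k + 1)
        (M := 0) hη le_rfl (fun k => k.succ_pos) (tendsto_add_atTop_nat 1) (fun k => by simp)
      have h1 := Metric.tendsto_nhds.1 (hav _ hfol) η hη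
      have h2 : ∀ᶠ k : ℕ in atTop,
          |(Ψ ω (((k + 1 : ℕ) : ℝ) • z) - Ψ ω 0) / ((k + 1 : ℕ) : ℝ) - inner ℝ p z| ≤
            (2 * L + 1) * η := by
        filter_upwards [h1] with k hk
        have hkp : (0 : ℝ) < ((k + 1 : ℕ) : ℝ) := by positivity
        rw [← integral_congr_ae ((tubeMeasure_absolutelyContinuous (a := (0 : Ed n)) (z := z)
          (K := k + 1) (r := η * ((k + 1 : ℕ) : ℝ))).ae_le hω), Real.dist_eq] at hk
        have h3 := telescoping_tubeMeasure hL 0 z (K := k + 1) (r := η * ((k + 1 : ℕ) : ℝ))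
          k.succ_pos (by positivity)
        rw [zero_add] at h3
        have e : 2 * L * (η * ((k + 1 : ℕ) : ℝ)) / ((k + 1 : ℕ) : ℝ) = 2 * L * η := by
          field_simp
        rw [e] at h3
        rw [abs_lt] at hk
        rw [_root_.abs_le] at h3 ⊢
        constructor <;> linarith [hk.1, hk.2, h3.1, h3.2]
      exact (eventually_atTop.2 (by
        obtain ⟨N, hN⟩ := eventually_atTop.1 h2
        refine ⟨N + 1, fun K hK => ?_⟩
        have := hN (K - 1) (by omega)
        rwa [Nat.sub_add_cancel (by omega)] at this))
    have hlim : Tendsto (fun K : ℕ => (Ψ ω ((K : ℝ) • z) - Ψ ω 0) / K) atTop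
        (nhds (inner ℝ p z)) := by
      rw [Metric.tendsto_nhds]
      intro ε hε
      filter_upwards [key (ε / (2 * (2 * L + 1))) (by positivity)] with K hK
      rw [Real.dist_eq]
      refine hK.trans_lt ?_
      have : (2 * (L : ℝ) + 1) * (ε / (2 * (2 * L + 1))) = ε / 2 := by field_simp
      rw [this]; linarith
    have h0 : Tendsto (fun K : ℕ => Ψ ω 0 / (K : ℝ)) atTop (nhds 0) :=
      tendsto_const_div_atTop_nhds_zero_nat _
    have := hlim.add h0
    rw [add_zero] at this
    refine this.congr fun K => ?_
    ring
  refine ⟨Ψ, ?_⟩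
  have hinc' : ∀ᵐ ω ∂P, ∀ i j : ℕ, Ψ ω (s j) - Ψ ω (s i) = Φ (s j - s i) (τ (s i) ω) := by
    refine ae_all_iff.2 fun i => ae_all_iff.2 fun j => ?_
    filter_upwards [hinc (s i) (s j - s i)] with ω h1
    rwa [add_sub_cancel] at h1
  filter_upwards [hΨL, ae_all_iff.2 hrate, hinc'] with ω h1 h2 h3
  refine ⟨h1, ?_, h3⟩
  have hlin : LipschitzWith ‖p‖₊ fun y : Ed n => inner ℝ p y := by
    refine LipschitzWith.of_dist_le_mul fun y y' => ?_
    rw [Real.dist_eq, ← inner_sub_right, dist_eq_norm]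
    exact abs_real_inner_le_norm _ _
  refine (h1.sub hlin).tendsto_sublinear fun k => ?_
  have := (h2 k).sub_const (inner ℝ p (s k))
  rw [sub_self] at this
  refine this.congr' ?_
  filter_upwards [eventually_gt_atTop 0] with K hK
  have hKp : (K : ℝ) ≠ 0 := by positivity
  rw [inner_smul_right, sub_div, mul_div_cancel_left₀ _ hKp]

end IsCocycle
end Realization

section Cost
set_option linter.unusedSectionVars false
variable {n : ℕ} {Ω : Type*} [MeasurableSpace Ω] {P : Measure Ω} {τ : Ed n → Ω → Ω}

lemma ConvexOn.continuous_univ {f : Ed n → ℝ} (hf : ConvexOn ℝ univ f) : Continuous f :=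
  hf.locallyLipschitz.continuous

lemma ConvexOn.exists_inner_le_of_lt {f : Ed n → ℝ} (hf : ConvexOn ℝ univ f) {p : Ed n} {a : ℝ}
    (ha : a < f p) : ∃ ζ : Ed n, ∀ q, inner ℝ ζ (q - p) + a ≤ f q := by
  obtain ⟨l, c, hle, heq⟩ := hf.exists_affine_le_of_lt (𝕜 := ℝ) (mem_univ p) ha isClosed_univ
    (hf.continuous_univ.lowerSemicontinuous.lowerSemicontinuousOn _)
  refine ⟨(InnerProductSpace.toDual ℝ (Ed n)).symm l, fun q => ?_⟩
  have h1 : l q + c ≤ f q := hle ⟨q, mem_univ q⟩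
  have h2 : l p + c = a := heq
  rw [InnerProductSpace.toDual_symm_apply, map_sub]
  linarith

lemma tendsto_slope_seq {ψ : Ed n → ℝ} {y : Ed n} (hy : DifferentiableAt ℝ ψ y) (ζ : Ed n) :
    Tendsto (fun m : ℕ => ((m : ℝ) + 1) * (ψ (y + (1 / ((m : ℝ) + 1)) • ζ) - ψ y))
      atTop (nhds (inner ℝ (gradient ψ y) ζ)) := by
  have hg : HasFDerivAt ψ (InnerProductSpace.toDual ℝ (Ed n) (gradient ψ y)) y :=
    hy.hasGradientAt.hasFDerivAt
  have h := hg.lim ζ (c := fun m : ℕ => (m : ℝ) + 1) (l := atTop) (by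
    refine (tendsto_atTop_add_const_right atTop (1 : ℝ)
      (tendsto_natCast_atTop_atTop (R := ℝ))).congr fun m => ?_
    rw [Real.norm_of_nonneg (by positivity)])
  rw [InnerProductSpace.toDual_apply_apply] at h
  simpa only [one_div, smul_eq_mul] using h

lemma tendsto_add_one_div_smul (y ζ : Ed n) :
    Tendsto (fun m : ℕ => y + (1 / ((m : ℝ) + 1)) • ζ) atTop (nhds y) := by
  simpa using ((tendsto_one_div_add_atTop_nhds_zero_nat (𝕜 := ℝ)).smul_const ζ).const_add y

/-- The standing assumptions on a stationary random Hamiltonian. -/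
structure IsHam (τ : Ed n → Ω → Ω) (H : Ed n → Ed n → Ω → ℝ) : Prop where
  meas : ∀ p y, Measurable (H p y)
  stat : ∀ p y z ω, H p y (τ z ω) = H p (y + z) ω
  conv : ∀ y ω, ConvexOn ℝ univ (fun p => H p y ω)
  coer : ∀ ω, ∀ C : ℝ, ∃ R : ℝ, ∀ p y, R ≤ ‖p‖ → C ≤ H p y ω
  bdd : ∀ R > (0 : ℝ), ∃ C : ℝ, ∀ ω p y, ‖p‖ < R → |H p y ω| ≤ C
  equi : ∀ R > (0 : ℝ), ∀ ε > (0 : ℝ), ∃ δ > (0 : ℝ), ∀ (ω : Ω) (p₁ p₂ y₁ y₂ : Ed n),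
      ‖p₁‖ < R → ‖p₂‖ < R → dist p₁ p₂ < δ → dist y₁ y₂ < δ →
      |H p₁ y₁ ω - H p₂ y₂ ω| ≤ ε

instance nonempty_ball_natCast (R : ℕ) : Nonempty (ball (0 : Ed n) ((R : ℝ) + 1)) :=
  ⟨⟨0, mem_ball_self (by positivity)⟩⟩

/-- A dense sequence in the ball of radius `R + 1`. -/
def ballSeq (n R k : ℕ) : Ed n :=
  (TopologicalSpace.denseSeq (ball (0 : Ed n) ((R : ℝ) + 1)) k).1

lemma norm_ballSeq_lt (R k : ℕ) : ‖ballSeq n R k‖ < R + 1 :=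
  mem_ball_zero_iff.1 (TopologicalSpace.denseSeq (ball (0 : Ed n) ((R : ℝ) + 1)) k).2

/-- The cost of moving by `z` in time `t`, for momenta in the ball of radius `R + 1`. -/
def cost (H : Ed n → Ed n → Ω → ℝ) (R : ℕ) (z : Ed n) (t : ℝ) (ω : Ω) : ℝ :=
  ⨆ k : ℕ, (inner ℝ z (ballSeq n R k) - t * H (ballSeq n R k) 0 ω)

namespace IsHam
variable {H : Ed n → Ed n → Ω → ℝ}

lemma continuous_left (hH : IsHam τ H) (y : Ed n) (ω : Ω) : Continuous fun p => H p y ω :=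
  (hH.conv y ω).continuous_univ

lemma exists_lower_bound (hH : IsHam τ H) (ω : Ω) : ∃ m, ∀ p y, m ≤ H p y ω := by
  obtain ⟨R, hR⟩ := hH.coer ω 0
  obtain ⟨C, hC⟩ := hH.bdd (max R 0 + 1) (by positivity)
  refine ⟨min 0 (-C), fun p y => ?_⟩
  rcases le_or_gt R ‖p‖ with h | h
  · exact (min_le_left _ _).trans (hR p y h)
  · have := hC ω p y (h.trans_le (by linarith [le_max_left R 0]))
    exact (min_le_right _ _).trans (abs_le.1 this).1

lemma bddBelow_effSetR (hH : IsHam τ H) (ω : Ω) (p : Ed n) : BddBelow (effSetR H ω p) := by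
  obtain ⟨m, hm⟩ := hH.exists_lower_bound ω
  refine ⟨m, ?_⟩
  rintro μ ⟨w, -, -, hw⟩
  obtain ⟨y, hy⟩ := hw.exists
  exact (hm _ _).trans hy

lemma exists_cost_bound (hH : IsHam τ H) (R : ℕ) (z : Ed n) (t : ℝ) :
    ∃ B, 0 < B ∧ ∀ ω k, |inner ℝ z (ballSeq n R k) - t * H (ballSeq n R k) 0 ω| ≤ B := by
  obtain ⟨C, hC⟩ := hH.bdd (R + 1) (by positivity)
  have hp : 0 ≤ ‖z‖ * (R + 1) + |t| * |C| := by positivity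
  refine ⟨‖z‖ * (R + 1) + |t| * |C| + 1, by linarith, fun ω k => ?_⟩
  have h1 := hC ω _ 0 (norm_ballSeq_lt (n := n) R k)
  have h2 := abs_real_inner_le_norm z (ballSeq n R k)
  have h3 := mul_le_mul_of_nonneg_left (norm_ballSeq_lt (n := n) R k).le (norm_nonneg z)
  have h4 := mul_le_mul_of_nonneg_left (h1.trans (le_abs_self C)) (abs_nonneg t)
  rw [← abs_mul] at h4
  have := abs_sub (inner ℝ z (ballSeq n R k)) (t * H (ballSeq n R k) 0 ω)
  linarith

lemma bddAbove_cost (hH : IsHam τ H) (R : ℕ) (z : Ed n) (t : ℝ) (ω : Ω) :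
    BddAbove (range fun k : ℕ => inner ℝ z (ballSeq n R k) - t * H (ballSeq n R k) 0 ω) := by
  obtain ⟨B, -, hB⟩ := hH.exists_cost_bound R z t
  exact ⟨B, by rintro _ ⟨k, rfl⟩; exact (abs_le.1 (hB ω k)).2⟩

lemma cost_le {R : ℕ} {z : Ed n} {t : ℝ} {ω : Ω} {a : ℝ}
    (h : ∀ q, inner ℝ z q - t * H q 0 ω ≤ a) : cost H R z t ω ≤ a :=
  ciSup_le fun _ => h _

lemma le_cost (hH : IsHam τ H) {R : ℕ} (z : Ed n) (t : ℝ) (ω : Ω) {q : Ed n} (hq : ‖q‖ < R + 1) :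
    inner ℝ z q - t * H q 0 ω ≤ cost H R z t ω := by
  have hc : Continuous fun q : ball (0 : Ed n) ((R : ℝ) + 1) =>
      inner ℝ z q.1 - t * H q.1 0 ω :=
    (continuous_const.inner continuous_subtype_val).sub
      (continuous_const.mul ((hH.continuous_left 0 ω).comp continuous_subtype_val))
  exact (TopologicalSpace.denseRange_denseSeq _).induction_on
    (p := fun q : ball (0 : Ed n) ((R : ℝ) + 1) =>
      inner ℝ z q.1 - t * H q.1 0 ω ≤ cost H R z t ω)
    ⟨q, mem_ball_zero_iff.2 hq⟩ (isClosed_le hc continuous_const)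
    fun k => le_ciSup (hH.bddAbove_cost R z t ω) k

lemma cost_smul (R : ℕ) (z : Ed n) {t : ℝ} (ht : 0 ≤ t) (ω : Ω) :
    cost H R (t • z) t ω = t * cost H R z 1 ω := by
  unfold cost
  rw [Real.mul_iSup_of_nonneg ht]
  congr 1; ext k
  rw [inner_smul_left]
  simp only [conj_trivial]
  ring

lemma cost_le_add (hH : IsHam τ H) (R : ℕ) (z z' : Ed n) (t : ℝ) (ω : Ω) :
    cost H R z t ω ≤ cost H R z' t ω + (R + 1) * ‖z - z'‖ := by
  refine ciSup_le fun k => ?_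
  have h1 := le_ciSup (hH.bddAbove_cost R z' t ω) k
  change _ ≤ cost H R z' t ω at h1
  have h2 := real_inner_le_norm (z - z') (ballSeq n R k)
  have h3 := mul_le_mul_of_nonneg_left (norm_ballSeq_lt (n := n) R k).le (norm_nonneg (z - z'))
  rw [inner_sub_left] at h2
  linarith

lemma isTestFun_cost (hH : IsHam τ H) (R : ℕ) (z : Ed n) (t : ℝ) :
    IsTestFun τ (cost H R z t) where
  meas := Measurable.iSup fun k => measurable_const.sub ((hH.meas _ _).const_mul _)
  bdd := by
    obtain ⟨B, hB0, hB⟩ := hH.exists_cost_bound R z t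
    refine ⟨B, hB0, fun ω => abs_le.2 ⟨?_, ciSup_le fun k => (abs_le.1 (hB ω k)).2⟩⟩
    exact (abs_le.1 (hB ω 0)).1.trans (le_ciSup (hH.bddAbove_cost R z t ω) 0)
  uc ε hε := by
    obtain ⟨δ, hδ, hd⟩ := hH.equi (R + 1) (by positivity) (ε / (|t| + 1)) (by positivity)
    refine ⟨δ, hδ, fun y hy ω => ?_⟩
    have key : ∀ k, |t * H (ballSeq n R k) 0 (τ y ω) - t * H (ballSeq n R k) 0 ω| ≤ ε := by
      intro k
      have h1 := hd ω _ _ (0 + y) 0 (norm_ballSeq_lt (n := n) R k) (norm_ballSeq_lt (n := n) R k)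
        (by simpa using hδ) (by simpa using hy)
      rw [← mul_sub, abs_mul, hH.stat]
      calc |t| * _ ≤ |t| * (ε / (|t| + 1)) := by gcongr
        _ ≤ (|t| + 1) * (ε / (|t| + 1)) := by gcongr; linarith
        _ = ε := by field_simp
    rw [abs_le]
    constructor
    · rw [neg_le_sub_iff_le_add]
      refine ciSup_le fun k => ?_
      have h1 := le_ciSup (hH.bddAbove_cost R z t (τ y ω)) k
      change _ ≤ cost H R z t (τ y ω) at h1
      have := abs_le.1 (key k)
      linarith [this.1, this.2]
    · rw [sub_le_iff_le_add]
      refine ciSup_le fun k => ?_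
      have h1 := le_ciSup (hH.bddAbove_cost R z t ω) k
      change _ ≤ cost H R z t ω at h1
      have := abs_le.1 (key k)
      linarith [this.1, this.2]

/-- A function whose increments are bounded by the cost is a subsolution. -/
lemma le_of_increment_le (hH : IsHam τ H) {ω : Ω} {R : ℕ} {ψ : Ed n → ℝ} {μ d : ℝ} (hd : 0 < d)
    {L : ℝ≥0} (hψ : LipschitzWith L ψ)
    (hinc : ∀ i j m : ℕ, ‖TopologicalSpace.denseSeq (Ed n) j - TopologicalSpace.denseSeq (Ed n) i‖
        ≤ d → ψ (TopologicalSpace.denseSeq (Ed n) j) - ψ (TopologicalSpace.denseSeq (Ed n) i) ≤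
      (1 / ((m : ℝ) + 1)) * μ + cost H R
        (TopologicalSpace.denseSeq (Ed n) j - TopologicalSpace.denseSeq (Ed n) i)
        (1 / ((m : ℝ) + 1)) (τ (TopologicalSpace.denseSeq (Ed n) i) ω))
    {y : Ed n} (hy : DifferentiableAt ℝ ψ y) (hstat : ∀ a b, τ (a + b) ω = τ a (τ b ω)) :
    H (gradient ψ y) y ω ≤ μ := by
  set s := TopologicalSpace.denseSeq (Ed n) with hs
  have hdense := TopologicalSpace.denseRange_denseSeq (Ed n)
  have hL : (0 : ℝ) ≤ L := L.2
  have h1 : ∀ (z : Ed n) (m : ℕ), ‖z‖ < d → ψ (y + z) - ψ y ≤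
      (1 / ((m : ℝ) + 1)) * μ + cost H R z (1 / ((m : ℝ) + 1)) (τ y ω) := by
    intro z m hz
    refine le_of_forall_pos_le_add fun ε hε => ?_
    obtain ⟨δ, hδ, huc⟩ := (hH.isTestFun_cost R z (1 / ((m : ℝ) + 1))).uc (ε / 2) (half_pos hε)
    set η := min (min δ ((d - ‖z‖) / 2)) (ε / (4 * (L + (R + 1)))) with hη
    have hLR : 0 < (L : ℝ) + (R + 1) := by positivity
    have hη0 : 0 < η := lt_min (lt_min hδ (by linarith)) (by positivity)
    obtain ⟨i, hi⟩ := hdense.exists_dist_lt y hη0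
    obtain ⟨j, hj⟩ := hdense.exists_dist_lt (y + z) hη0
    rw [dist_eq_norm] at hi hj
    change ‖y - s i‖ < η at hi
    change ‖y + z - s j‖ < η at hj
    have hη1 : η ≤ δ := (min_le_left _ _).trans (min_le_left _ _)
    have hη2 : η ≤ (d - ‖z‖) / 2 := (min_le_left _ _).trans (min_le_right _ _)
    have hη3 : η * (4 * (L + (R + 1))) ≤ ε := by
      rw [← le_div_iff₀ (by positivity)]; exact min_le_right _ _
    have hzz : ‖(s j - s i) - z‖ ≤ 2 * η := by
      have : (s j - s i) - z = (y - s i) - (y + z - s j) := by abel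
      rw [this]
      refine (norm_sub_le _ _).trans (by linarith)
    have hji : ‖s j - s i‖ ≤ d := by
      have := norm_add_le ((s j - s i) - z) z
      rw [sub_add_cancel] at this
      linarith
    have a1 := hinc i j m hji
    have a2 := hH.cost_le_add R (s j - s i) z (1 / ((m : ℝ) + 1)) (τ (s i) ω)
    have a3 := huc (s i - y) (by rw [norm_sub_rev]; linarith) (τ y ω)
    rw [← hstat, sub_add_cancel] at a3
    have a4 := (abs_le.1 a3).2
    have a5 := hψ.sub_le_norm (y + z) (s j)
    have a6 := hψ.sub_le_norm (s i) y
    rw [norm_sub_rev] at a6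
    have b1 := mul_le_mul_of_nonneg_left hi.le hL
    have b2 := mul_le_mul_of_nonneg_left hj.le hL
    have b3 := mul_le_mul_of_nonneg_left hzz (show (0 : ℝ) ≤ R + 1 by positivity)
    linarith
  have h2 : ∀ ζ, inner ℝ (gradient ψ y) ζ ≤ μ + cost H R ζ 1 (τ y ω) := by
    intro ζ
    have hlim := tendsto_slope_seq hy ζ
    refine le_of_tendsto hlim ?_
    have hsmall : ∀ᶠ m : ℕ in atTop, ‖(1 / ((m : ℝ) + 1)) • ζ‖ < d := by
      have : Tendsto (fun m : ℕ => ‖(1 / ((m : ℝ) + 1)) • ζ‖) atTop (nhds 0) := by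
        have := (tendsto_one_div_add_atTop_nhds_zero_nat (𝕜 := ℝ)).smul_const ζ
        rw [zero_smul] at this
        simpa using this.norm
      exact this.eventually (gt_mem_nhds hd)
    filter_upwards [hsmall] with m hm
    have hm0 : (0 : ℝ) < (m : ℝ) + 1 := by positivity
    have := h1 _ m hm
    rw [cost_smul R ζ (by positivity)] at this
    have h3 := mul_le_mul_of_nonneg_left this hm0.le
    refine h3.trans (le_of_eq ?_)
    field_simp
  refine le_of_forall_lt_imp_le_of_dense fun a ha => ?_
  obtain ⟨ζ, hζ⟩ := ConvexOn.exists_inner_le_of_lt (hH.conv y ω) ha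
  have h3 : cost H R ζ 1 (τ y ω) ≤ inner ℝ ζ (gradient ψ y) - a := by
    refine cost_le fun q => ?_
    have h4 := hζ q
    rw [inner_sub_right] at h4
    rw [hH.stat, zero_add]
    linarith
  have h5 := h2 ζ
  rw [real_inner_comm] at h5
  linarith


end IsHam
end Cost

section Slope
variable {n : ℕ} {Ω : Type*} [MeasurableSpace Ω] {P : Measure Ω} {τ : Ed n → Ω → Ω}

lemma ae_tubeMeasure_mem_ball (a : Ed n) {z : Ed n} {K : ℕ} {r ρ : ℝ}
    (hρ : K * ‖z‖ + r < ρ) : ∀ᵐ y ∂tubeMeasure a z K r, y ∈ ball a ρ := by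
  have key : ∀ j ∈ Finset.range K, (volume.restrict (closedBall (a + (j : ℝ) • z) r))
      (ball a ρ)ᶜ = 0 := by
    intro j hj
    rw [Measure.restrict_apply isOpen_ball.measurableSet.compl]
    convert measure_empty (μ := (volume : Measure (Ed n)))
    rw [← disjoint_iff_inter_eq_empty, disjoint_compl_left_iff_subset]
    refine closedBall_subset_ball' ?_
    have hj' : (j : ℝ) ≤ K := by exact_mod_cast (Finset.mem_range.1 hj).le
    rw [dist_eq_norm, add_sub_cancel_left, norm_smul, Real.norm_natCast]
    have := mul_le_mul_of_nonneg_right hj' (norm_nonneg z)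
    linarith
  rw [ae_iff]
  change tubeMeasure a z K r (ball a ρ)ᶜ = 0
  unfold tubeMeasure
  rw [Measure.smul_apply, Measure.coe_finsetSum, Finset.sum_apply,
    Finset.sum_eq_zero, smul_zero]
  intro j hj
  rw [Measure.smul_apply, key j hj, smul_zero]

/-- The costs of the increments of the dense sequence. -/
def costFuns (H : Ed n → Ed n → Ω → ℝ) : Set (Ω → ℝ) :=
  range fun q : ℕ × ℕ × ℕ × ℕ => cost H q.1
    (TopologicalSpace.denseSeq (Ed n) q.2.1 - TopologicalSpace.denseSeq (Ed n) q.2.2.1)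
    (1 / ((q.2.2.2 : ℝ) + 1))

namespace IsHam
variable {H : Ed n → Ed n → Ω → ℝ}

lemma effHR_le_of_cocycle [IsProbabilityMeasure P] (h : IsErgodicAction P τ) (hH : IsHam τ H)
    {L : ℝ≥0} {Φ : Ed n → Ω → ℝ} (hΦ : IsCocycle P τ L Φ) {p : Ed n}
    (hp : ∀ z, ∫ ω, Φ z ω ∂P = inner ℝ p z) {R : ℕ} {μ d : ℝ} (hd : 0 < d)
    (hle : ∀ i j m : ℕ,
      ‖TopologicalSpace.denseSeq (Ed n) j - TopologicalSpace.denseSeq (Ed n) i‖ ≤ d →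
      ∀ᵐ ω ∂P, Φ (TopologicalSpace.denseSeq (Ed n) j - TopologicalSpace.denseSeq (Ed n) i) ω ≤
        (1 / ((m : ℝ) + 1)) * μ + cost H R
          (TopologicalSpace.denseSeq (Ed n) j - TopologicalSpace.denseSeq (Ed n) i)
          (1 / ((m : ℝ) + 1)) ω) :
    ∀ᵐ ω ∂P, effHR H ω p ≤ μ := by
  obtain ⟨Ψ, hΨ⟩ := hΦ.exists_realization h hp
  have hle' : ∀ᵐ ω ∂P, ∀ i j m : ℕ,
      ‖TopologicalSpace.denseSeq (Ed n) j - TopologicalSpace.denseSeq (Ed n) i‖ ≤ d →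
      Φ (TopologicalSpace.denseSeq (Ed n) j - TopologicalSpace.denseSeq (Ed n) i)
          (τ (TopologicalSpace.denseSeq (Ed n) i) ω) ≤
        (1 / ((m : ℝ) + 1)) * μ + cost H R
          (TopologicalSpace.denseSeq (Ed n) j - TopologicalSpace.denseSeq (Ed n) i)
          (1 / ((m : ℝ) + 1)) (τ (TopologicalSpace.denseSeq (Ed n) i) ω) := by
    simp only [ae_all_iff]
    intro i j m hij
    exact (h.mp _).quasiMeasurePreserving.ae (hle i j m hij)
  filter_upwards [hΨ, hle'] with ω ⟨hL, hlim, hinc⟩ hω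
  refine csInf_le (hH.bddBelow_effSetR ω p) ⟨fun y => Ψ ω y - inner ℝ p y, ?_, hlim, ?_⟩
  · have hlin : LipschitzWith ‖innerSL ℝ p‖₊ (fun y : Ed n => (inner ℝ p y : ℝ)) :=
      (innerSL ℝ p).lipschitz
    exact ⟨_, hL.sub hlin⟩
  · filter_upwards [hL.ae_differentiableAt (μ := volume)] with y hy
    have hgrad : p + gradient (fun y => Ψ ω y - inner ℝ p y) y = gradient (Ψ ω) y := by
      have h1 : HasGradientAt (fun y : Ed n => (inner ℝ p y : ℝ)) p y := by
        rw [hasGradientAt_iff_hasFDerivAt]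
        exact (innerSL ℝ p).hasFDerivAt
      have h2 : HasGradientAt (fun y => Ψ ω y - inner ℝ p y) (gradient (Ψ ω) y - p) y := by
        rw [hasGradientAt_iff_hasFDerivAt, map_sub]
        exact hy.hasGradientAt.hasFDerivAt.sub h1.hasFDerivAt
      rw [h2.gradient]; abel
    rw [hgrad]
    exact hH.le_of_increment_le hd hL
      (fun i j m hij => by rw [hinc i j]; exact hω i j m hij) hy (fun a b => h.add a b ω)

/-- Large-scale slopes of functions with increments bounded by the cost are realised by momenta
in the corresponding sublevel set of the effective Hamiltonian. -/
lemma ae_exists_slope [IsProbabilityMeasure P] (h : IsErgodicAction P τ) (hH : IsHam τ H) :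
    ∀ᵐ ω ∂P, ∀ (R : ℕ) (L : ℝ≥0) (μ d M ρ c : ℝ) (z : Ed n) (K : ℕ → ℕ) (a : ℕ → Ed n)
      (ϕ : ℕ → Ed n → ℝ), 0 < d → 0 ≤ M → ‖z‖ < ρ → (∀ k, 0 < K k) → Tendsto K atTop atTop →
      (∀ k, ‖a k‖ ≤ M * K k) → (∀ k, LipschitzWith L (ϕ k)) →
      (∀ k, ∀ w, ‖w‖ ≤ d → ∀ t > 0, ∀ y ∈ ball (a k) (ρ * K k),
        ϕ k (y + w) - ϕ k y ≤ t * μ + cost H R w t (τ y ω)) →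
      (∀ k, c ≤ (ϕ k (a k + (K k : ℝ) • z) - ϕ k (a k)) / K k) →
      ∀ δ > 0, ∃ p : Ed n, (∀ᵐ ω' ∂P, effHR H ω' p ≤ μ) ∧ c - δ ≤ inner ℝ p z := by
  obtain ⟨V, hV, hSV, hgood⟩ := exists_testSpace h (S := costFuns H) (countable_range _) (by
    rintro _ ⟨q, rfl⟩
    exact hH.isTestFun_cost _ _ _)
  filter_upwards [hgood] with ω hω R L μ d M ρ c z K a ϕ hd hM hρ hK hKt ha hL hinc hc δ hδ
  obtain ⟨η, hη, hη1, hη2⟩ : ∃ η : ℝ, 0 < η ∧ ‖z‖ + η < ρ ∧ 2 * L * η ≤ δ := by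
    refine ⟨min ((ρ - ‖z‖) / 2) (δ / (2 * L + 1)), lt_min (by linarith) (by positivity), ?_, ?_⟩
    · linarith [min_le_left ((ρ - ‖z‖) / 2) (δ / (2 * (L : ℝ) + 1))]
    · have h1 := min_le_right ((ρ - ‖z‖) / 2) (δ / (2 * (L : ℝ) + 1))
      have h2 : (0 : ℝ) ≤ 2 * L := by positivity
      have h3 : (2 * (L : ℝ) + 1) * (δ / (2 * L + 1)) = δ := by field_simp
      have h4 : 0 < δ / (2 * (L : ℝ) + 1) := by positivity
      have h5 := mul_le_mul_of_nonneg_left h1 h2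
      linarith
  have hF := isFolner_tubeMeasure z hη hM hK hKt ha
  obtain ⟨Φ, hΦ, hΦle, hΦlim⟩ := exists_limit_cocycle h hV hF hω hL
  obtain ⟨p, hp⟩ := hΦ.exists_mean h
  refine ⟨p, effHR_le_of_cocycle h hH hΦ hp (R := R) hd fun i j m hij => ?_, ?_⟩
  · refine hΦle _ (fun ω' => (1 / ((m : ℝ) + 1)) * μ + cost H R
          (TopologicalSpace.denseSeq (Ed n) j - TopologicalSpace.denseSeq (Ed n) i)
          (1 / ((m : ℝ) + 1)) ω') ?_ (Eventually.of_forall fun k => ?_)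
    · refine V.add_mem ?_ (hSV ⟨(R, j, i, m), rfl⟩)
      have := V.smul_mem ((1 / ((m : ℝ) + 1)) * μ) hV.one
      convert this using 1
      ext ω'; simp
    · have hK0 : (0 : ℝ) < K k := by exact_mod_cast hK k
      filter_upwards [ae_tubeMeasure_mem_ball (a k) (z := z) (K := K k) (r := η * K k) (ρ := ρ * K k)
        (by nlinarith)] with y hy
      exact hinc k _ hij _ (by positivity) y hy
  · rw [← hp z]
    refine ge_of_tendsto (hΦlim z) (Eventually.of_forall fun k => ?_)
    have hK0 : (0 : ℝ) < K k := by exact_mod_cast hK k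
    have h1 := telescoping_tubeMeasure (hL k) (a k) z (hK k) (r := η * K k) (by positivity)
    have h2 : 2 * L * (η * K k) / K k = 2 * L * η := by field_simp
    rw [h2] at h1
    linarith [(abs_le.1 h1).1, hc k]

end IsHam
end Slope

section Increments
variable {n : ℕ}

lemma inner_gradient_eq_fderiv (ψ : Ed n → ℝ) (y w : Ed n) :
    inner ℝ (gradient ψ y) w = fderiv ℝ ψ y w := by
  rw [gradient, InnerProductSpace.toDual_symm_apply]

lemma norm_gradient_eq (ψ : Ed n → ℝ) (y : Ed n) : ‖gradient ψ y‖ = ‖fderiv ℝ ψ y‖ := by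
  rw [gradient, LinearIsometryEquiv.norm_map]

lemma LipschitzWith.norm_gradient_le {ψ : Ed n → ℝ} {L : ℝ≥0} (hψ : LipschitzWith L ψ) (y : Ed n) :
    ‖gradient ψ y‖ ≤ L := by
  rw [norm_gradient_eq]; exact norm_fderiv_le_of_lipschitz ℝ hψ

lemma LipschitzWith.ae_differentiableAt_add {ψ : Ed n → ℝ} {L : ℝ≥0} (hψ : LipschitzWith L ψ)
    (x : Ed n) : ∀ᵐ y ∂(volume : Measure (Ed n)), DifferentiableAt ℝ ψ (x + y) :=
  (measurePreserving_add_left volume x).quasiMeasurePreserving.ae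
    (hψ.ae_differentiableAt (μ := volume))

lemma LipschitzWith.hasDerivAt_integral_ball {ψ : Ed n → ℝ} {L : ℝ≥0} (hψ : LipschitzWith L ψ)
    (x w : Ed n) (s t : ℝ) :
    HasDerivAt (fun t : ℝ => ∫ y in ball (0 : Ed n) s, ψ (x + t • w + y))
      (∫ y in ball (0 : Ed n) s, fderiv ℝ ψ (x + t • w + y) w) t := by
  have hvol : volume (ball (0 : Ed n) s) ≠ ⊤ := measure_ball_lt_top.ne
  have hfin : IsFiniteMeasure (volume.restrict (ball (0 : Ed n) s)) :=
    ⟨by rw [Measure.restrict_apply_univ]; exact measure_ball_lt_top⟩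
  have hcont : ∀ t : ℝ, Continuous fun y => ψ (x + t • w + y) := fun t =>
    hψ.continuous.comp (continuous_const.add continuous_id)
  refine (hasDerivAt_integral_of_dominated_loc_of_lip (s := univ) (bound := fun _ => L * ‖w‖)
    univ_mem (Eventually.of_forall fun t => (hcont t).aestronglyMeasurable) ?_ ?_ ?_
    (integrable_const _) ?_).2
  · exact ((hcont t).locallyIntegrable.integrableOn_isCompact
      (isCompact_closedBall (0 : Ed n) s)).mono_set ball_subset_closedBall
  · exact ((measurable_fderiv_apply_const ℝ ψ w).comp
      (measurable_const_add _)).aestronglyMeasurable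
  · refine Eventually.of_forall fun y => LipschitzOnWith.of_dist_le_mul fun t₁ _ t₂ _ => ?_
    refine (hψ.dist_le_mul _ _).trans (le_of_eq ?_)
    rw [dist_add_right, dist_add_left, dist_eq_norm, ← sub_smul, norm_smul, Real.dist_eq,
      Real.norm_eq_abs, Real.coe_nnabs, abs_of_nonneg (by positivity : (0 : ℝ) ≤ L * ‖w‖)]
    ring
  · refine ae_restrict_of_ae ?_
    filter_upwards [hψ.ae_differentiableAt_add (x + t • w)] with y hy
    have h1 : HasDerivAt (fun t : ℝ => x + t • w + y) w t := by
      simpa using (((hasDerivAt_id t).smul_const w).const_add x).add_const y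
    exact hy.hasFDerivAt.comp_hasDerivAt t h1

lemma LipschitzWith.sub_le_of_ae_inner_gradient_le {ψ : Ed n → ℝ} {L : ℝ≥0}
    (hψ : LipschitzWith L ψ) {a x w : Ed n} {r c : ℝ}
    (h : ∀ᵐ y ∂(volume : Measure (Ed n)), y ∈ ball a r → inner ℝ (gradient ψ y) w ≤ c)
    (hx : x ∈ ball a r) (hxw : x + w ∈ ball a r) : ψ (x + w) - ψ x ≤ c := by
  rw [mem_ball, dist_eq_norm] at hx hxw
  set s₀ := min (r - ‖x - a‖) (r - ‖x + w - a‖) with hs₀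
  have hs₀0 : 0 < s₀ := lt_min (by linarith) (by linarith)
  have key : ∀ s, 0 < s → s < s₀ → ψ (x + w) - ψ x ≤ c + 2 * L * s := by
    intro s hs hss
    have hfin : IsFiniteMeasure (volume.restrict (ball (0 : Ed n) s)) :=
      ⟨by rw [Measure.restrict_apply_univ]; exact measure_ball_lt_top⟩
    have hcont : ∀ z : Ed n, IntegrableOn (fun y => ψ (z + y)) (ball (0 : Ed n) s) := fun z =>
      ((hψ.continuous.comp (continuous_const.add continuous_id)).locallyIntegrable
        |>.integrableOn_isCompact (isCompact_closedBall (0 : Ed n) s)).mono_set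
          ball_subset_closedBall
    have hd := hψ.hasDerivAt_integral_ball x w s
    set v := volume.real (ball (0 : Ed n) s) with hv
    have hv0 : 0 < v := ENNReal.toReal_pos (measure_ball_pos _ _ hs).ne' measure_ball_lt_top.ne
    have hle : ∀ t ∈ interior (Icc (0 : ℝ) 1),
        deriv (fun t : ℝ => ∫ y in ball (0 : Ed n) s, ψ (x + t • w + y)) t ≤ v * c := by
      intro t ht
      rw [(hd t).deriv]
      have ht' : t ∈ Icc (0 : ℝ) 1 := interior_subset ht
      have hmem : ∀ y ∈ ball (0 : Ed n) s, x + t • w + y ∈ ball a r := by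
        intro y hy
        rw [mem_ball_zero_iff] at hy
        rw [mem_ball, dist_eq_norm]
        have e : x + t • w + y - a = (1 - t) • (x - a) + t • (x + w - a) + y := by module
        rw [e]
        have h1 := norm_add_le ((1 - t) • (x - a) + t • (x + w - a)) y
        have h2 := norm_add_le ((1 - t) • (x - a)) (t • (x + w - a))
        rw [norm_smul, norm_smul, Real.norm_of_nonneg ht'.1,
          Real.norm_of_nonneg (sub_nonneg.2 ht'.2)] at h2
        have h3 : ‖x - a‖ ≤ r - s₀ := by linarith [min_le_left (r - ‖x - a‖) (r - ‖x + w - a‖)]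
        have h4 : ‖x + w - a‖ ≤ r - s₀ := by
          linarith [min_le_right (r - ‖x - a‖) (r - ‖x + w - a‖)]
        have h5 := mul_le_mul_of_nonneg_left h3 (sub_nonneg.2 ht'.2)
        have h6 := mul_le_mul_of_nonneg_left h4 ht'.1
        linarith
      have hae : ∀ᵐ y ∂volume.restrict (ball (0 : Ed n) s),
          fderiv ℝ ψ (x + t • w + y) w ≤ c := by
        rw [ae_restrict_iff' isOpen_ball.measurableSet]
        filter_upwards [(measurePreserving_add_left volume
          (x + t • w)).quasiMeasurePreserving.ae h] with y hy hys
        rw [← inner_gradient_eq_fderiv]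
        exact hy (hmem y hys)
      have hint : Integrable (fun y => fderiv ℝ ψ (x + t • w + y) w)
          (volume.restrict (ball (0 : Ed n) s)) := by
        refine Integrable.of_bound ((measurable_fderiv_apply_const ℝ ψ w).comp
          (measurable_const_add _)).aestronglyMeasurable (L * ‖w‖)
          (Eventually.of_forall fun y => ?_)
        exact (ContinuousLinearMap.le_opNorm _ _).trans
          (mul_le_mul_of_nonneg_right (norm_fderiv_le_of_lipschitz ℝ hψ) (norm_nonneg w))
      have := integral_mono_ae hint (integrable_const c) hae
      simpa [hv, measureReal_restrict_apply_univ] using this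
    have hmv := (convex_Icc (0 : ℝ) 1).image_sub_le_mul_sub_of_deriv_le
      (fun t _ => (hd t).continuousAt.continuousWithinAt)
      (fun t _ => (hd t).differentiableAt.differentiableWithinAt) hle 0 (by simp) 1 (by simp)
      zero_le_one
    simp only [one_smul, zero_smul, add_zero, sub_zero, mul_one] at hmv
    rw [← integral_sub (hcont _) (hcont _)] at hmv
    have hlow : v * (ψ (x + w) - ψ x - 2 * L * s) ≤
        ∫ y in ball (0 : Ed n) s, (ψ (x + w + y) - ψ (x + y)) := by
      have := setIntegral_mono_on (f := fun _ => ψ (x + w) - ψ x - 2 * L * s)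
        (g := fun y => ψ (x + w + y) - ψ (x + y)) (μ := volume) (s := ball (0 : Ed n) s)
        (integrable_const _) ((hcont _).sub (hcont _)) isOpen_ball.measurableSet (by
          intro y hy
          rw [mem_ball_zero_iff] at hy
          have h1 := hψ.sub_le_norm (x + w) (x + w + y)
          have h2 := hψ.sub_le_norm (x + y) x
          rw [show x + w - (x + w + y) = -y by abel, norm_neg] at h1
          rw [add_sub_cancel_left] at h2
          have := mul_le_mul_of_nonneg_left hy.le L.2
          simp only [NNReal.val_eq_coe] at this
          linarith)
      simpa [hv, measureReal_restrict_apply_univ] using this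
    have := le_of_mul_le_mul_left (hlow.trans hmv) hv0
    linarith
  refine le_of_forall_pos_le_add fun ε hε => ?_
  set s := min (s₀ / 2) (ε / (2 * L + 1)) with hs
  have hs0 : 0 < s := lt_min (by linarith) (by positivity)
  have h1 : s ≤ ε / (2 * L + 1) := min_le_right _ _
  rw [le_div_iff₀ (by positivity)] at h1
  have h2 := key s hs0 ((min_le_left _ _).trans_lt (by linarith))
  linarith

end Increments

section Rescaled
variable {n : ℕ} {Ω : Type*} [MeasurableSpace Ω] {P : Measure Ω} {τ : Ed n → Ω → Ω}

lemma gradient_rescale (u : Ed n → ℝ) {ε : ℝ} (hε : ε ≠ 0) (z : Ed n) :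
    gradient (fun z => ε⁻¹ * u (ε • z)) z = gradient u (ε • z) := by
  have h : fderiv ℝ (fun z => ε⁻¹ * u (ε • z)) z = fderiv ℝ u (ε • z) := by
    rw [show (fun z => ε⁻¹ * u (ε • z)) = ε⁻¹ • fun z => u (ε • z) from rfl,
      fderiv_const_smul_field, Pi.smul_apply, fderiv_comp_smul, inv_smul_smul₀ hε]
  rw [gradient, gradient, h]

lemma LipschitzWith.rescale {u : Ed n → ℝ} {L : ℝ≥0} (hu : LipschitzWith L u) {ε : ℝ}
    (hε : 0 < ε) : LipschitzWith L (fun z => ε⁻¹ * u (ε • z)) := by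
  refine LipschitzWith.of_dist_le_mul fun a b => ?_
  have h1 := hu.dist_le_mul (ε • a) (ε • b)
  rw [dist_smul₀, Real.norm_of_nonneg hε.le] at h1
  rw [Real.dist_eq] at h1 ⊢
  rw [← mul_sub, abs_mul, abs_of_pos (inv_pos.2 hε), inv_mul_le_iff₀ hε]
  linarith

namespace IsHam
variable {H : Ed n → Ed n → Ω → ℝ}

/-- The increments of a local subsolution are bounded by the cost. -/
lemma exists_increment_bound (hH : IsHam τ H) {L : ℝ≥0} {R : ℕ} (hLR : (L : ℝ) < R + 1) {ε : ℝ}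
    (hε : 0 < ε) : ∃ d > 0, ∀ (ω : Ω) (ψ : Ed n → ℝ) (a : Ed n) (r μ : ℝ), LipschitzWith L ψ →
      (∀ᵐ y ∂(volume : Measure (Ed n)), y ∈ ball a r → H (gradient ψ y) y ω ≤ μ) →
      ∀ (y w : Ed n) (t : ℝ), ball y (2 * d) ⊆ ball a r → ‖w‖ ≤ d → 0 < t →
        ψ (y + w) - ψ y ≤ t * (μ + ε) + cost H R w t (τ y ω) := by
  obtain ⟨δ, hδ, hd⟩ := hH.equi (R + 1) (by positivity) ε hε
  refine ⟨δ / 2, by positivity, fun ω ψ a r μ hψ hle y w t hsub hw ht => ?_⟩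
  rw [mul_div_cancel₀ _ two_ne_zero] at hsub
  refine hψ.sub_le_of_ae_inner_gradient_le (a := y) (r := δ) ?_ (mem_ball_self hδ) ?_
  · filter_upwards [hle] with x hx hxy
    have h1 := hx (hsub hxy)
    have hg : ‖gradient ψ x‖ < R + 1 := (hψ.norm_gradient_le x).trans_lt hLR
    have h2 := hd ω _ _ x y hg hg (by simpa using hδ) hxy
    have h3 := hH.le_cost w t (τ y ω) hg
    rw [hH.stat, zero_add] at h3
    have h4 : H (gradient ψ x) y ω ≤ μ + ε := by linarith [(abs_le.1 h2).1]
    have h5 := mul_le_mul_of_nonneg_left h4 ht.le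
    rw [real_inner_comm]
    linarith
  · rw [mem_ball, dist_eq_norm, add_sub_cancel_left]; linarith

lemma ae_exists_slope_of_subsolutions [IsProbabilityMeasure P] (h : IsErgodicAction P τ)
    (hH : IsHam τ H) :
    ∀ᵐ ω ∂P, ∀ (L : ℝ≥0) (μ μ' r c : ℝ) (x y : Ed n) (ε : ℕ → ℝ) (u : ℕ → Ed n → ℝ),
      μ < μ' → (∀ k, 0 < ε k) → Tendsto ε atTop (nhds 0) → (∀ k, LipschitzWith L (u k)) →
      (∀ k, ∀ᵐ z ∂(volume : Measure (Ed n)), z ∈ ball x r →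
        H (gradient (u k) z) ((ε k)⁻¹ • z) ω ≤ μ) →
      dist y x < r / 2 → (∀ k, c ≤ u k x - u k y) →
      ∀ δ > 0, ∃ p : Ed n, (∀ᵐ ω' ∂P, effHR H ω' p ≤ μ') ∧
        c - δ ≤ inner ℝ p (x - y) := by
  filter_upwards [hH.ae_exists_slope h] with
    ω hω L μ μ' r c x y ε u hμ hε hεt hL hle hyx hc δ hδ
  obtain ⟨R, hR⟩ := exists_nat_gt (L : ℝ)
  have hLR : (L : ℝ) < R + 1 := by linarith
  obtain ⟨d, hd, hinc⟩ := hH.exists_increment_bound hLR (sub_pos.2 hμ)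
  rw [dist_eq_norm, norm_sub_rev] at hyx
  set z := x - y with hz
  set ρ := (‖z‖ + r / 2) / 2 with hρ
  set A := |c| + L * ‖z‖ with hA
  have hA0 : 0 ≤ A := by positivity
  have hinvt : Tendsto (fun k => (ε k)⁻¹) atTop atTop :=
    tendsto_inv_nhdsGT_zero.comp (tendsto_nhdsWithin_iff.2 ⟨hεt, Eventually.of_forall hε⟩)
  obtain ⟨N, hN⟩ := eventually_atTop.1 ((hinvt.eventually_ge_atTop (1 + 2 * A / δ)).and
    ((hinvt.eventually_ge_atTop (2 * d / (r - ρ - ‖z‖)))))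
  have hrr : 0 < r - ρ - ‖z‖ := by linarith
  set e : ℕ → ℝ := fun k => ε (k + N) with he
  have he0 : ∀ k, 0 < e k := fun k => hε _
  have hei : ∀ k, 0 < (e k)⁻¹ := fun k => inv_pos.2 (he0 k)
  have he1 : ∀ k, 1 + 2 * A / δ ≤ (e k)⁻¹ := fun k => (hN (k + N) (Nat.le_add_left _ _)).1
  have he2 : ∀ k, 2 * d ≤ (e k)⁻¹ * (r - ρ - ‖z‖) := fun k =>
    (div_le_iff₀ hrr).1 (hN (k + N) (Nat.le_add_left _ _)).2
  have hAδ : 0 ≤ 2 * A / δ := by positivity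
  set K : ℕ → ℕ := fun k => ⌊(e k)⁻¹⌋₊ with hK
  have hKpos : ∀ k, 0 < K k := fun k => Nat.floor_pos.2 (by linarith [he1 k])
  have hK1 : ∀ k, (1 : ℝ) ≤ K k := fun k => by exact_mod_cast hKpos k
  have hKle : ∀ k, (K k : ℝ) ≤ (e k)⁻¹ := fun k => Nat.floor_le (hei k).le
  have hKlt : ∀ k, (e k)⁻¹ < K k + 1 := fun k => Nat.lt_floor_add_one _
  have hKt : Tendsto K atTop atTop :=
    (tendsto_nat_floor_atTop).comp (hinvt.comp (tendsto_add_atTop_nat N))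
  set ϕ : ℕ → Ed n → ℝ := fun k w => (e k)⁻¹ * u (k + N) (e k • w) with hϕ
  have hϕL : ∀ k, LipschitzWith L (ϕ k) := fun k => (hL (k + N)).rescale (he0 k)
  have hsub : ∀ k, ∀ᵐ w ∂(volume : Measure (Ed n)), w ∈ ball ((e k)⁻¹ • x) ((e k)⁻¹ * r) →
      H (gradient (ϕ k) w) w ω ≤ μ := by
    intro k
    filter_upwards [(Measure.quasiMeasurePreserving_smul (μ := (volume : Measure (Ed n)))
      (he0 k).ne').ae (hle (k + N))] with w hw hwx
    have hmem : e k • w ∈ ball x r := by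
      rw [mem_ball, dist_eq_norm] at hwx ⊢
      have e1 : w - (e k)⁻¹ • x = (e k)⁻¹ • (e k • w - x) := by
        rw [smul_sub, inv_smul_smul₀ (he0 k).ne']
      rw [e1, norm_smul, Real.norm_of_nonneg (hei k).le] at hwx
      exact lt_of_mul_lt_mul_left hwx (hei k).le
    have h1 := hw hmem
    rw [show ε (k + N) = e k from rfl, inv_smul_smul₀ (he0 k).ne'] at h1
    rwa [hϕ, gradient_rescale _ (he0 k).ne']
  have hρz : ‖z‖ < ρ := by linarith
  obtain ⟨p, hp, hpc⟩ := hω R L μ' d (2 * ‖y‖) ρ (c - δ / 2) z K (fun k => (e k)⁻¹ • y) ϕ hd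
    (by positivity) hρz hKpos hKt (fun k => by
      rw [norm_smul, Real.norm_of_nonneg (hei k).le]
      have := mul_le_mul_of_nonneg_right
        (show (e k)⁻¹ ≤ 2 * K k by linarith [hKlt k, hK1 k]) (norm_nonneg y)
      linarith) hϕL (fun k w hw t ht q hq => by
      have := hinc ω (ϕ k) _ _ μ (hϕL k) (hsub k) q w t (ball_subset_ball' ?_) hw ht
      · rwa [add_sub_cancel] at this
      · rw [mem_ball] at hq
        have h1 := dist_triangle q ((e k)⁻¹ • y) ((e k)⁻¹ • x)
        rw [dist_smul₀, Real.norm_of_nonneg (hei k).le, dist_comm y x, dist_eq_norm x y] at h1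
        have h2 := mul_le_mul_of_nonneg_left (hKle k) (by linarith [norm_nonneg z] : 0 ≤ ρ)
        have h3 := he2 k
        rw [← hz] at h1
        linarith) (fun k => by
      have hK0 : (0 : ℝ) < K k := by exact_mod_cast hKpos k
      rw [le_div_iff₀ hK0]
      have h1 : c * (e k)⁻¹ ≤ ϕ k ((e k)⁻¹ • x) - ϕ k ((e k)⁻¹ • y) := by
        simp only [hϕ, smul_inv_smul₀ (he0 k).ne']
        have := mul_le_mul_of_nonneg_right (hc (k + N)) (hei k).le
        linarith
      have h2 := (hϕL k).sub_le_norm ((e k)⁻¹ • x) ((e k)⁻¹ • y + (K k : ℝ) • z)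
      have e2 : (e k)⁻¹ • x - ((e k)⁻¹ • y + (K k : ℝ) • z) = ((e k)⁻¹ - K k) • z := by
        rw [hz]; module
      rw [e2, norm_smul, Real.norm_of_nonneg (sub_nonneg.2 (hKle k))] at h2
      have h3 : ((e k)⁻¹ - K k) * ‖z‖ ≤ ‖z‖ :=
        mul_le_of_le_one_left (norm_nonneg z) (by linarith [hKlt k])
      have h4 := mul_le_mul_of_nonneg_left h3 L.2
      simp only [NNReal.val_eq_coe] at h4
      have h5 : -|c| ≤ c * ((e k)⁻¹ - K k) := by
        have := neg_abs_le (c * ((e k)⁻¹ - K k))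
        rw [abs_mul, abs_of_nonneg (sub_nonneg.2 (hKle k))] at this
        have h6 := mul_le_of_le_one_right (abs_nonneg c)
          (show (e k)⁻¹ - K k ≤ 1 by linarith [hKlt k])
        linarith
      have h6 : A ≤ δ / 2 * K k := by
        have : 2 * A / δ ≤ K k := by linarith [he1 k, hKlt k]
        rw [div_le_iff₀ hδ] at this
        linarith
      linarith) (δ / 2) (half_pos hδ)
  exact ⟨p, hp, by linarith⟩

end IsHam
end Rescaled

section Effective
set_option linter.unusedSectionVars false
variable {n : ℕ} {Ω : Type*} [MeasurableSpace Ω] {τ : Ed n → Ω → Ω}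

lemma gradient_inner_add {p : Ed n} {w : Ed n → ℝ} {y : Ed n} (hw : DifferentiableAt ℝ w y) :
    gradient (fun y => inner ℝ p y + w y) y = p + gradient w y := by
  have h1 : HasGradientAt (fun y : Ed n => (inner ℝ p y : ℝ)) p y := by
    rw [hasGradientAt_iff_hasFDerivAt]
    exact (innerSL ℝ p).hasFDerivAt
  refine HasGradientAt.gradient ?_
  rw [hasGradientAt_iff_hasFDerivAt, map_add]
  exact h1.hasFDerivAt.add hw.hasGradientAt.hasFDerivAt

lemma lipschitzWith_inner (p : Ed n) : LipschitzWith ‖p‖₊ (fun y : Ed n => (inner ℝ p y : ℝ)) := by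
  refine LipschitzWith.of_dist_le_mul fun a b => ?_
  rw [Real.dist_eq, ← inner_sub_right, dist_eq_norm]
  exact abs_real_inner_le_norm _ _

/-- Quantitative form of sublinearity. -/
lemma exists_abs_le_of_sublinear {w : Ed n → ℝ} (hc : Continuous w)
    (hw : Tendsto (fun y : Ed n => w y / ‖y‖) (cocompact (Ed n)) (nhds 0)) {η : ℝ} (hη : 0 < η) :
    ∃ C, 0 ≤ C ∧ ∀ y, |w y| ≤ η * ‖y‖ + C := by
  have h1 : ∀ᶠ y in cocompact (Ed n), |w y / ‖y‖| < η := by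
    have := (tendsto_order.1 (tendsto_zero_iff_abs_tendsto_zero _ |>.1 hw)).2 η hη
    simpa using this
  obtain ⟨t, ht, hts⟩ := mem_cocompact.1 h1
  obtain ⟨C, hC⟩ := (ht.insert 0).exists_bound_of_continuousOn hc.continuousOn
  refine ⟨|C|, abs_nonneg C, fun y => ?_⟩
  by_cases hy : y ∈ insert 0 t
  · have := (hC y hy).trans (le_abs_self C)
    rw [Real.norm_eq_abs] at this
    have : 0 ≤ η * ‖y‖ := by positivity
    linarith
  · rw [mem_insert_iff, not_or] at hy
    have h2 : |w y / ‖y‖| < η := hts hy.2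
    have h3 : 0 < ‖y‖ := norm_pos_iff.2 hy.1
    rw [abs_div, abs_norm, div_lt_iff₀ h3] at h2
    linarith [abs_nonneg C]

namespace IsHam
variable {H : Ed n → Ed n → Ω → ℝ}

lemma exists_corrector {ω : Ω} {p : Ed n} {μ : ℝ}
    (hne : (effSetR H ω p).Nonempty) (hlt : effHR H ω p < μ) :
    μ ∈ effSetR H ω p := by
  obtain ⟨ν, ⟨w, hw, hlim, hle⟩, hν⟩ := exists_lt_of_csInf_lt hne hlt
  exact ⟨w, hw, hlim, hle.mono fun y hy => hy.trans hν.le⟩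

lemma effSetR_nonempty (hH : IsHam τ H) (ω : Ω) (p : Ed n) : (effSetR H ω p).Nonempty := by
  obtain ⟨C, hC⟩ := hH.bdd (‖p‖ + 1) (by positivity)
  refine ⟨C, fun _ => 0, ⟨0, LipschitzWith.const 0⟩,
    by simpa using tendsto_const_nhds, Eventually.of_forall fun y => ?_⟩
  have hg : gradient (fun _ : Ed n => (0 : ℝ)) y = 0 := by
    rw [gradient]; simp
  rw [hg, add_zero]
  exact (abs_le.1 (hC ω p y (by linarith))).2

lemma convexOn_effHR (hH : IsHam τ H) (ω : Ω) : ConvexOn ℝ univ (effHR H ω) := by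
  refine ⟨convex_univ, fun p _ q _ a b ha hb hab => ?_⟩
  refine le_of_forall_pos_le_add fun ε hε => ?_
  obtain ⟨w₁, ⟨K₁, hK₁⟩, hlim₁, hle₁⟩ :=
    exists_corrector (hH.effSetR_nonempty ω p) (lt_add_of_pos_right _ hε)
  obtain ⟨w₂, ⟨K₂, hK₂⟩, hlim₂, hle₂⟩ :=
    exists_corrector (hH.effSetR_nonempty ω q) (lt_add_of_pos_right _ hε)
  have hmem : a * (effHR H ω p + ε) + b * (effHR H ω q + ε) ∈ effSetR H ω (a • p + b • q) := by
    have hd₁ := hK₁.ae_differentiableAt (μ := volume)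
    have hd₂ := hK₂.ae_differentiableAt (μ := volume)
    refine ⟨fun y => a * w₁ y + b * w₂ y, ⟨_, ((lipschitzWith_smul a).comp hK₁).add
      ((lipschitzWith_smul b).comp hK₂)⟩, ?_, ?_⟩
    · have := (hlim₁.const_mul a).add (hlim₂.const_mul b)
      simp only [mul_zero, add_zero] at this
      exact this.congr fun y => by ring
    · filter_upwards [hle₁, hle₂, hd₁, hd₂] with y h1 h2 hy1 hy2
      have hg : gradient (fun y => a * w₁ y + b * w₂ y) y =
          a • gradient w₁ y + b • gradient w₂ y := by
        refine HasGradientAt.gradient ?_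
        rw [hasGradientAt_iff_hasFDerivAt, map_add, map_smul, map_smul]
        exact (hy1.hasGradientAt.hasFDerivAt.const_mul a).add
          (hy2.hasGradientAt.hasFDerivAt.const_mul b)
      have hc := (hH.conv y ω).2 (mem_univ (p + gradient w₁ y)) (mem_univ (q + gradient w₂ y))
        ha hb hab
      rw [hg, show a • p + b • q + (a • gradient w₁ y + b • gradient w₂ y) =
        a • (p + gradient w₁ y) + b • (q + gradient w₂ y) by module]
      refine hc.trans ?_
      rw [smul_eq_mul, smul_eq_mul]
      gcongr
  have h1 : effHR H ω (a • p + b • q) ≤ _ := csInf_le (hH.bddBelow_effSetR ω _) hmem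
  rw [smul_eq_mul, smul_eq_mul]
  have h2 : a * ε + b * ε = ε := by rw [← add_mul, hab, one_mul]
  linarith

lemma effHR_ge (hH : IsHam τ H) {ω : Ω} {C R : ℝ} (hR0 : 0 ≤ R)
    (hR : ∀ p y, R ≤ ‖p‖ → C ≤ H p y ω) {p : Ed n} (hp : R < ‖p‖) : C ≤ effHR H ω p := by
  refine le_csInf (hH.effSetR_nonempty ω p) ?_
  rintro μ ⟨w, ⟨K, hK⟩, hlim, hle⟩
  by_contra! hμ
  have hp0 : 0 < ‖p‖ := hR0.trans_lt hp
  have hL : LipschitzWith (‖p‖₊ + K) fun y => inner ℝ p y + w y := (lipschitzWith_inner p).add hK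
  have hgrad : ∀ᵐ y ∂(volume : Measure (Ed n)),
      inner ℝ (gradient (fun y => inner ℝ p y + w y) y) p ≤ R * ‖p‖ := by
    filter_upwards [hle, hK.ae_differentiableAt (μ := volume)] with y hy hd
    rw [gradient_inner_add hd]
    have h1 : ‖p + gradient w y‖ ≤ R := by
      by_contra! h
      linarith [hR _ y h.le]
    exact (real_inner_le_norm _ _).trans (mul_le_mul_of_nonneg_right h1 hp0.le)
  have hinc : ∀ t > 0, inner ℝ p (t • p) + w (t • p) - w 0 ≤ t * (R * ‖p‖) := by
    intro t ht
    have hg : ∀ᵐ y ∂(volume : Measure (Ed n)), y ∈ ball (0 : Ed n) (‖t • p‖ + 1) →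
        inner ℝ (gradient (fun y => inner ℝ p y + w y) y) (t • p) ≤ t * (R * ‖p‖) := by
      filter_upwards [hgrad] with y hy _
      rw [inner_smul_right]
      exact mul_le_mul_of_nonneg_left hy ht.le
    have := hL.sub_le_of_ae_inner_gradient_le (x := 0) hg (mem_ball_self (by positivity))
      (by rw [zero_add, mem_ball_zero_iff]; linarith)
    simpa using this
  obtain ⟨B, hB0, hB⟩ := exists_abs_le_of_sublinear hK.continuous hlim
    (η := (‖p‖ - R) / 2) (by linarith)
  set t := (B + |w 0| + 1) * 2 / ((‖p‖ - R) * ‖p‖) with ht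
  have hpR : 0 < (‖p‖ - R) * ‖p‖ := mul_pos (by linarith) hp0
  have ht0 : 0 < t := by positivity
  have h1 := hinc t ht0
  have h2 := (abs_le.1 (hB (t • p))).1
  rw [norm_smul, Real.norm_of_nonneg ht0.le] at h2
  rw [inner_smul_right, real_inner_self_eq_norm_sq] at h1
  have h3 : t * ((‖p‖ - R) * ‖p‖) = (B + |w 0| + 1) * 2 := by
    rw [ht]; exact div_mul_cancel₀ _ hpR.ne'
  have h4 := le_abs_self (w 0)
  nlinarith

lemma tendsto_effHR (hH : IsHam τ H) (ω : Ω) :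
    Tendsto (effHR H ω) (cocompact (Ed n)) atTop := by
  refine tendsto_atTop.2 fun C => ?_
  obtain ⟨R, hR⟩ := hH.coer ω C
  filter_upwards [tendsto_norm_cocompact_atTop.eventually_gt_atTop (max R 0)] with p hp
  exact hH.effHR_ge (le_max_right R 0) (fun q y hq => hR q y ((le_max_left R 0).trans hq)) hp

end IsHam
end Effective

section Competitor
set_option linter.unusedSectionVars false
variable {n : ℕ} {Ω : Type*} [MeasurableSpace Ω] {τ : Ed n → Ω → Ω}

/-- Finitely many momenta slightly outside a sublevel set dominate its support function. -/
lemma exists_finset_support {Hbar : Ed n → ℝ} (hc : Continuous Hbar)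
    (hcoer : Tendsto Hbar (cocompact (Ed n)) atTop) {μ μ' : ℝ} (hμ : μ < μ')
    (hne : ∃ q, Hbar q ≤ μ) :
    ∃ F : Finset (Ed n), F.Nonempty ∧ (∀ f ∈ F, Hbar f < μ') ∧ ∃ c > 0, ∀ q, Hbar q ≤ μ →
      ∀ w, ∃ f ∈ F, inner ℝ q w + c * ‖w‖ ≤ inner ℝ f w := by
  have hK : IsCompact {q | Hbar q ≤ μ} := by
    obtain ⟨t, ht, hts⟩ := mem_cocompact.1 (hcoer.eventually_gt_atTop μ)
    refine ht.of_isClosed_subset (isClosed_le hc continuous_const) fun q hq => ?_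
    by_contra hqt
    have h1 : μ < Hbar q := hts hqt
    exact absurd hq (not_le.2 h1)
  obtain ⟨δ, hδ, hδs⟩ := hK.exists_cthickening_subset_open
    (isOpen_lt hc continuous_const : IsOpen {q | Hbar q < μ'}) (fun q hq => lt_of_le_of_lt hq hμ)
  obtain ⟨t, hts, htf, htc⟩ := (hK.cthickening (r := δ)).finite_cover_balls (half_pos hδ)
  have hex : ∀ q, Hbar q ≤ μ → ∀ w, ∃ f ∈ t, inner ℝ q w + δ / 2 * ‖w‖ ≤ inner ℝ f w := by
    intro q hq w
    have hmem : q + (δ / ‖w‖) • w ∈ cthickening δ {q | Hbar q ≤ μ} := by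
      refine mem_cthickening_of_dist_le _ q _ _ hq ?_
      rw [dist_eq_norm, add_sub_cancel_left, norm_smul, Real.norm_of_nonneg (by positivity)]
      rcases eq_or_ne w 0 with rfl | hw
      · simpa using hδ.le
      · rw [div_mul_cancel₀ _ (norm_ne_zero_iff.2 hw)]
    obtain ⟨f, hf, hfd⟩ := mem_iUnion₂.1 (htc hmem)
    refine ⟨f, hf, ?_⟩
    rw [mem_ball, dist_eq_norm] at hfd
    have h1 := real_inner_le_norm (q + (δ / ‖w‖) • w - f) w
    have h2 := mul_le_mul_of_nonneg_right hfd.le (norm_nonneg w)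
    rw [inner_sub_left, inner_add_left, real_inner_smul_left, real_inner_self_eq_norm_sq] at h1
    have h3 : δ / ‖w‖ * ‖w‖ ^ 2 = δ * ‖w‖ := by
      rcases eq_or_ne w 0 with rfl | hw
      · simp
      · have := norm_ne_zero_iff.2 hw
        field_simp
    linarith
  refine ⟨htf.toFinset, ?_, fun f hf => hδs (hts (htf.mem_toFinset.1 hf)), δ / 2, half_pos hδ,
    fun q hq w => ?_⟩
  · obtain ⟨q, hq⟩ := hne
    obtain ⟨f, hf, -⟩ := hex q hq 0
    exact ⟨f, htf.mem_toFinset.2 hf⟩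
  · obtain ⟨f, hf, h⟩ := hex q hq w
    exact ⟨f, htf.mem_toFinset.2 hf, h⟩

lemma LipschitzOnWith.ae_differentiableAt_of_isOpen {g : Ed n → ℝ} {W : Set (Ed n)} (hW : IsOpen W)
    {K : ℝ≥0} (hg : LipschitzOnWith K g W) :
    ∀ᵐ x ∂(volume : Measure (Ed n)), x ∈ W → DifferentiableAt ℝ g x := by
  filter_upwards [hg.ae_differentiableWithinAt_of_mem (μ := volume)] with x hx hxW
  exact (hx hxW).differentiableAt (hW.mem_nhds hxW)

namespace IsHam
variable {H : Ed n → Ed n → Ω → ℝ}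

/-- A function whose increments are locally bounded by those of one of finitely many
subsolutions is a subsolution. -/
lemma le_of_exists_increment_le (hH : IsHam τ H) {ω : Ω} {ι : Type*} {F : Finset ι} {g : Ed n → ℝ}
    {φ : ι → Ed n → ℝ} {x y : Ed n} {μ : ℝ} (hg : DifferentiableAt ℝ g x)
    (hφ : ∀ f ∈ F, DifferentiableAt ℝ (φ f) x)
    (hinc : ∀ᶠ z in nhds x, ∃ f ∈ F, g z - g x ≤ φ f z - φ f x)
    (hle : ∀ f ∈ F, H (gradient (φ f) x) y ω ≤ μ) : H (gradient g x) y ω ≤ μ := by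
  refine le_of_forall_lt_imp_le_of_dense fun a ha => ?_
  obtain ⟨ζ, hζ⟩ := ConvexOn.exists_inner_le_of_lt (hH.conv y ω) ha
  obtain ⟨f, hf, hfζ⟩ : ∃ f ∈ F, inner ℝ (gradient g x) ζ ≤ inner ℝ (gradient (φ f) x) ζ := by
    by_contra! hcon
    have h1 : ∀ᶠ m : ℕ in atTop, ∀ f ∈ F,
        ((m : ℝ) + 1) * (φ f (x + (1 / ((m : ℝ) + 1)) • ζ) - φ f x) <
          ((m : ℝ) + 1) * (g (x + (1 / ((m : ℝ) + 1)) • ζ) - g x) := by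
      rw [eventually_all_finset]
      intro f hf
      exact (tendsto_slope_seq (hφ f hf) ζ).eventually_lt (tendsto_slope_seq hg ζ) (hcon f hf)
    obtain ⟨m, hm1, f, hf, hm2⟩ := (h1.and ((tendsto_add_one_div_smul x ζ).eventually hinc)).exists
    have := lt_of_mul_lt_mul_left (hm1 f hf) (by positivity)
    linarith
  have h2 := hζ (gradient (φ f) x)
  rw [inner_sub_right, real_inner_comm, real_inner_comm (gradient g x)] at h2
  linarith [hle f hf]

lemma exists_rescaled_correctors (hH : IsHam τ H) {ω : Ω} (F : Finset (Ed n)) {μ A η : ℝ}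
    (hF : ∀ f ∈ F, effHR H ω f < μ) (hA : 0 ≤ A) (hη : 0 < η) :
    ∃ L : ℝ≥0, ∃ ε₀ > 0, ∀ ε : ℝ, 0 < ε → ε < ε₀ → ∃ φ : Ed n → Ed n → ℝ, ∀ f ∈ F,
      LipschitzWith L (φ f) ∧ (∀ x, ‖x‖ ≤ A → |φ f x - inner ℝ f x| ≤ η) ∧
      ∀ᵐ x ∂(volume : Measure (Ed n)), H (gradient (φ f) x) (ε⁻¹ • x) ω ≤ μ := by
  have hex : ∀ f : Ed n, ∃ (w : Ed n → ℝ) (K : ℝ≥0) (C : ℝ), f ∈ F → LipschitzWith K w ∧ 0 ≤ C ∧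
      (∀ y, |w y| ≤ η / (2 * (A + 1)) * ‖y‖ + C) ∧
      ∀ᵐ y ∂(volume : Measure (Ed n)), H (f + gradient w y) y ω ≤ μ := by
    intro f
    by_cases hf : f ∈ F
    · obtain ⟨w, ⟨K, hK⟩, hlim, hle⟩ := exists_corrector (hH.effSetR_nonempty ω f) (hF f hf)
      obtain ⟨C, hC0, hC⟩ := exists_abs_le_of_sublinear hK.continuous hlim
        (η := η / (2 * (A + 1))) (by positivity)
      exact ⟨w, K, C, fun _ => ⟨hK, hC0, hC, hle⟩⟩
    · exact ⟨0, 0, 0, fun h => absurd h hf⟩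
  choose w K C hw using hex
  have hCsum : 0 ≤ ∑ f ∈ F, C f := Finset.sum_nonneg fun f hf => (hw f hf).2.1
  refine ⟨F.sup fun f => ‖f‖₊ + K f, η / (2 * (∑ f ∈ F, C f + 1)), by positivity,
    fun ε hε hεε => ⟨fun f x => (ε⁻¹)⁻¹ * (inner ℝ f (ε⁻¹ • x) + w f (ε⁻¹ • x)), fun f hf => ?_⟩⟩
  obtain ⟨hK, hC0, hC, hle⟩ := hw f hf
  have hL : LipschitzWith (‖f‖₊ + K f) fun y => inner ℝ f y + w f y :=
    (lipschitzWith_inner f).add hK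
  refine ⟨(hL.rescale (inv_pos.2 hε)).weaken (Finset.le_sup (f := fun f => ‖f‖₊ + K f) hf),
    fun x hx => ?_, ?_⟩
  · have e1 : (ε⁻¹)⁻¹ * (inner ℝ f (ε⁻¹ • x) + w f (ε⁻¹ • x)) - inner ℝ f x =
        ε * w f (ε⁻¹ • x) := by
      rw [inner_smul_right, inv_inv, mul_add, mul_inv_cancel_left₀ hε.ne']; ring
    rw [e1, abs_mul, abs_of_pos hε]
    have h1 := mul_le_mul_of_nonneg_left (hC (ε⁻¹ • x)) hε.le
    rw [norm_smul, Real.norm_of_nonneg (inv_pos.2 hε).le] at h1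
    have e2 : ε * (η / (2 * (A + 1)) * (ε⁻¹ * ‖x‖) + C f) =
        η / (2 * (A + 1)) * ‖x‖ + ε * C f := by
      field_simp
    rw [e2] at h1
    have h2 : η / (2 * (A + 1)) * ‖x‖ ≤ η / 2 := by
      rw [div_mul_eq_mul_div, div_le_div_iff₀ (by positivity) two_pos]
      nlinarith
    have h3 : C f ≤ ∑ f ∈ F, C f :=
      Finset.single_le_sum (f := C) (fun f hf => (hw f hf).2.1) hf
    rw [lt_div_iff₀ (by positivity)] at hεε
    have h4 := mul_le_mul_of_nonneg_left h3 hε.le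
    linarith
  · filter_upwards [(Measure.quasiMeasurePreserving_smul (μ := (volume : Measure (Ed n)))
      (inv_pos.2 hε).ne').ae (hle.and (hK.ae_differentiableAt (μ := volume)))] with x ⟨h1, h2⟩
    rw [gradient_rescale (fun y => inner ℝ f y + w f y) (inv_pos.2 hε).ne',
      gradient_inner_add h2]
    exact h1

/-- A strict subsolution of the effective equation can be approximated by subsolutions of the
oscillating equation. -/
lemma exists_competitor (hH : IsHam τ H) {Hbar : Ed n → ℝ} {ω : Ω}
    (hω : ∀ p, effHR H ω p = Hbar p) {V W : Set (Ed n)} {v : Ed n → ℝ} {K : ℝ≥0}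
    (hv : LipschitzWith K v) {μ μ' r A η : ℝ} (hμ : μ < μ') (hr : 0 < r) (hη : 0 < η)
    (hle : ∀ᵐ x ∂(volume : Measure (Ed n)), x ∈ V → Hbar (gradient v x) ≤ μ) (hW : IsOpen W)
    (hWV : ∀ x ∈ W, ball x (2 * r) ⊆ V) (hVA : ∀ x ∈ V, ‖x‖ ≤ A) :
    ∃ ε₀ > 0, ∀ ε : ℝ, 0 < ε → ε < ε₀ → ∃ v' : Ed n → ℝ, (∀ x ∈ W, |v' x - v x| ≤ η) ∧
      (∃ K' : ℝ≥0, LipschitzOnWith K' v' W) ∧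
      ∀ᵐ x ∂(volume : Measure (Ed n)), x ∈ W → H (gradient v' x) (ε⁻¹ • x) ω ≤ μ' := by
  have hHb : Hbar = effHR H ω := funext fun p => (hω p).symm
  rcases W.eq_empty_or_nonempty with rfl | ⟨x₀, hx₀⟩
  · exact ⟨1, one_pos, fun ε _ _ => ⟨v, by simp, ⟨0, by simp⟩, by simp⟩⟩
  have hx₀V : ∀ x ∈ W, x ∈ V := fun x hx => hWV x hx (mem_ball_self (by positivity))
  have hA : 0 ≤ A := (norm_nonneg x₀).trans (hVA x₀ (hx₀V x₀ hx₀))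
  obtain ⟨F, hF, hFμ, c, hc, hFc⟩ := exists_finset_support (Hbar := Hbar)
    (by rw [hHb]; exact (hH.convexOn_effHR ω).continuous_univ)
    (by rw [hHb]; exact hH.tendsto_effHR ω) hμ (by
      by_contra! hcon
      have h1 : volume V = 0 := by
        refine measure_mono_null (fun x hx => ?_) (ae_iff.1 hle)
        simpa [hx] using hcon (gradient v x)
      exact (measure_ball_pos volume x₀ (by positivity : 0 < 2 * r)).ne'
        (measure_mono_null (hWV x₀ hx₀) h1))
  set η₁ := min (η / 2) (c * r / 4) with hη₁
  have hη₁0 : 0 < η₁ := lt_min (by positivity) (by positivity)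
  have hη₁η : η₁ ≤ η / 2 := min_le_left _ _
  have hη₁c : η₁ ≤ c * r / 4 := min_le_right _ _
  obtain ⟨L, ε₀, hε₀, hcor⟩ := hH.exists_rescaled_correctors (ω := ω) F (μ := μ')
    (fun f hf => by rw [hω]; exact hFμ f hf) hA hη₁0
  refine ⟨ε₀, hε₀, fun ε hε hεε => ?_⟩
  obtain ⟨φ, hφ⟩ := hcor ε hε hεε
  set m : Ed n → Ed n → ℝ := fun x z => F.sup' hF fun f => φ f x - φ f z with hm
  have hmle : ∀ x z f, f ∈ F → φ f x - φ f z ≤ m x z := fun x z f hf =>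
    Finset.le_sup' (fun f => φ f x - φ f z) hf
  have hmex : ∀ x z, ∃ f ∈ F, m x z = φ f x - φ f z := fun x z =>
    Finset.exists_mem_eq_sup' hF fun f => φ f x - φ f z
  have hGc : ∀ x, Continuous fun z => v z + m x z := by
    intro x
    refine hv.continuous.add ?_
    exact Continuous.finset_sup'_apply hF fun f hf => continuous_const.sub (hφ f hf).1.continuous
  have hmin : ∀ x, ∃ z ∈ closedBall x r, ∀ z' ∈ closedBall x r, v z + m x z ≤ v z' + m x z' := by
    intro x
    obtain ⟨z, hz, hzm⟩ := (isCompact_closedBall x r).exists_isMinOn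
      ⟨x, mem_closedBall_self hr.le⟩ (hGc x).continuousOn
    exact ⟨z, hz, fun z' hz' => hzm hz'⟩
  choose zm hzm hzmin using hmin
  set v' : Ed n → ℝ := fun x => v (zm x) + m x (zm x) with hv'
  have hupper : ∀ x, v' x ≤ v x := by
    intro x
    refine (hzmin x x (mem_closedBall_self hr.le)).trans ?_
    obtain ⟨f, -, hf⟩ := hmex x x
    rw [hf, sub_self, add_zero]
  have hlower : ∀ x ∈ W, ∀ z ∈ closedBall x r, v x + c * ‖x - z‖ - 2 * η₁ ≤ v z + m x z := by
    intro x hx z hz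
    have hzV : z ∈ ball x (2 * r) := closedBall_subset_ball (by linarith) hz
    have hxA := hVA x (hx₀V x hx)
    have hzA := hVA z (hWV x hx hzV)
    have h1 : v (z + (x - z)) - v z ≤ m x z + 2 * η₁ - c * ‖x - z‖ := by
      refine hv.sub_le_of_ae_inner_gradient_le (a := x) (r := 2 * r) ?_ hzV
        (by rw [add_sub_cancel]; exact mem_ball_self (by positivity))
      filter_upwards [hle] with y hy hyx
      obtain ⟨f, hf, hfy⟩ := hFc _ (hy (hWV x hx hyx)) (x - z)
      have h2 := abs_le.1 ((hφ f hf).2.1 x hxA)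
      have h3 := abs_le.1 ((hφ f hf).2.1 z hzA)
      have h4 := hmle x z f hf
      rw [inner_sub_right f] at hfy
      linarith [h2.1, h3.2]
    rw [add_sub_cancel] at h1
    linarith
  have hzclose : ∀ x ∈ W, ‖x - zm x‖ ≤ r / 2 := by
    intro x hx
    have h1 := hlower x hx _ (hzm x)
    have h2 := hupper x
    simp only [hv'] at h2
    have h3 : c * ‖x - zm x‖ ≤ c * (r / 2) := by linarith
    exact le_of_mul_le_mul_left h3 hc
  have hclose : ∀ x ∈ W, v x - 2 * η₁ ≤ v' x := by
    intro x hx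
    have h1 := hlower x hx _ (hzm x)
    have : 0 ≤ c * ‖x - zm x‖ := by positivity
    simp only [hv']
    linarith
  have hinc : ∀ x ∈ W, ∀ y, dist y x ≤ r / 2 → ∃ f ∈ F, v' y - v' x ≤ φ f y - φ f x := by
    intro x hx y hy
    have hmem : zm x ∈ closedBall y r := by
      rw [mem_closedBall, dist_comm]
      have h1 := dist_triangle y x (zm x)
      have h2 := hzclose x hx
      rw [← dist_eq_norm] at h2
      linarith
    have h1 := hzmin y _ hmem
    obtain ⟨f, hf, h2⟩ := hmex y (zm x)
    have h3 := hmle x (zm x) f hf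
    refine ⟨f, hf, ?_⟩
    simp only [hv']
    linarith
  have hLip : LipschitzOnWith (L + K + Real.toNNReal (4 * η₁ / r)) v' W := by
    refine LipschitzOnWith.of_le_add_mul _ fun y hy x hx => ?_
    rw [NNReal.coe_add, NNReal.coe_add, Real.coe_toNNReal _ (by positivity)]
    have hd := dist_nonneg (x := y) (y := x)
    have hLd : 0 ≤ L * dist y x := by positivity
    have hKd : 0 ≤ K * dist y x := by positivity
    have hηd : 0 ≤ 4 * η₁ / r * dist y x := by positivity
    rcases le_or_gt (dist y x) (r / 2) with h | h
    · obtain ⟨f, hf, h1⟩ := hinc x hx y h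
      have h2 := (hφ f hf).1.sub_le_norm y x
      rw [← dist_eq_norm] at h2
      linarith
    · have h1 := hv.sub_le_norm y x
      rw [← dist_eq_norm] at h1
      have h2 := hclose x hx
      have h3 := hupper y
      have h4 : 2 * η₁ ≤ 4 * η₁ / r * dist y x := by
        rw [div_mul_eq_mul_div, le_div_iff₀ hr]
        nlinarith
      linarith
  refine ⟨v', fun x hx => ?_, ⟨_, hLip⟩, ?_⟩
  · rw [abs_le]; constructor <;> linarith [hclose x hx, hupper x]
  · have hall : ∀ᵐ x ∂(volume : Measure (Ed n)), ∀ f ∈ F, DifferentiableAt ℝ (φ f) x ∧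
        H (gradient (φ f) x) (ε⁻¹ • x) ω ≤ μ' := by
      rw [eventually_all_finset]
      intro f hf
      exact ((hφ f hf).1.ae_differentiableAt (μ := volume)).and (hφ f hf).2.2
    filter_upwards [hall, hLip.ae_differentiableAt_of_isOpen hW] with x h1 h2 hx
    refine hH.le_of_exists_increment_le (h2 hx) (fun f hf => (h1 f hf).1) ?_
      (fun f hf => (h1 f hf).2)
    filter_upwards [closedBall_mem_nhds x (half_pos hr)] with y hy
    exact hinc x hx y hy

end IsHam
end Competitor

section Limsup

lemma eventually_lt_limsup_add {g : ℝ → ℝ} {C : ℝ} (hg : ∀ ε > 0, |g ε| ≤ C) {η : ℝ} (hη : 0 < η) :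
    ∀ᶠ ε in nhdsWithin 0 (Ioi 0), g ε < limsup g (nhdsWithin 0 (Ioi 0)) + η := by
  refine eventually_lt_of_limsup_lt (lt_add_of_pos_right _ hη) ?_
  exact isBoundedUnder_of_eventually_le (a := C)
    (eventually_nhdsWithin_of_forall fun ε hε => (abs_le.1 (hg ε hε)).2)

lemma frequently_limsup_sub_lt {g : ℝ → ℝ} {C : ℝ} (hg : ∀ ε > 0, |g ε| ≤ C) {η : ℝ} (hη : 0 < η) :
    ∃ᶠ ε in nhdsWithin 0 (Ioi 0), limsup g (nhdsWithin 0 (Ioi 0)) - η < g ε := by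
  refine frequently_lt_of_lt_limsup ?_ (sub_lt_self _ hη)
  have h : IsBoundedUnder (· ≥ ·) (nhdsWithin 0 (Ioi 0)) g := isBoundedUnder_of_eventually_ge
    (a := -C) (eventually_nhdsWithin_of_forall fun ε hε => (abs_le.1 (hg ε hε)).1)
  exact h.isCoboundedUnder_le

lemma limsup_le_limsup_add {g g' : ℝ → ℝ} {C C' d : ℝ} (hg : ∀ ε > 0, |g ε| ≤ C)
    (hg' : ∀ ε > 0, |g' ε| ≤ C') (h : ∀ ε > 0, g ε ≤ g' ε + d) :
    limsup g (nhdsWithin 0 (Ioi 0)) ≤ limsup g' (nhdsWithin 0 (Ioi 0)) + d := by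
  refine le_of_forall_pos_le_add fun η hη => ?_
  obtain ⟨ε, h1, h2, hε⟩ := ((frequently_limsup_sub_lt hg (half_pos hη)).and_eventually
    ((eventually_lt_limsup_add hg' (half_pos hη)).and self_mem_nhdsWithin)).exists
  linarith [h ε hε]

variable {n : ℕ}

/-- A family of functions that is locally uniformly bounded and locally uniformly Lipschitz. -/
def LocUnif (U : Set (Ed n)) (u : ℝ → Ed n → ℝ) : Prop :=
  ∀ x ∈ U, ∃ L : ℝ≥0, ∃ C : ℝ, ∃ r > 0, ball x r ⊆ U ∧ ∀ ε > (0 : ℝ),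
    LipschitzOnWith L (u ε) (ball x r) ∧ ∀ y ∈ ball x r, |u ε y| ≤ C

/-- The upper limit of a family as the parameter tends to zero. -/
def upperLim (u : ℝ → Ed n → ℝ) (x : Ed n) : ℝ :=
  limsup (fun ε => u ε x) (nhdsWithin 0 (Ioi 0))

lemma locUnif_of_nhdsWithin {U : Set (Ed n)} (hU : IsOpen U) {u : ℝ → Ed n → ℝ}
    (h : ∀ x ∈ U, ∃ L : ℝ≥0, ∃ C : ℝ, ∃ t ∈ nhdsWithin x U, ∀ ε > (0 : ℝ),
      LipschitzOnWith L (u ε) t ∧ ∀ y ∈ t, |u ε y| ≤ C) : LocUnif U u := by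
  intro x hx
  obtain ⟨L, C, t, ht, h1⟩ := h x hx
  rw [hU.nhdsWithin_eq hx] at ht
  obtain ⟨r, hr, hrt⟩ := Metric.mem_nhds_iff.1 (Filter.inter_mem ht (hU.mem_nhds hx))
  exact ⟨L, C, r, hr, fun y hy => (hrt hy).2, fun ε hε =>
    ⟨(h1 ε hε).1.mono fun y hy => (hrt hy).1, fun y hy => (h1 ε hε).2 y (hrt hy).1⟩⟩

namespace LocUnif
variable {U : Set (Ed n)} {u : ℝ → Ed n → ℝ}

lemma exists_bound (h : LocUnif U u) {x : Ed n} (hx : x ∈ U) : ∃ C, ∀ ε > 0, |u ε x| ≤ C := by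
  obtain ⟨L, C, r, hr, -, h1⟩ := h x hx
  exact ⟨C, fun ε hε => (h1 ε hε).2 x (mem_ball_self hr)⟩

lemma exists_lipschitz (h : LocUnif U u) {x : Ed n} (hx : x ∈ U) :
    ∃ L : ℝ≥0, ∃ r > 0, ball x r ⊆ U ∧ (∀ ε > 0, LipschitzOnWith L (u ε) (ball x r)) ∧
      LipschitzOnWith L (upperLim u) (ball x r) := by
  obtain ⟨L, C, r, hr, hrU, h1⟩ := h x hx
  refine ⟨L, r, hr, hrU, fun ε hε => (h1 ε hε).1, LipschitzOnWith.of_le_add_mul L fun y hy z hz =>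
    limsup_le_limsup_add (fun ε hε => (h1 ε hε).2 y hy) (fun ε hε => (h1 ε hε).2 z hz)
      fun ε hε => ?_⟩
  have := (h1 ε hε).1.dist_le_mul y hy z hz
  rw [Real.dist_eq] at this
  linarith [le_abs_self (u ε y - u ε z)]

lemma continuousOn (h : LocUnif U u) {ε : ℝ} (hε : 0 < ε) : ContinuousOn (u ε) U := by
  intro x hx
  obtain ⟨L, r, hr, -, h1, -⟩ := h.exists_lipschitz hx
  exact ((h1 ε hε).continuousOn.continuousAt (ball_mem_nhds x hr)).continuousWithinAt

lemma continuousOn_upperLim (h : LocUnif U u) : ContinuousOn (upperLim u) U := by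
  intro x hx
  obtain ⟨L, r, hr, -, -, h1⟩ := h.exists_lipschitz hx
  exact (h1.continuousOn.continuousAt (ball_mem_nhds x hr)).continuousWithinAt

lemma ae_differentiableAt_upperLim (h : LocUnif U u) {V : Set (Ed n)} (hV : IsOpen V)
    (hVc : IsCompact (closure V)) (hVU : closure V ⊆ U) :
    ∀ᵐ x ∂(volume : Measure (Ed n)), x ∈ V → DifferentiableAt ℝ (upperLim u) x := by
  have hloc : LocallyLipschitzOn (closure V) (upperLim u) := by
    intro x hx
    obtain ⟨L, r, hr, -, -, h1⟩ := h.exists_lipschitz (hVU hx)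
    exact ⟨L, ball x r, mem_nhdsWithin_of_mem_nhds (ball_mem_nhds x hr), h1⟩
  obtain ⟨K, hK⟩ := hloc.exists_lipschitzOnWith_of_compact hVc
  exact (hK.mono subset_closure).ae_differentiableAt_of_isOpen hV

/-- The family is eventually below its upper limit, uniformly on compact sets. -/
lemma eventually_le_upperLim_add (h : LocUnif U u) {S : Set (Ed n)} (hS : IsCompact S)
    (hSU : S ⊆ U) {η : ℝ} (hη : 0 < η) :
    ∀ᶠ ε in nhdsWithin 0 (Ioi 0), ∀ x ∈ S, u ε x ≤ upperLim u x + η := by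
  rw [eventually_nhdsWithin_iff]
  have key := hS.eventually_forall_of_forall_eventually (x₀ := (0 : ℝ))
    (P := fun ε x => ε ∈ Ioi (0 : ℝ) → u ε x ≤ upperLim u x + η) fun x hx => by
    obtain ⟨L, r, hr, -, h1, h2⟩ := h.exists_lipschitz (hSU hx)
    obtain ⟨C, hC⟩ := h.exists_bound (hSU hx)
    have e1 := eventually_nhdsWithin_iff.1 (eventually_lt_limsup_add hC (half_pos hη))
    have hd : 0 < min r (η / (4 * (L + 1))) := lt_min hr (by positivity)
    rw [nhds_prod_eq]
    filter_upwards [e1.prod_mk (ball_mem_nhds x hd)] with z hz hz0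
    have hz1 : u z.1 x < upperLim u x + η / 2 := hz.1 hz0
    have hz2 : dist z.2 x < min r (η / (4 * (L + 1))) := hz.2
    have hzr : z.2 ∈ ball x r := lt_of_lt_of_le hz2 (min_le_left _ _)
    have hL : L * dist z.2 x ≤ η / 4 := by
      have h3 := (lt_div_iff₀ (by positivity)).1 (lt_of_lt_of_le hz2 (min_le_right _ _))
      have h4 : (0:ℝ) ≤ dist z.2 x := dist_nonneg
      linarith
    have h3 := (h1 z.1 hz0).dist_le_mul z.2 hzr x (mem_ball_self hr)
    have h4 := h2.dist_le_mul z.2 hzr x (mem_ball_self hr)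
    rw [Real.dist_eq] at h3 h4
    linarith [le_abs_self (u z.1 z.2 - u z.1 x), neg_abs_le (upperLim u z.2 - upperLim u x)]
  filter_upwards [key] with ε hε hε0 x hx using hε x hx hε0

end LocUnif
end Limsup

section Homogenize
set_option linter.unusedSectionVars false
variable {n : ℕ} {Ω : Type*} [MeasurableSpace Ω] {τ : Ed n → Ω → Ω}

lemma AbsSubmin.ae_le {G : Ed n → Ed n → ℝ} {U V : Set (Ed n)} {u v : Ed n → ℝ}
    (h : AbsSubmin G U u) (hV : IsOpen V) (hVc : IsCompact (closure V)) (hVU : closure V ⊆ U)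
    {K : ℝ≥0} (hv : LipschitzOnWith K v (closure V)) (hle : ∀ x ∈ V, v x ≤ u x)
    (heq : ∀ x ∈ frontier V, v x = u x) {μ : ℝ}
    (hμ : ∀ᵐ x ∂(volume : Measure (Ed n)), x ∈ V → G (gradient v x) x ≤ μ) :
    ∀ᵐ x ∂(volume : Measure (Ed n)), x ∈ V → G (gradient u x) x ≤ μ := by
  rw [← ae_restrict_iff' hV.measurableSet] at hμ ⊢
  have h1 := (h.2 V hV hVc hVU v ⟨K, hv⟩ hle heq).trans
    (essSup_le_of_ae_le (μ : EReal) (hμ.mono fun x hx => EReal.coe_le_coe_iff.2 hx))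
  filter_upwards [ae_le_essSup (μ := volume.restrict V)
    (f := fun x => ((G (gradient u x) x : ℝ) : EReal))] with x hx
  exact EReal.coe_le_coe_iff.1 (hx.trans h1)

/-- Rescaled subsolutions for `H` only decrease along directions seen by the sublevel sets of
`Hbar`. -/
def HasSlopes (H : Ed n → Ed n → Ω → ℝ) (Hbar : Ed n → ℝ) (ω : Ω) : Prop :=
  ∀ (L : ℝ≥0) (μ μ' r c : ℝ) (x y : Ed n) (ε : ℕ → ℝ) (u : ℕ → Ed n → ℝ),
    μ < μ' → (∀ k, 0 < ε k) → Tendsto ε atTop (nhds 0) → (∀ k, LipschitzWith L (u k)) →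
    (∀ k, ∀ᵐ z ∂(volume : Measure (Ed n)), z ∈ ball x r →
      H (gradient (u k) z) ((ε k)⁻¹ • z) ω ≤ μ) →
    dist y x < r / 2 → (∀ k, c ≤ u k x - u k y) →
    ∀ δ > 0, ∃ p : Ed n, Hbar p ≤ μ' ∧ c - δ ≤ inner ℝ p (x - y)

/-- Frequent subsolutions bound the decrease of the upper limit. -/
lemma HasSlopes.exists_upperLim {H : Ed n → Ed n → Ω → ℝ} {Hbar : Ed n → ℝ} {ω : Ω}
    (hs : HasSlopes H Hbar ω) {U : Set (Ed n)} {u : ℝ → Ed n → ℝ} (hu : LocUnif U u)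
    {L : ℝ≥0} {x y : Ed n} {ρ μ μ' δ d : ℝ} (hρ : 0 < ρ) (hρU : ball x ρ ⊆ U) (hμ : μ < μ')
    (hδ : 0 < δ) (hL : ∀ ε > 0, LipschitzOnWith L (u ε) (ball x ρ)) (hd : 0 < d)
    (hev : ∀ᶠ ε in nhdsWithin 0 (Ioi 0), upperLim u x - d < u ε x →
      ∀ᵐ z ∂(volume : Measure (Ed n)), z ∈ ball x ρ → H (gradient (u ε) z) (ε⁻¹ • z) ω ≤ μ)
    (hy : dist y x < ρ / 2) :
    ∃ p, Hbar p ≤ μ' ∧ upperLim u x - upperLim u y - δ ≤ inner ℝ p (x - y) := by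
  have hx : x ∈ U := hρU (mem_ball_self hρ)
  have hyb : y ∈ ball x ρ := lt_of_lt_of_le hy (by linarith)
  obtain ⟨C, hC⟩ := hu.exists_bound hx
  obtain ⟨C', hC'⟩ := hu.exists_bound (hρU hyb)
  have hδ3 : 0 < δ / 3 := by positivity
  have hfr := (frequently_limsup_sub_lt hC (lt_min hδ3 hd)).and_eventually
    ((eventually_lt_limsup_add hC' hδ3).and (hev.and self_mem_nhdsWithin))
  obtain ⟨e, het, he⟩ := exists_seq_forall_of_frequently hfr
  have he0 : ∀ k, 0 < e k := fun k => (he k).2.2.2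
  choose w hwL hwe using fun k => (hL (e k) (he0 k)).extend_real
  obtain ⟨p, hp, hpc⟩ := hs L μ μ' ρ (upperLim u x - upperLim u y - 2 * (δ / 3)) x y e w hμ he0
    (tendsto_nhds_of_tendsto_nhdsWithin het) hwL (fun k => by
      have h1 : upperLim u x - d < u (e k) x := by
        have h2 := (he k).1
        have h3 := min_le_right (δ / 3) d
        unfold upperLim
        linarith
      filter_upwards [(he k).2.2.1 h1] with z hz hzb
      have : w k =ᶠ[nhds z] u (e k) := by
        filter_upwards [isOpen_ball.mem_nhds hzb] with q hq using (hwe k hq).symm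
      have h4 : gradient (w k) z = gradient (u (e k)) z := this.gradient_eq
      rw [h4]
      exact hz hzb) hy (fun k => by
      rw [← hwe k (mem_ball_self hρ), ← hwe k hyb]
      have h2 := (he k).1
      have h3 := min_le_left (δ / 3) d
      have h4 := (he k).2.1
      unfold upperLim
      linarith) (δ / 3) hδ3
  exact ⟨p, hp, by linarith⟩

/-- One sided slope bounds at a point of differentiability control the gradient. -/
lemma le_of_slope_bounds {Hbar : Ed n → ℝ} (hconv : ConvexOn ℝ univ Hbar) {f : Ed n → ℝ}
    {x : Ed n} (hf : DifferentiableAt ℝ f x) {ρ μ : ℝ} (hρ : 0 < ρ)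
    (h : ∀ y, dist y x < ρ → ∀ δ > 0, ∃ p, Hbar p ≤ μ ∧ f x - f y - δ ≤ inner ℝ p (x - y)) :
    Hbar (gradient f x) ≤ μ := by
  refine le_of_forall_lt_imp_le_of_dense fun a ha => ?_
  obtain ⟨ζ, hζ⟩ := hconv.exists_inner_le_of_lt ha
  have hlim := tendsto_slope_seq hf (-ζ)
  have hy := (tendsto_add_one_div_smul x (-ζ)).eventually (ball_mem_nhds x hρ)
  have hge : ∀ᶠ m : ℕ in atTop, -(inner ℝ ζ (gradient f x) + μ - a) ≤
      ((m : ℝ) + 1) * (f (x + (1 / ((m : ℝ) + 1)) • (-ζ)) - f x) := by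
    filter_upwards [hy] with m hm
    set y := x + (1 / ((m : ℝ) + 1)) • (-ζ) with hydef
    have hm0 : (0 : ℝ) < (m : ℝ) + 1 := by positivity
    have h1 : f x - f y ≤ 1 / ((m : ℝ) + 1) * (inner ℝ ζ (gradient f x) + μ - a) := by
      refine le_of_forall_pos_le_add fun δ hδ => ?_
      obtain ⟨p, hp, hpc⟩ := h y hm δ hδ
      have e1 : x - y = (1 / ((m : ℝ) + 1)) • ζ := by rw [hydef]; module
      have h2 := hζ p
      rw [e1, real_inner_smul_right, real_inner_comm] at hpc
      rw [inner_sub_right] at h2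
      have h3 := mul_le_mul_of_nonneg_left
        (show inner ℝ ζ p ≤ inner ℝ ζ (gradient f x) + μ - a by linarith)
        (by positivity : 0 ≤ 1 / ((m : ℝ) + 1))
      linarith
    have h2 := mul_le_mul_of_nonneg_left h1 hm0.le
    rw [← mul_assoc, mul_one_div_cancel hm0.ne', one_mul] at h2
    linarith
  have h1 := ge_of_tendsto hlim hge
  rw [inner_neg_right, real_inner_comm] at h1
  linarith

namespace IsHam
variable {H : Ed n → Ed n → Ω → ℝ}

/-- Where the upper limit is strictly above a competitor, its gradient is controlled by the
competitor. -/
lemma gradient_upperLim_le (hH : IsHam τ H) {Hbar : Ed n → ℝ} {ω : Ω}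
    (hω : ∀ p, effHR H ω p = Hbar p) (hs : HasSlopes H Hbar ω) {U V : Set (Ed n)}
    {u : ℝ → Ed n → ℝ} (hu : LocUnif U u)
    (husub : ∀ ε > 0, AbsSubmin (fun p x => H p (ε⁻¹ • x) ω) U (u ε))
    (hV : IsOpen V) (hVc : IsCompact (closure V)) (hVU : closure V ⊆ U) {v : Ed n → ℝ} {K : ℝ≥0}
    (hv : LipschitzWith K v) (heq : ∀ x ∈ frontier V, v x = upperLim u x) {μ μ' : ℝ}
    (hμ : μ < μ')
    (hle : ∀ᵐ x ∂(volume : Measure (Ed n)), x ∈ V → Hbar (gradient v x) ≤ μ) {x₀ : Ed n}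
    (hx₀ : x₀ ∈ V) (hlt : v x₀ < upperLim u x₀) (hdiff : DifferentiableAt ℝ (upperLim u) x₀) :
    Hbar (gradient (upperLim u) x₀) ≤ μ' := by
  have hHb : Hbar = effHR H ω := funext fun p => (hω p).symm
  obtain ⟨μ₁, hμ₁, hμ₁'⟩ := exists_between hμ
  have hVsub : V ⊆ U := subset_closure.trans hVU
  obtain ⟨δ, hδ, hδv⟩ : ∃ δ > 0, v x₀ + 8 * δ = upperLim u x₀ :=
    ⟨(upperLim u x₀ - v x₀) / 8, by linarith, by ring⟩
  set D := closure V ∩ {x | v x + δ ≤ upperLim u x} with hD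
  have hDcl : IsClosed D := by
    have := ((hu.continuousOn_upperLim.mono hVU).sub hv.continuous.continuousOn).preimage_isClosed_of_isClosed
      isClosed_closure (isClosed_Ici (a := δ))
    convert this using 1
    ext x
    simp only [hD, mem_inter_iff, Set.mem_ofPred_eq, mem_preimage, mem_Ici]
    refine and_congr_right fun _ => ?_
    rw [Pi.sub_apply, le_sub_iff_add_le']
  have hDc : IsCompact D := hVc.of_isClosed_subset hDcl inter_subset_left
  have hDV : D ⊆ V := by
    rintro x ⟨hx, hxd⟩
    by_contra hxV
    have h1 := heq x ⟨hx, by rwa [hV.interior_eq]⟩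
    have h2 : v x + δ ≤ upperLim u x := hxd
    linarith
  obtain ⟨r, hr, hrV⟩ := hDc.exists_cthickening_subset_open hV hDV
  set W := thickening (r / 2) D with hWdef
  have hW : IsOpen W := isOpen_thickening
  have hDW : D ⊆ W := self_subset_thickening (half_pos hr) D
  have hWV : ∀ x ∈ W, ball x (2 * (r / 4)) ⊆ V := by
    intro x hx y hy
    obtain ⟨z, hz, hxz⟩ := mem_thickening_iff.1 hx
    refine hrV (mem_cthickening_of_dist_le y z r D hz ?_)
    have h1 : dist y x < 2 * (r / 4) := hy
    linarith [dist_triangle y x z]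
  have hWV' : W ⊆ V := fun x hx => hWV x hx (mem_ball_self (by positivity))
  obtain ⟨A, hA⟩ := hVc.isBounded.exists_norm_le
  obtain ⟨ε₀, hε₀, hcomp⟩ := hH.exists_competitor hω hv hμ₁ (by positivity : 0 < r / 4) hδ hle hW
    hWV (fun x hx => hA x (subset_closure hx))
  have hx₀D : x₀ ∈ D := ⟨subset_closure hx₀, by
    have : v x₀ + δ ≤ upperLim u x₀ := by linarith
    exact this⟩
  obtain ⟨L, r₁, hr₁, hr₁U, hL, -⟩ := hu.exists_lipschitz (hVsub hx₀)
  obtain ⟨r₂, hr₂, hr₂W⟩ := Metric.isOpen_iff.1 hW x₀ (hDW hx₀D)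
  set ρ := min (min r₁ r₂) (2 * δ / (L + K + 1)) with hρdef
  have hρ : 0 < ρ := lt_min (lt_min hr₁ hr₂) (by positivity)
  have hρ₁ : ball x₀ ρ ⊆ ball x₀ r₁ :=
    ball_subset_ball ((min_le_left _ _).trans (min_le_left _ _))
  have hρW : ball x₀ ρ ⊆ W :=
    (ball_subset_ball ((min_le_left _ _).trans (min_le_right _ _))).trans hr₂W
  have hρδ : (L + K) * ρ ≤ 2 * δ := by
    have h1 : ρ ≤ 2 * δ / (L + K + 1) := min_le_right _ _
    rw [le_div_iff₀ (by positivity)] at h1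
    linarith
  have hev : ∀ᶠ ε in nhdsWithin 0 (Ioi 0), upperLim u x₀ - δ < u ε x₀ →
      ∀ᵐ z ∂(volume : Measure (Ed n)), z ∈ ball x₀ ρ → H (gradient (u ε) z) (ε⁻¹ • z) ω ≤ μ₁ := by
    filter_upwards [hu.eventually_le_upperLim_add hVc hVU hδ, self_mem_nhdsWithin,
      nhdsWithin_le_nhds (Iio_mem_nhds hε₀)] with ε huε hε0 hεε hux₀
    obtain ⟨v', hv'v, ⟨K', hK'⟩, hv'H⟩ := hcomp ε hε0 hεε
    obtain ⟨w, hwK, hwe⟩ := hK'.extend_real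
    set V' := W ∩ {x | w x + 3 * δ < u ε x} with hV'
    have huc : ContinuousOn (u ε) (closure V) := (hu.continuousOn hε0).mono hVU
    have hcont : ContinuousOn (fun x => u ε x - w x) (closure V) :=
      huc.sub hwK.continuous.continuousOn
    have hV'o : IsOpen V' := by
      have := (hcont.mono (hWV'.trans subset_closure)).isOpen_inter_preimage hW
        (isOpen_Ioi (a := 3 * δ))
      convert this using 1
      ext x
      simp only [hV', mem_inter_iff, Set.mem_ofPred_eq, mem_preimage, mem_Ioi]
      exact and_congr_right fun _ => lt_sub_iff_add_lt'.symm
    have hV'D : V' ⊆ D := by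
      rintro x ⟨hxW, hx⟩
      have h1 : w x + 3 * δ < u ε x := hx
      have hxV := subset_closure (hWV' hxW)
      have h2 := huε x hxV
      have h3 := (abs_le.1 (hv'v x hxW)).1
      rw [hwe hxW] at h3
      refine ⟨hxV, ?_⟩
      have : v x + δ ≤ upperLim u x := by linarith
      exact this
    have hclD : closure V' ⊆ D := hDcl.closure_subset_iff.2 hV'D
    have hclV : closure V' ⊆ closure V := hclD.trans inter_subset_left
    have hgrad : ∀ᵐ z ∂(volume : Measure (Ed n)), z ∈ V' →
        H (gradient (fun x => w x + 3 * δ) z) (ε⁻¹ • z) ω ≤ μ₁ := by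
      filter_upwards [hv'H] with z hz hzV
      have h1 : gradient (fun x => w x + 3 * δ) z = gradient v' z := by
        have h2 : w =ᶠ[nhds z] v' := by
          filter_upwards [hW.mem_nhds hzV.1] with q hq using (hwe hq).symm
        rw [← h2.gradient_eq, gradient, gradient, fderiv_add_const]
      rw [h1]
      exact hz hzV.1
    have key := (husub ε hε0).ae_le hV'o (hDc.of_isClosed_subset isClosed_closure hclD)
      (hclV.trans hVU) ((hwK.add (LipschitzWith.const (3 * δ))).lipschitzOnWith (s := closure V'))
      (fun x hx => by have : w x + 3 * δ < u ε x := hx.2; exact this.le) (fun x hx => by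
        have hxcl : x ∈ closure V' := hx.1
        have hxnot : x ∉ V' := by
          have := hx.2
          rwa [hV'o.interior_eq] at this
        have h1 : ¬ w x + 3 * δ < u ε x := fun h => hxnot ⟨hDW (hclD hxcl), h⟩
        have h2 : 3 * δ ≤ u ε x - w x := by
          refine le_on_closure (s := V') (fun y hy => ?_) continuousOn_const (hcont.mono hclV) hxcl
          have : w y + 3 * δ < u ε y := hy.2
          linarith
        linarith) hgrad
    filter_upwards [key] with z hz hzb
    refine hz ⟨hρW hzb, ?_⟩
    have h1 := (hL ε hε0).dist_le_mul x₀ (mem_ball_self hr₁) z (hρ₁ hzb)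
    have h2 := hv.dist_le_mul z x₀
    have h3 := (abs_le.1 (hv'v z (hρW hzb))).2
    rw [hwe (hρW hzb)] at h3
    have h4 : dist z x₀ < ρ := hzb
    rw [Real.dist_eq] at h1 h2
    rw [dist_comm] at h1
    have h5 := le_abs_self (u ε x₀ - u ε z)
    have h6 := le_abs_self (v z - v x₀)
    have h7 : (L + K) * dist z x₀ ≤ (L + K) * ρ := by gcongr
    have : w z + 3 * δ < u ε z := by linarith
    exact this
  refine le_of_slope_bounds (by rw [hHb]; exact hH.convexOn_effHR ω) hdiff (half_pos hρ)
    fun y hy d hd => ?_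
  exact hs.exists_upperLim hu hρ (hρ₁.trans hr₁U) hμ₁' hd
    (fun ε hε => (hL ε hε).mono hρ₁) hδ hev hy

end IsHam
end Homogenize

section HomogenizeSub
set_option linter.unusedSectionVars false
variable {n : ℕ} {Ω : Type*} [MeasurableSpace Ω] {τ : Ed n → Ω → Ω}

lemma gradient_eq_of_isLocalMin_sub {f g : Ed n → ℝ} {x : Ed n} (hf : DifferentiableAt ℝ f x)
    (hg : DifferentiableAt ℝ g x) (h : IsLocalMin (fun y => f y - g y) x) :
    gradient f x = gradient g x := by
  have h1 := h.fderiv_eq_zero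
  rw [fderiv_fun_sub hf hg, sub_eq_zero] at h1
  rw [gradient, gradient, h1]

lemma LocUnif.locallyLipschitz_upperLim {U : Set (Ed n)} {u : ℝ → Ed n → ℝ} (hu : LocUnif U u) :
    ∀ x ∈ U, ∃ K : ℝ≥0, ∃ t ∈ nhdsWithin x U, LipschitzOnWith K (upperLim u) t := by
  intro x hx
  obtain ⟨L, r, hr, -, -, h1⟩ := hu.exists_lipschitz hx
  exact ⟨L, ball x r, mem_nhdsWithin_of_mem_nhds (ball_mem_nhds x hr), h1⟩

/-- At a good realization the upper limit of absolute subminimizers is an absolute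
subminimizer for the effective Hamiltonian. -/
lemma IsHam.absSubmin_upperLim {H : Ed n → Ed n → Ω → ℝ} (hH : IsHam τ H) {Hbar : Ed n → ℝ}
    {ω : Ω} (hω : ∀ p, effHR H ω p = Hbar p) (hs : HasSlopes H Hbar ω) {U : Set (Ed n)}
    {u : ℝ → Ed n → ℝ} (hu : LocUnif U u)
    (husub : ∀ ε > 0, AbsSubmin (fun p x => H p (ε⁻¹ • x) ω) U (u ε)) :
    AbsSubmin (fun p _ => Hbar p) U (upperLim u) := by
  refine ⟨hu.locallyLipschitz_upperLim, fun V hV hVc hVU v ⟨K, hv⟩ hvu heq => ?_⟩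
  obtain ⟨g, hg, hgv⟩ := hv.extend_real
  have hcoe : ∀ M : ℝ, (∀ᵐ x ∂volume.restrict V, ((Hbar (gradient v x) : ℝ) : EReal) ≤ M) →
      ∀ᵐ x ∂volume.restrict V, ((Hbar (gradient (upperLim u) x) : ℝ) : EReal) ≤ M := by
    intro μ hμ
    rw [ae_restrict_iff' hV.measurableSet] at hμ ⊢
    have hgrad : ∀ x ∈ V, gradient v x = gradient g x := fun x hx =>
      (Filter.eventuallyEq_of_mem (hV.mem_nhds hx)
        fun y hy => hgv (subset_closure hy)).gradient_eq
    have hle : ∀ᵐ x ∂(volume : Measure (Ed n)), x ∈ V → Hbar (gradient g x) ≤ μ := by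
      filter_upwards [hμ] with x hx hxV
      rw [← hgrad x hxV]
      exact EReal.coe_le_coe_iff.1 (hx hxV)
    filter_upwards [hle, hu.ae_differentiableAt_upperLim hV hVc hVU,
      hg.ae_differentiableAt (μ := volume)] with x hx hxd hgd hxV
    refine EReal.coe_le_coe_iff.2 ?_
    have hgu : ∀ y ∈ V, g y ≤ upperLim u y := fun y hy => by
      rw [← hgv (subset_closure hy)]; exact hvu y hy
    rcases (hgu x hxV).eq_or_lt with h | h
    · rw [gradient_eq_of_isLocalMin_sub (hxd hxV) hgd]
      · exact hx hxV
      · filter_upwards [hV.mem_nhds hxV] with y hy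
        linarith [hgu y hy]
    · refine le_of_forall_gt_imp_ge_of_dense fun μ' hμ' => ?_
      exact hH.gradient_upperLim_le hω hs hu husub hV hVc hVU hg
        (fun y hy => by rw [← hgv (frontier_subset_closure hy)]; exact heq y hy) hμ' hle hxV h
        (hxd hxV)
  refine essSup_le_of_ae_le _ ?_
  have hM := ae_le_essSup (μ := volume.restrict V)
    (f := fun x => ((Hbar (gradient v x) : ℝ) : EReal))
  induction hE : essSup (fun x => ((Hbar (gradient v x) : ℝ) : EReal)) (volume.restrict V) with
  | top => exact Eventually.of_forall fun _ => le_top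
  | coe M => exact hcoe M (by rwa [hE] at hM)
  | bot =>
    rw [hE] at hM
    filter_upwards [hM] with x hx
    exact absurd (le_bot_iff.1 hx) (EReal.coe_ne_bot _)

lemma gradient_fun_neg (f : Ed n → ℝ) (x : Ed n) :
    gradient (fun y => -f y) x = -gradient f x := by
  rw [gradient, gradient, fderiv_fun_neg, map_neg]

lemma lipschitzOnWith_fun_neg_iff {K : ℝ≥0} {f : Ed n → ℝ} {s : Set (Ed n)} :
    LipschitzOnWith K (fun y => -f y) s ↔ LipschitzOnWith K f s := by
  simp only [lipschitzOnWith_iff_dist_le_mul, dist_neg_neg]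

lemma absSupermin_iff {G : Ed n → Ed n → ℝ} {U : Set (Ed n)} {u : Ed n → ℝ} :
    AbsSupermin G U u ↔ AbsSubmin (fun p x => G (-p) x) U (fun x => -u x) := by
  unfold AbsSupermin AbsSubmin
  simp only [lipschitzOnWith_fun_neg_iff, gradient_fun_neg, neg_neg]
  refine and_congr_right fun _ => forall₄_congr fun V _ _ _ => ?_
  constructor
  · rintro h v ⟨K, hK⟩ h1 h2
    have := h (fun x => -v x) ⟨K, lipschitzOnWith_fun_neg_iff.2 hK⟩
      (fun x hx => le_neg.1 (h1 x hx)) (fun x hx => by rw [h2 x hx, neg_neg])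
    simpa only [gradient_fun_neg] using this
  · rintro h v ⟨K, hK⟩ h1 h2
    have := h (fun x => -v x) ⟨K, lipschitzOnWith_fun_neg_iff.2 hK⟩
      (fun x hx => neg_le_neg (h1 x hx)) (fun x hx => by rw [h2 x hx])
    simpa only [gradient_fun_neg, neg_neg] using this

lemma effHR_neg (H : Ed n → Ed n → Ω → ℝ) (ω : Ω) (p : Ed n) :
    effHR (fun p => H (-p)) ω p = effHR H ω (-p) := by
  have key : ∀ (H : Ed n → Ed n → Ω → ℝ) (p : Ed n),
      effSetR (fun p => H (-p)) ω p ⊆ effSetR H ω (-p) := by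
    rintro H p μ ⟨w, ⟨K, hK⟩, hw, hle⟩
    refine ⟨fun y => -w y, ⟨K, hK.neg⟩, by simpa [neg_div] using hw.neg, ?_⟩
    filter_upwards [hle] with y hy
    rwa [gradient_fun_neg, ← neg_add]
  unfold effHR
  congr 1
  refine (key H p).antisymm ?_
  have := key (fun p => H (-p)) (-p)
  simpa only [neg_neg] using this

lemma IsHam.comp_neg {H : Ed n → Ed n → Ω → ℝ} (hH : IsHam τ H) : IsHam τ (fun p => H (-p)) where
  meas p := hH.meas (-p)
  stat p := hH.stat (-p)
  conv y ω := by
    have := (hH.conv y ω).comp_linearMap (-LinearMap.id)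
    simpa [Function.comp_def] using this
  coer ω C := by
    obtain ⟨R, hR⟩ := hH.coer ω C
    exact ⟨R, fun p y hp => hR (-p) y (by rwa [norm_neg])⟩
  bdd R hR := by
    obtain ⟨C, hC⟩ := hH.bdd R hR
    exact ⟨C, fun ω p y hp => hC ω (-p) y (by rwa [norm_neg])⟩
  equi R hR ε hε := by
    obtain ⟨δ, hδ, h⟩ := hH.equi R hR ε hε
    exact ⟨δ, hδ, fun ω p₁ p₂ y₁ y₂ h1 h2 h3 h4 => h ω (-p₁) (-p₂) y₁ y₂ (by rwa [norm_neg])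
      (by rwa [norm_neg]) (by rwa [dist_neg_neg]) h4⟩

lemma LocUnif.neg {U : Set (Ed n)} {u : ℝ → Ed n → ℝ} (hu : LocUnif U u) :
    LocUnif U (fun ε x => -u ε x) := by
  intro x hx
  obtain ⟨L, C, r, hr, hrU, h⟩ := hu x hx
  exact ⟨L, C, r, hr, hrU, fun ε hε => ⟨lipschitzOnWith_fun_neg_iff.2 (h ε hε).1, fun y hy => by
    rw [abs_neg]; exact (h ε hε).2 y hy⟩⟩

lemma limsup_neg_eq_neg_liminf {ι : Type*} (g : ι → ℝ) (f : Filter ι) :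
    limsup (fun i => -g i) f = -liminf g f := by
  rw [limsup_eq, liminf_eq, Real.sInf_def]
  congr 2
  ext a
  simp only [Set.mem_neg, Set.mem_ofPred_eq, neg_le_neg_iff]

/-- At a good realization the lower limit of absolute superminimizers is an absolute
superminimizer for the effective Hamiltonian. -/
lemma IsHam.absSupermin_lowerLim {H : Ed n → Ed n → Ω → ℝ} (hH : IsHam τ H) {Hbar : Ed n → ℝ}
    {ω : Ω} (hω : ∀ p, effHR H ω p = Hbar p)
    (hs : HasSlopes (fun p => H (-p)) (fun p => Hbar (-p)) ω) {U : Set (Ed n)}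
    {u : ℝ → Ed n → ℝ} (hu : LocUnif U u)
    (husup : ∀ ε > 0, AbsSupermin (fun p x => H p (ε⁻¹ • x) ω) U (u ε)) :
    AbsSupermin (fun p _ => Hbar p) U
      (fun x => liminf (fun ε => u ε x) (nhdsWithin 0 (Ioi 0))) := by
  rw [absSupermin_iff]
  have := hH.comp_neg.absSubmin_upperLim (Hbar := fun p => Hbar (-p))
    (fun p => by rw [effHR_neg, hω]) hs hu.neg fun ε hε =>
      (absSupermin_iff (G := fun p x => H p (ε⁻¹ • x) ω)).1 (husup ε hε)
  convert this using 1
  ext x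
  exact (limsup_neg_eq_neg_liminf _ _).symm

end HomogenizeSub

section Reduction
variable {n : ℕ} {Ω : Type*}

/-- The σ-algebra generated by the evaluations of a random Hamiltonian. -/
abbrev hamSigma (H : Ed n → Ed n → Ω → ℝ) : MeasurableSpace Ω :=
  ⨆ p, ⨆ y, MeasurableSpace.comap (H p y) inferInstance

lemma hamSigma_le {m : MeasurableSpace Ω} {H : Ed n → Ed n → Ω → ℝ}
    (h : ∀ p y, Measurable (H p y)) : hamSigma H ≤ m :=
  iSup₂_le fun p y => (h p y).comap_le

lemma measurable_hamSigma (H : Ed n → Ed n → Ω → ℝ) (p y : Ed n) :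
    Measurable[hamSigma H] (H p y) :=
  Measurable.mono (comap_measurable (H p y))
    (le_iSup₂ (f := fun p y => MeasurableSpace.comap (H p y) inferInstance) p y) le_rfl

lemma measurable_hamSigma_iff {β : Type*} {m : MeasurableSpace β} {H : Ed n → Ed n → Ω → ℝ}
    {f : β → Ω} : @Measurable _ _ m (hamSigma H) f ↔ ∀ p y, Measurable fun b => H p y (f b) := by
  rw [measurable_iff_le_map, hamSigma, iSup₂_le_iff]
  refine forall₂_congr fun p y => ?_
  rw [MeasurableSpace.comap_le_iff_le_map, MeasurableSpace.map_comp, ← measurable_iff_le_map]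
  rfl

lemma measurable_hamSigma_action {τ : Ed n → Ω → Ω} {H : Ed n → Ed n → Ω → ℝ}
    (hstat : ∀ p y z ω, H p y (τ z ω) = H p (y + z) ω)
    (hcont : ∀ p ω, Continuous fun y => H p y ω) :
    Measurable[@Prod.instMeasurableSpace _ _ _ (hamSigma H), hamSigma H]
      fun q : Ed n × Ω => τ q.1 q.2 := by
  let := hamSigma H
  refine measurable_hamSigma_iff.2 fun p z => ?_
  simp only [hstat]
  exact measurable_uncurry_of_continuous_of_measurable
    (u := fun (y : Ed n) (ω : Ω) => H p (z + y) ω)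
    (fun ω => (hcont p ω).comp (continuous_const.add continuous_id))
    fun y => measurable_hamSigma H p (z + y)

variable [mΩ : MeasurableSpace Ω] {P : Measure Ω} {τ : Ed n → Ω → Ω}
  {H : Ed n → Ed n → Ω → ℝ}

lemma IsHam.continuous_right (hH : IsHam τ H) (p : Ed n) (ω : Ω) :
    Continuous fun y => H p y ω := by
  rw [Metric.continuous_iff]
  intro y ε hε
  obtain ⟨δ, hδ, h⟩ := hH.equi (‖p‖ + 1) (by positivity) (ε / 2) (half_pos hε)
  refine ⟨δ, hδ, fun y' hy' => ?_⟩
  have := h ω p p y' y (by linarith) (by linarith) (by simpa using hδ) hy'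
  rw [Real.dist_eq]
  linarith

lemma IsHam.hamSigma (hH : IsHam τ H) : @IsHam n Ω (hamSigma H) τ H :=
  @IsHam.mk n Ω (_root_.hamSigma H) τ H (measurable_hamSigma H) hH.stat hH.conv hH.coer hH.bdd
    hH.equi

lemma IsHam.isErgodicAction_trim (hH : IsHam τ H) (hτmp : ∀ y, MeasurePreserving (τ y) P P)
    (hτadd : ∀ y z ω, τ (y + z) ω = τ y (τ z ω)) (hτ0 : ∀ ω, τ 0 ω = ω)
    (herg : ∀ D : Set Ω, MeasurableSet D → (∀ z, τ z ⁻¹' D = D) → P D = 0 ∨ P D = 1) :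
    @IsErgodicAction n Ω (_root_.hamSigma H) (P.trim (hamSigma_le hH.meas)) τ := by
  have hm := hamSigma_le hH.meas
  have hmeas : ∀ y, @Measurable _ _ (_root_.hamSigma H) (_root_.hamSigma H) (τ y) := fun y => by
    refine measurable_hamSigma_iff.2 fun p z => ?_
    simp only [hH.stat]
    exact measurable_hamSigma H p (z + y)
  refine @IsErgodicAction.mk n Ω (_root_.hamSigma H) (P.trim hm) τ ?_
    (fun y => @MeasurePreserving.mk Ω Ω (_root_.hamSigma H) (_root_.hamSigma H) (τ y) (P.trim hm)
      (P.trim hm) (hmeas y) ?_) hτadd hτ0 fun D hD hinv => ?_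
  · exact measurable_hamSigma_action hH.stat hH.continuous_right
  · refine @Measure.ext _ (_root_.hamSigma H) _ _ fun s hs => ?_
    rw [@Measure.map_apply _ _ (_root_.hamSigma H) (_root_.hamSigma H) _ _ (hmeas y) _ hs,
      trim_measurableSet_eq hm (hmeas y hs), trim_measurableSet_eq hm hs,
      (hτmp y).measure_preimage (hm s hs).nullMeasurableSet]
  · rw [trim_measurableSet_eq hm hD]
    exact herg D (hm D hD) hinv

/-- For an action that need not be jointly measurable, almost every realization still has the
slope property. -/
lemma IsHam.ae_hasSlopes [IsProbabilityMeasure P] (hH : IsHam τ H) (hτmp : ∀ y, MeasurePreserving (τ y) P P)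
    (hτadd : ∀ y z ω, τ (y + z) ω = τ y (τ z ω)) (hτ0 : ∀ ω, τ 0 ω = ω)
    (herg : ∀ D : Set Ω, MeasurableSet D → (∀ z, τ z ⁻¹' D = D) → P D = 0 ∨ P D = 1)
    {Hbar : Ed n → ℝ} (hHbar : ∀ᵐ ω ∂P, ∀ p, effHR H ω p = Hbar p) :
    ∀ᵐ ω ∂P, HasSlopes H Hbar ω := by
  have hm := hamSigma_le hH.meas
  have hprob : @IsProbabilityMeasure Ω (_root_.hamSigma H) (P.trim hm) :=
    @IsProbabilityMeasure.mk Ω (_root_.hamSigma H) (P.trim hm)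
      ((trim_measurableSet_eq hm MeasurableSet.univ).trans measure_univ)
  have key := ae_of_ae_trim hm (@IsHam.ae_exists_slope_of_subsolutions n Ω (_root_.hamSigma H)
    (P.trim hm) τ H hprob (hH.isErgodicAction_trim hτmp hτadd hτ0 herg) hH.hamSigma)
  filter_upwards [key] with ω hω L μ μ' r c x y ε u h1 h2 h3 h4 h5 h6 h7 δ hδ
  obtain ⟨p, hp, hpc⟩ := hω L μ μ' r c x y ε u h1 h2 h3 h4 h5 h6 h7 δ hδ
  obtain ⟨ω', hω', hb⟩ := ((ae_of_ae_trim hm hp).and hHbar).exists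
  exact ⟨p, hb p ▸ hω', hpc⟩

end Reduction

/-- Homogenization of absolute sub- and superminimizers: the effective Hamiltonian is convex,
continuous and coercive, and almost surely the `limsup` (resp. `liminf`) as `ε → 0` of a family
of absolute subminimizers (resp. superminimizers) for `H^ε` is an absolute subminimizer
(resp. superminimizer) for `H̄`. -/
theorem stmt_3
    (n : ℕ) (hn : 1 ≤ n)
    {Ω : Type*} [MeasurableSpace Ω] (P : Measure Ω) [IsProbabilityMeasure P]
    (τ : Ed n → Ω → Ω)
    (hτmeas : ∀ y, Measurable (τ y))
    (hτmp : ∀ y, MeasurePreserving (τ y) P P)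
    (hτgrp : ∀ y z, τ (y + z) = τ y ∘ τ z) (hτ0 : τ 0 = id)
    (herg : ∀ D : Set Ω, MeasurableSet D → (∀ z, τ z ⁻¹' D = D) → P D = 0 ∨ P D = 1)
    (H : Ed n → Ed n → Ω → ℝ)
    (hHmeas : ∀ p, Measurable (fun q : Ed n × Ω => H p q.1 q.2))
    (hHstat : ∀ p y z ω, H p y (τ z ω) = H p (y + z) ω)
    (hHconv : ∀ y ω, ConvexOn ℝ Set.univ (fun p => H p y ω))
    (hHcoer : ∀ ω, ∀ C : ℝ, ∃ R : ℝ, ∀ p y, R ≤ ‖p‖ → C ≤ H p y ω)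
    (hHbdd : ∀ R > (0 : ℝ), ∃ C : ℝ, ∀ ω p y, ‖p‖ < R → |H p y ω| ≤ C)
    (hHequi : ∀ R > (0 : ℝ), ∀ ε > (0 : ℝ), ∃ δ > (0 : ℝ), ∀ (ω : Ω) (p₁ p₂ y₁ y₂ : Ed n),
      ‖p₁‖ < R → ‖p₂‖ < R → dist p₁ p₂ < δ → dist y₁ y₂ < δ →
      |H p₁ y₁ ω - H p₂ y₂ ω| ≤ ε)
    (Hbar : Ed n → ℝ)
    (hHbar : ∀ᵐ ω ∂P, ∀ p : Ed n, effHR H ω p = Hbar p)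
    (U : Set (Ed n)) (hU : IsOpen U)
    (u : ℝ → Ed n → Ω → ℝ)
    (husub : ∀ ω : Ω, ∀ ε > (0 : ℝ),
      AbsSubmin (fun p x => H p (ε⁻¹ • x) ω) U (fun x => u ε x ω))
    (huloc : ∀ ω : Ω, ∀ x ∈ U, ∃ L : ℝ≥0, ∃ C : ℝ, ∃ t ∈ nhdsWithin x U, ∀ ε > (0 : ℝ),
      LipschitzOnWith L (fun y => u ε y ω) t ∧ ∀ y ∈ t, |u ε y ω| ≤ C)
    (v : ℝ → Ed n → Ω → ℝ)
    (hvsup : ∀ ω : Ω, ∀ ε > (0 : ℝ),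
      AbsSupermin (fun p x => H p (ε⁻¹ • x) ω) U (fun x => v ε x ω))
    (hvloc : ∀ ω : Ω, ∀ x ∈ U, ∃ L : ℝ≥0, ∃ C : ℝ, ∃ t ∈ nhdsWithin x U, ∀ ε > (0 : ℝ),
      LipschitzOnWith L (fun y => v ε y ω) t ∧ ∀ y ∈ t, |v ε y ω| ≤ C) :
    (ConvexOn ℝ Set.univ Hbar ∧ Continuous Hbar ∧
        Tendsto Hbar (cocompact (Ed n)) atTop) ∧
    ∃ Ω' : Set Ω, MeasurableSet Ω' ∧ P Ω' = 1 ∧ ∀ ω ∈ Ω',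
      AbsSubmin (fun p _ => Hbar p) U
        (fun x => limsup (fun ε => u ε x ω) (nhdsWithin 0 (Set.Ioi 0))) ∧
      AbsSupermin (fun p _ => Hbar p) U
        (fun x => liminf (fun ε => v ε x ω) (nhdsWithin 0 (Set.Ioi 0))) := by
  have hH : IsHam τ H :=
    ⟨fun p y => (hHmeas p).comp measurable_prodMk_left, hHstat, hHconv, hHcoer, hHbdd, hHequi⟩
  have hτadd : ∀ y z ω, τ (y + z) ω = τ y (τ z ω) := fun y z ω => congrFun (hτgrp y z) ω
  have hτzero : ∀ ω, τ 0 ω = ω := fun ω => congrFun hτ0 ω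
  refine ⟨?_, ?_⟩
  · obtain ⟨ω, hω⟩ := hHbar.exists
    obtain rfl : effHR H ω = Hbar := funext hω
    exact ⟨hH.convexOn_effHR ω, (hH.convexOn_effHR ω).continuous_univ, hH.tendsto_effHR ω⟩
  have hneg : ∀ᵐ ω ∂P, ∀ p, effHR (fun p => H (-p)) ω p = Hbar (-p) := by
    filter_upwards [hHbar] with ω hω p
    rw [effHR_neg, hω]
  have hall := (hHbar.and (hH.ae_hasSlopes hτmp hτadd hτzero herg hHbar)).and
    (hH.comp_neg.ae_hasSlopes hτmp hτadd hτzero herg hneg)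
  obtain ⟨Ω', hΩ', hmeas, hsub⟩ := hall.exists_measurable_mem
  refine ⟨Ω', hmeas, (mem_ae_iff_prob_eq_one hmeas).1 hΩ', fun ω hω => ?_⟩
  obtain ⟨⟨h1, h2⟩, h3⟩ := hsub ω hω
  exact ⟨hH.absSubmin_upperLim h1 h2 (locUnif_of_nhdsWithin hU (huloc ω)) (husub ω),
    hH.absSupermin_lowerLim h1 h3 (locUnif_of_nhdsWithin hU (hvloc ω)) (hvsup ω)⟩


end
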